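/- arXiv:math/0204112 — 2 statements merged into one kernel-verified Lean document; each statement's English description precedes it below -/
import Mathlib

section
/- Let A and B be Morita equivalent m-regular involutive quantales. Then the centres Cen(A) and Cen(B) are isomorphic as involutive quantales; an isomorphism γ : Cen(A) → Cen(B) is given, via an imprimitivity A–B bimodule X implementing the equivalence, by γ(f)(⋁ᵢ⟨xᵢ, rᵢ•yᵢ⟩_B) = ⋁ᵢ⟨xᵢ, f(rᵢ)•yᵢ⟩_B. -/
universe u v w

set_option autoImplicit false

/-- An involutive quantale: a complete lattice with an associative multiplication
distributing over arbitrary joins in both arguments, together with an involution. -/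
class InvQuantale (A : Type u) extends CompleteLattice A, Mul A, Star A where
  qmul_assoc : ∀ a b c : A, a * b * c = a * (b * c)
  mul_sSup : ∀ (a : A) (S : Set A), a * sSup S = ⨆ b ∈ S, a * b
  sSup_mul : ∀ (S : Set A) (a : A), sSup S * a = ⨆ b ∈ S, b * a
  qstar_star : ∀ a : A, star (star a) = a
  star_sSup : ∀ S : Set A, star (sSup S) = ⨆ a ∈ S, star a
  qstar_mul : ∀ a b : A, star (a * b) = star b * star a

namespace Quantale

variable {A : Type u} [InvQuantale A]

theorem mul_iSup {ι : Sort w} (a : A) (f : ι → A) :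
    (a * ⨆ i, f i) = ⨆ i, a * f i := by
  rw [iSup, InvQuantale.mul_sSup, iSup_range]

theorem iSup_mul {ι : Sort w} (f : ι → A) (a : A) :
    (⨆ i, f i) * a = ⨆ i, f i * a := by
  rw [iSup, InvQuantale.sSup_mul, iSup_range]

theorem star_iSup {ι : Sort w} (f : ι → A) :
    star (⨆ i, f i) = ⨆ i, star (f i) := by
  rw [iSup, InvQuantale.star_sSup, iSup_range]

end Quantale

/-- A quantale is unital if it has a two-sided unit for the multiplication. -/
def InvQuantale.IsUnital (A : Type u) [InvQuantale A] : Prop :=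
  ∃ e : A, ∀ a : A, e * a = a ∧ a * e = a
section Modules

/-- A right module over an involutive quantale. -/
class QMod (A : Type u) [InvQuantale A] (M : Type v) [CompleteLattice M] where
  act : M → A → M
  act_mul : ∀ (m : M) (a b : A), act m (a * b) = act (act m a) b
  sSup_act : ∀ (S : Set M) (a : A), act (sSup S) a = ⨆ m ∈ S, act m a
  act_sSup : ∀ (m : M) (S : Set A), act m (sSup S) = ⨆ a ∈ S, act m a

/-- The module action `m ⋄ a`. -/
abbrev qact {A : Type u} [InvQuantale A] {M : Type v} [CompleteLattice M] [QMod A M]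
    (m : M) (a : A) : M := QMod.act m a

/-- A right pre-Hilbert module over an involutive quantale. -/
class QPreHilb (A : Type u) [InvQuantale A] (M : Type v) [CompleteLattice M] extends
    QMod A M where
  ip : M → M → A
  ip_mul : ∀ (m n : M) (a : A), ip m n * a = ip m (act n a)
  sSup_ip : ∀ (S : Set M) (n : M), ip (sSup S) n = ⨆ m ∈ S, ip m n
  ip_sSup : ∀ (m : M) (S : Set M), ip m (sSup S) = ⨆ n ∈ S, ip m n
  star_ip : ∀ m n : M, star (ip m n) = ip n m

/-- The inner product `⟨m, n⟩` with values in `A`. -/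
abbrev qip (A : Type u) [InvQuantale A] {M : Type v} [CompleteLattice M] [QPreHilb A M]
    (m n : M) : A := QPreHilb.ip m n

/-- A right Hilbert module: a pre-Hilbert module whose inner product separates points. -/
class QHilb (A : Type u) [InvQuantale A] (M : Type v) [CompleteLattice M] extends
    QPreHilb A M where
  ip_sep : ∀ m n : M, (∀ p : M, ip p m = ip p n) → m = n

variable {A : Type u} [InvQuantale A]

theorem qact_iSup_left {M : Type v} [CompleteLattice M] [QMod A M] {ι : Sort w}
    (f : ι → M) (a : A) : qact (⨆ i, f i) a = ⨆ i, qact (f i) a := by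
  rw [iSup]; exact (QMod.sSup_act _ _).trans iSup_range

theorem qact_iSup_right {M : Type v} [CompleteLattice M] [QMod A M] {ι : Sort w}
    (m : M) (f : ι → A) : qact m (⨆ i, f i) = ⨆ i, qact m (f i) := by
  rw [iSup]; exact (QMod.act_sSup _ _).trans iSup_range

theorem qip_iSup_left {M : Type v} [CompleteLattice M] [QPreHilb A M] {ι : Sort w}
    (f : ι → M) (n : M) : qip A (⨆ i, f i) n = ⨆ i, qip A (f i) n := by
  rw [iSup]; exact (QPreHilb.sSup_ip _ _).trans iSup_range

theorem qip_iSup_right {M : Type v} [CompleteLattice M] [QPreHilb A M] {ι : Sort w}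
    (m : M) (f : ι → M) : qip A m (⨆ i, f i) = ⨆ i, qip A m (f i) := by
  rw [iSup]; exact (QPreHilb.ip_sSup _ _).trans iSup_range

/-- A module is essential if every element is a join of elements of the form `m ⋄ a`. -/
def Essential (A : Type u) [InvQuantale A] (M : Type v) [CompleteLattice M] [QMod A M] :
    Prop :=
  ∀ m : M, m = sSup {x : M | (∃ (p : M) (a : A), x = qact p a) ∧ x ≤ m}

/-- A module is separated by `A` if the right actions separate points. -/
def Separated (A : Type u) [InvQuantale A] (M : Type v) [CompleteLattice M] [QMod A M] :
    Prop :=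
  ∀ m n : M, (∀ a : A, qact m a = qact n a) → m = n

/-- A module is m-regular if it is essential and separated. -/
def MRegMod (A : Type u) [InvQuantale A] (M : Type v) [CompleteLattice M] [QMod A M] :
    Prop :=
  Essential A M ∧ Separated A M

/-- A pre-Hilbert module is full if every element of `A` is a join of inner products. -/
def FullMod (A : Type u) [InvQuantale A] (M : Type v) [CompleteLattice M] [QPreHilb A M] :
    Prop :=
  ∀ a : A, a = sSup {b : A | (∃ m n : M, b = qip A m n) ∧ b ≤ a}

/-- An involutive quantale with multiplication as right action on itself. -/
instance selfQMod : QMod A A where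
  act m a := m * a
  act_mul m a b := (InvQuantale.qmul_assoc m a b).symm
  sSup_act S a := InvQuantale.sSup_mul S a
  act_sSup m S := InvQuantale.mul_sSup m S

/-- An involutive quantale as a pre-Hilbert module over itself, with `⟨a, b⟩ = a⋆ · b`. -/
instance selfQPreHilb : QPreHilb A A where
  ip a b := star a * b
  ip_mul m n a := InvQuantale.qmul_assoc _ _ _
  sSup_ip S n := by
    show star (sSup S) * n = ⨆ m ∈ S, star m * n
    rw [InvQuantale.star_sSup]
    simp only [Quantale.iSup_mul]
  ip_sSup m S := InvQuantale.mul_sSup _ S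
  star_ip m n := by
    rw [InvQuantale.qstar_mul, InvQuantale.qstar_star]

/-- An involutive quantale is m-regular if it is m-regular as a right module over itself. -/
def InvQuantale.MReg (A : Type u) [InvQuantale A] : Prop := MRegMod A A

/-- If right multiplications separate the points of `A`, then `A` is a right Hilbert module
over itself. -/
def selfQHilb (hsep : ∀ a b : A, (∀ c : A, a * c = b * c) → a = b) : QHilb A A where
  toQPreHilb := selfQPreHilb
  ip_sep := by
    intro m n h
    have h2 : ∀ c : A, star m * c = star n * c := by
      intro c
      have h1 : star c * m = star c * n := h c
      have h3 := congrArg star h1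
      rw [InvQuantale.qstar_mul, InvQuantale.qstar_mul, InvQuantale.qstar_star] at h3
      exact h3
    have h4 := hsep _ _ h2
    have h5 := congrArg star h4
    rwa [InvQuantale.qstar_star, InvQuantale.qstar_star] at h5

end Modules
section Pi

variable {A : Type u} [InvQuantale A]

/-- Pointwise right module structure on a power of a module. -/
instance piQMod (J : Type w) (M : Type v) [CompleteLattice M] [QMod A M] :
    QMod A (J → M) where
  act v a := fun j => qact (v j) a
  act_mul v a b := funext fun j => QMod.act_mul (v j) a b
  sSup_act S a := by
    funext j
    show qact (sSup S j) a = _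
    rw [sSup_apply, qact_iSup_left, iSup_subtype]
    simp only [iSup_apply]
  act_sSup v S := by
    funext j
    show qact (v j) (sSup S) = _
    rw [show qact (v j) (sSup S) = ⨆ a ∈ S, qact (v j) a from QMod.act_sSup _ _]
    simp only [iSup_apply]

/-- Pointwise pre-Hilbert structure on a power of a pre-Hilbert module, with inner product
`⟨v, w⟩ = ⨆ j, ⟨v j, w j⟩`.  In particular `A^J` carries the inner product
`⟨(a_j), (b_j)⟩ = ⨆ j, a_j⋆ · b_j`. -/
instance piQPreHilb (J : Type w) (M : Type v) [CompleteLattice M] [QPreHilb A M] :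
    QPreHilb A (J → M) where
  ip v w := ⨆ j, qip A (v j) (w j)
  ip_mul v w a := by
    show (⨆ j, qip A (v j) (w j)) * a = ⨆ j, qip A (v j) (qact (w j) a)
    rw [Quantale.iSup_mul]
    exact iSup_congr fun j => QPreHilb.ip_mul _ _ _
  sSup_ip S w := by
    show (⨆ j, qip A (sSup S j) (w j)) = ⨆ v ∈ S, ⨆ j, qip A (v j) (w j)
    calc (⨆ j, qip A (sSup S j) (w j))
        = ⨆ j, ⨆ f : S, qip A ((f : J → M) j) (w j) := by
          refine iSup_congr fun j => ?_
          rw [sSup_apply, qip_iSup_left]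
      _ = ⨆ f : S, ⨆ j, qip A ((f : J → M) j) (w j) := iSup_comm
      _ = ⨆ v ∈ S, ⨆ j, qip A (v j) (w j) := by rw [iSup_subtype]
  ip_sSup v S := by
    show (⨆ j, qip A (v j) (sSup S j)) = ⨆ w ∈ S, ⨆ j, qip A (v j) (w j)
    calc (⨆ j, qip A (v j) (sSup S j))
        = ⨆ j, ⨆ f : S, qip A (v j) ((f : J → M) j) := by
          refine iSup_congr fun j => ?_
          rw [sSup_apply, qip_iSup_right]
      _ = ⨆ f : S, ⨆ j, qip A (v j) ((f : J → M) j) := iSup_comm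
      _ = ⨆ w ∈ S, ⨆ j, qip A (v j) (w j) := by rw [iSup_subtype]
  star_ip v w := by
    show star (⨆ j, qip A (v j) (w j)) = ⨆ j, qip A (w j) (v j)
    rw [Quantale.star_iSup]
    exact iSup_congr fun j => QPreHilb.star_ip _ _

end Pi

section Maps

variable {A : Type u} [InvQuantale A]

/-- A module homomorphism: a join-preserving map commuting with the action. -/
def IsModHom (A : Type u) [InvQuantale A] {M : Type v} {N : Type w}
    [CompleteLattice M] [CompleteLattice N] [QMod A M] [QMod A N] (f : M → N) : Prop :=
  (∀ S : Set M, f (sSup S) = ⨆ m ∈ S, f m) ∧ ∀ (m : M) (a : A), f (qact m a) = qact (f m) a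

/-- `g` is a ⋆-adjoint of `f`: `⟨f m, n⟩ = ⟨m, g n⟩`. -/
def IsAdjointPair (A : Type u) [InvQuantale A] {M : Type v} {N : Type w}
    [CompleteLattice M] [CompleteLattice N] [QPreHilb A M] [QPreHilb A N]
    (f : M → N) (g : N → M) : Prop :=
  ∀ (m : M) (n : N), qip A (f m) n = qip A m (g n)

/-- A map between (pre-)Hilbert modules is adjointable if it has a ⋆-adjoint. -/
def Adjointable (A : Type u) [InvQuantale A] {M : Type v} {N : Type w}
    [CompleteLattice M] [CompleteLattice N] [QPreHilb A M] [QPreHilb A N]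
    (f : M → N) : Prop :=
  ∃ g : N → M, IsAdjointPair A f g

theorem IsAdjointPair.symm' {M : Type v} {N : Type w}
    [CompleteLattice M] [CompleteLattice N] [QPreHilb A M] [QPreHilb A N]
    {f : M → N} {g : N → M} (h : IsAdjointPair A f g) : IsAdjointPair A g f := by
  intro n m
  calc qip A (g n) m = star (qip A m (g n)) := (QPreHilb.star_ip m (g n)).symm
    _ = star (qip A (f m) n) := by rw [h m n]
    _ = qip A n (f m) := QPreHilb.star_ip _ _

/-- The rank-one operator `Θ_{n,m} : x ↦ n ⋄ ⟨m, x⟩`. -/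
def theta (A : Type u) [InvQuantale A] {M : Type v} {N : Type w}
    [CompleteLattice M] [CompleteLattice N] [QPreHilb A M] [QPreHilb A N]
    (n : N) (m : M) : M → N :=
  fun x => qact n (qip A m x)

/-- A compact operator: an arbitrary (pointwise) join of rank-one operators `Θ_{n,m}`. -/
def IsCompactOp (A : Type u) [InvQuantale A] {M : Type v} {N : Type w}
    [CompleteLattice M] [CompleteLattice N] [QPreHilb A M] [QPreHilb A N]
    (f : M → N) : Prop :=
  ∃ S : Set (N × M), ∀ x : M, f x = ⨆ p ∈ S, theta A p.1 p.2 x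

end Maps

section LeftModules

/-- A left module over an involutive quantale. -/
class QLMod (A : Type u) [InvQuantale A] (M : Type v) [CompleteLattice M] where
  lact : A → M → M
  lact_mul : ∀ (a b : A) (m : M), lact (a * b) m = lact a (lact b m)
  sSup_lact : ∀ (S : Set A) (m : M), lact (sSup S) m = ⨆ a ∈ S, lact a m
  lact_sSup : ∀ (a : A) (S : Set M), lact a (sSup S) = ⨆ m ∈ S, lact a m

/-- A left pre-Hilbert module over an involutive quantale. -/
class QLPreHilb (A : Type u) [InvQuantale A] (M : Type v) [CompleteLattice M] extends
    QLMod A M where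
  lip : M → M → A
  lip_lact : ∀ (a : A) (m n : M), a * lip m n = lip (lact a m) n
  sSup_lip : ∀ (S : Set M) (n : M), lip (sSup S) n = ⨆ m ∈ S, lip m n
  lip_sSup : ∀ (m : M) (S : Set M), lip m (sSup S) = ⨆ n ∈ S, lip m n
  star_lip : ∀ m n : M, star (lip m n) = lip n m

/-- A left Hilbert module. -/
class QLHilb (A : Type u) [InvQuantale A] (M : Type v) [CompleteLattice M] extends
    QLPreHilb A M where
  lip_sep : ∀ m n : M, (∀ p : M, lip m p = lip n p) → m = n

/-- A left module is essential if every element is a join of elements `a • m`. -/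
def LEssential (A : Type u) [InvQuantale A] (M : Type v) [CompleteLattice M] [QLMod A M] :
    Prop :=
  ∀ m : M, m = sSup {x : M | (∃ (a : A) (p : M), x = QLMod.lact a p) ∧ x ≤ m}

/-- A left module is separated by `A` if the left actions separate points. -/
def LSeparated (A : Type u) [InvQuantale A] (M : Type v) [CompleteLattice M] [QLMod A M] :
    Prop :=
  ∀ m n : M, (∀ a : A, QLMod.lact a m = QLMod.lact a n) → m = n

/-- A left pre-Hilbert module is full if every element of `A` is a join of inner products. -/
def LFull (A : Type u) [InvQuantale A] (M : Type v) [CompleteLattice M] [QLPreHilb A M] :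
    Prop :=
  ∀ a : A, a = sSup {b : A | (∃ m n : M, b = QLPreHilb.lip m n) ∧ b ≤ a}

end LeftModules
open CategoryTheory

section Categories

variable {A : Type u} [InvQuantale A]

/-- An object of the category `mreg-Hilb_A` (or `mreg-HMOD_A`): an m-regular right
Hilbert `A`-module. -/
structure HObj (A : Type u) [InvQuantale A] : Type (u + 1) where
  carrier : Type u
  [lat : CompleteLattice carrier]
  [str : QHilb A carrier]
  ess : Essential A carrier
  sep : Separated A carrier

attribute [instance] HObj.lat HObj.str

instance : CoeSort (HObj A) (Type u) := ⟨HObj.carrier⟩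

/-- The category `mreg-Hilb_A` of m-regular right Hilbert `A`-modules with
adjointable maps as morphisms. -/
instance HObj.cat : Category.{u} (HObj A) where
  Hom M N := {f : M.carrier → N.carrier // Adjointable A f}
  id M := ⟨fun m => m, ⟨fun m => m, fun _ _ => rfl⟩⟩
  comp {M N P} f g := ⟨fun m => g.1 (f.1 m), by
    obtain ⟨f', hf⟩ := f.2
    obtain ⟨g', hg⟩ := g.2
    exact ⟨fun p => f' (g' p), fun m p => (hg (f.1 m) p).trans (hf m (g' p))⟩⟩
  id_comp f := Subtype.ext rfl
  comp_id f := Subtype.ext rfl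
  assoc f g h := Subtype.ext rfl

/-- Construct a morphism of `mreg-Hilb_A`. -/
def mkHom {M N : HObj A} (f : M.carrier → N.carrier) (hf : Adjointable A f) : M ⟶ N :=
  ⟨f, hf⟩

/-- The underlying function of a morphism. -/
def homFn {M N : HObj A} (f : M ⟶ N) : M.carrier → N.carrier := f.1

/-- The ⋆-adjoint of a morphism of `mreg-Hilb_A`. -/
noncomputable def hStar {M N : HObj A} (f : M ⟶ N) : N ⟶ M :=
  ⟨Classical.choose f.2, ⟨f.1, (Classical.choose_spec f.2).symm'⟩⟩

theorem hStar_adj {M N : HObj A} (f : M ⟶ N) : IsAdjointPair A f.1 (hStar f).1 :=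
  Classical.choose_spec f.2

/-- The join of a set of morphisms of `mreg-Hilb_A`, computed pointwise. -/
noncomputable def hSup {M N : HObj A} (S : Set (M ⟶ N)) : M ⟶ N :=
  ⟨fun m => ⨆ f ∈ S, (f : M ⟶ N).1 m,
   ⟨fun n => ⨆ f ∈ S, (hStar f).1 n, by
      intro m n
      have L : qip A (⨆ f ∈ S, (f : M ⟶ N).1 m) n
          = ⨆ f ∈ S, qip A ((f : M ⟶ N).1 m) n := by
        rw [qip_iSup_left]
        exact iSup_congr fun f => qip_iSup_left _ _
      have R : qip A m (⨆ f ∈ S, (hStar f).1 n)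
          = ⨆ f ∈ S, qip A m ((hStar f).1 n) := by
        rw [qip_iSup_right]
        exact iSup_congr fun f => qip_iSup_right _ _
      rw [L, R]
      exact iSup_congr fun f => iSup_congr fun _ => hStar_adj f m n⟩⟩

/-- A morphism is unitary if its ⋆-adjoint is a two-sided inverse. -/
noncomputable def IsUnitaryHom {M N : HObj A} (f : M ⟶ N) : Prop :=
  f ≫ hStar f = 𝟙 M ∧ hStar f ≫ f = 𝟙 N

end Categories

section Functors

/-- A (join-preserving) ⋆-functor between the categories `mreg-Hilb_A` and `mreg-Hilb_B`. -/
structure StarFunctor (A B : Type u) [InvQuantale A] [InvQuantale B] : Type (u + 1) where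
  toFunctor : HObj A ⥤ HObj B
  map_star : ∀ {M N : HObj A} (f : M ⟶ N),
    toFunctor.map (hStar f) = hStar (toFunctor.map f)
  map_hSup : ∀ {M N : HObj A} (S : Set (M ⟶ N)),
    toFunctor.map (hSup S) = hSup (toFunctor.map '' S)

/-- Morita equivalence of involutive quantales: there are ⋆-functors `F, G` between
`mreg-Hilb_A` and `mreg-Hilb_B` with `GF ≅ Id` and `FG ≅ Id` via unitary natural
isomorphisms. -/
def Morita (A B : Type u) [InvQuantale A] [InvQuantale B] : Prop :=
  ∃ (F : StarFunctor A B) (G : StarFunctor B A)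
    (η : F.toFunctor ⋙ G.toFunctor ⟶ 𝟭 (HObj A))
    (ζ : G.toFunctor ⋙ F.toFunctor ⟶ 𝟭 (HObj B)),
    (∀ M : HObj A, IsUnitaryHom (η.app M)) ∧ (∀ N : HObj B, IsUnitaryHom (ζ.app N))

variable {A : Type u} [InvQuantale A]

/-- An m-regular involutive quantale as an object of `mreg-Hilb_A`. -/
def selfObj (A : Type u) [InvQuantale A] (hA : InvQuantale.MReg A) : HObj A where
  carrier := A
  lat := inferInstance
  str := selfQHilb hA.2
  ess := hA.1
  sep := hA.2

/-- Left multiplication by `a` as a morphism `A ⟶ A` of `mreg-Hilb_A`. -/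
def lmulHom (A : Type u) [InvQuantale A] (hA : InvQuantale.MReg A) (a : A) :
    selfObj A hA ⟶ selfObj A hA :=
  ⟨fun (b : A) => a * b, ⟨fun (b : A) => Star.star a * b, fun (m n : A) => by
    show Star.star (a * m) * n = Star.star m * (Star.star a * n)
    rw [InvQuantale.qstar_mul, InvQuantale.qmul_assoc]⟩⟩

/-- The left `A`-action `a • z = F(L_a)(z)` on `Z = F(A)` used in the Eilenberg-Watts
theorem. -/
def EWact {A B : Type u} [InvQuantale A] [InvQuantale B] (hA : InvQuantale.MReg A)
    (F : StarFunctor A B) :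
    A → (F.toFunctor.obj (selfObj A hA)).carrier → (F.toFunctor.obj (selfObj A hA)).carrier :=
  fun a z => (F.toFunctor.map (lmulHom A hA a)).1 z

end Functors
section Bimodules

/-- A right Hilbert `A`–`B` bimodule structure: `M` is a right Hilbert `B`-module with a
compatible left `A`-action. -/
structure IsRightHilbBimod (A B : Type u) [InvQuantale A] [InvQuantale B]
    (M : Type u) [CompleteLattice M] [QHilb B M] (lact : A → M → M) : Prop where
  lact_mul : ∀ (a b : A) (m : M), lact (a * b) m = lact a (lact b m)
  sSup_lact : ∀ (S : Set A) (m : M), lact (sSup S) m = ⨆ a ∈ S, lact a m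
  lact_sSup : ∀ (a : A) (S : Set M), lact a (sSup S) = ⨆ m ∈ S, lact a m
  lact_act : ∀ (a : A) (x : M) (b : B), lact a (qact x b) = qact (lact a x) b
  ip_lact : ∀ (a : A) (x y : M), qip B (lact a x) y = qip B x (lact (Star.star a) y)

/-- A left action is essential if every element is a join of elements `a • m`. -/
def LEssentialAct {A : Type u} {M : Type u} [CompleteLattice M] (lact : A → M → M) : Prop :=
  ∀ m : M, m = sSup {x : M | (∃ (a : A) (p : M), x = lact a p) ∧ x ≤ m}

/-- `t : M × N → P` realizes `P` as the interior tensor product `M ⊗̇_A N` of the right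
Hilbert `A`-module `M` with the right Hilbert `A`–`B` bimodule `N` (with left action
`lactN`): `t` is bilinear for joins, its image join-generates `P`, and
`⟨x₁ ⊗ y₁, x₂ ⊗ y₂⟩ = ⟨y₁, ⟨x₁,x₂⟩ • y₂⟩`. -/
structure IsInteriorTensor (A B : Type u) [InvQuantale A] [InvQuantale B]
    {M : Type u} [CompleteLattice M] [QHilb A M]
    {N : Type u} [CompleteLattice N] [QHilb B N] (lactN : A → N → N)
    {P : Type u} [CompleteLattice P] [QHilb B P]
    (t : M → N → P) : Prop where
  ip_t : ∀ (x₁ x₂ : M) (y₁ y₂ : N),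
    qip B (t x₁ y₁) (t x₂ y₂) = qip B y₁ (lactN (qip A x₁ x₂) y₂)
  sSup_t : ∀ (S : Set M) (y : N), t (sSup S) y = ⨆ x ∈ S, t x y
  t_sSup : ∀ (x : M) (S : Set N), t x (sSup S) = ⨆ y ∈ S, t x y
  gen : ∀ p : P, p = sSup {q : P | (∃ x y, q = t x y) ∧ q ≤ p}

/-- A bundled right Hilbert `A`-module. -/
structure HilbMod (A : Type u) [InvQuantale A] : Type (u + 1) where
  carrier : Type u
  [lat : CompleteLattice carrier]
  [str : QHilb A carrier]

attribute [instance] HilbMod.lat HilbMod.str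

/-- A bundled right Hilbert `A`–`B` bimodule. -/
structure BimodObj (A B : Type u) [InvQuantale A] [InvQuantale B] : Type (u + 1) where
  carrier : Type u
  [lat : CompleteLattice carrier]
  [str : QHilb B carrier]
  lact : A → carrier → carrier
  bimod : IsRightHilbBimod A B carrier lact

attribute [instance] BimodObj.lat BimodObj.str

/-- An imprimitivity `A`–`B` bimodule structure on `X`: a full m-regular right Hilbert
`B`-module and full m-regular left Hilbert `A`-module with compatible structures. -/
structure IsImprim (A B : Type u) [InvQuantale A] [InvQuantale B]
    (X : Type u) [CompleteLattice X] [QHilb B X]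
    (lact : A → X → X) (lip : X → X → A) : Prop where
  bimod : IsRightHilbBimod A B X lact
  lip_lact : ∀ (a : A) (x y : X), a * lip x y = lip (lact a x) y
  sSup_lip : ∀ (S : Set X) (y : X), lip (sSup S) y = ⨆ x ∈ S, lip x y
  lip_sSup : ∀ (x : X) (S : Set X), lip x (sSup S) = ⨆ y ∈ S, lip x y
  star_lip : ∀ x y : X, Star.star (lip x y) = lip y x
  lip_sep : ∀ x y : X, (∀ z : X, lip x z = lip y z) → x = y
  rfull : ∀ b : B, b = sSup {c : B | (∃ x y : X, c = qip B x y) ∧ c ≤ b}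
  lfull : ∀ a : A, a = sSup {c : A | (∃ x y : X, c = lip x y) ∧ c ≤ a}
  ress : Essential B X
  rsep : Separated B X
  less : LEssentialAct lact
  lsep : ∀ m n : X, (∀ a : A, lact a m = lact a n) → m = n
  imp1 : ∀ x y z : X, lact (lip x y) z = qact x (qip B y z)
  imp2 : ∀ (x y : X) (b : B), lip (qact x b) y = lip x (qact y (Star.star b))

/-- A bundled imprimitivity `A`–`B` bimodule; `A` and `B` are strongly Morita
equivalent iff such a bimodule exists. -/
structure ImprimObj (A B : Type u) [InvQuantale A] [InvQuantale B] : Type (u + 1) where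
  carrier : Type u
  [lat : CompleteLattice carrier]
  [str : QHilb B carrier]
  lact : A → carrier → carrier
  lip : carrier → carrier → A
  imprim : IsImprim A B carrier lact lip

attribute [instance] ImprimObj.lat ImprimObj.str

end Bimodules

section Constructions

/-- The opposite involutive quantale `A^d`, with multiplication `a ∘ b = b · a`. -/
def InvQuantale.dual (A : Type u) [iq : InvQuantale A] : InvQuantale A :=
  { iq.toCompleteLattice with
    mul := fun a b => b * a
    star := fun a => Star.star a
    qmul_assoc := fun a b c => (InvQuantale.qmul_assoc c b a).symm
    mul_sSup := fun a S => InvQuantale.sSup_mul S a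
    sSup_mul := fun S a => InvQuantale.mul_sSup a S
    qstar_star := fun a => InvQuantale.qstar_star a
    star_sSup := fun S => InvQuantale.star_sSup S
    qstar_mul := fun a b => InvQuantale.qstar_mul b a }

/-- The involutive quantale of `J × J` matrices over `A`, with matrix multiplication
(joins in place of sums) and conjugate-transpose involution. -/
def MatrixQuantale (A : Type u) [InvQuantale A] (J : Type u) :
    InvQuantale (J → J → A) :=
  { (inferInstance : CompleteLattice (J → J → A)) with
    mul := fun X Y i k => ⨆ j, X i j * Y j k
    star := fun X i j => Star.star (X j i)
    qmul_assoc := by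
      intro X Y Z
      funext i l
      show (⨆ k, (⨆ j, X i j * Y j k) * Z k l) = ⨆ j, X i j * ⨆ k, Y j k * Z k l
      calc (⨆ k, (⨆ j, X i j * Y j k) * Z k l)
          = ⨆ k, ⨆ j, (X i j * Y j k) * Z k l := by
            exact iSup_congr fun k => Quantale.iSup_mul _ _
        _ = ⨆ j, ⨆ k, X i j * (Y j k * Z k l) := by
            rw [iSup_comm]
            exact iSup_congr fun j => iSup_congr fun k => InvQuantale.qmul_assoc _ _ _
        _ = ⨆ j, X i j * ⨆ k, Y j k * Z k l := by
            exact iSup_congr fun j => (Quantale.mul_iSup _ _).symm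
    mul_sSup := by
      intro X S
      funext i k
      show (⨆ j, X i j * sSup S j k) = _
      simp only [sSup_apply, iSup_apply, Quantale.mul_iSup]
      rw [iSup_comm]
      rw [iSup_subtype]
      rfl
    sSup_mul := by
      intro S X
      funext i k
      show (⨆ j, sSup S i j * X j k) = _
      simp only [sSup_apply, iSup_apply, Quantale.iSup_mul]
      rw [iSup_comm]
      rw [iSup_subtype]
      rfl
    qstar_star := by
      intro X
      funext i j
      exact InvQuantale.qstar_star _
    star_sSup := by
      intro S
      funext i j
      show Star.star (sSup S j i) = _
      simp only [sSup_apply, iSup_apply, Quantale.star_iSup]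
      rw [iSup_subtype]
    qstar_mul := by
      intro X Y
      funext i l
      show Star.star (⨆ j, X l j * Y j i) = ⨆ j, Star.star (Y j i) * Star.star (X l j)
      rw [Quantale.star_iSup]
      exact iSup_congr fun j => InvQuantale.qstar_mul _ _ }

/-- The property of belonging to the centre of `A`: a join-preserving bimodule
endomorphism that is adjointable for the right and left inner products. -/
def IsCen (A : Type u) [InvQuantale A] (f : A → A) : Prop :=
  (∀ S : Set A, f (sSup S) = ⨆ a ∈ S, f a) ∧
  (∀ a b : A, f (a * b) = f a * b) ∧
  (∀ a b : A, f (a * b) = a * f b) ∧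
  Adjointable A f ∧
  (∃ g : A → A, ∀ a b : A, f a * Star.star b = a * Star.star (g b))

/-- The centre of an m-regular involutive quantale. -/
def Cen (A : Type u) [InvQuantale A] : Type u := {f : A → A // IsCen A f}

end Constructions

namespace MC

section Basic

variable {M : Type v} {N : Type w} [CompleteLattice M] [CompleteLattice N]

/-- Join-preserving maps. -/
def SP {M : Type v} {N : Type w} [CompleteLattice M] [CompleteLattice N] (f : M → N) : Prop :=
  ∀ S : Set M, f (sSup S) = ⨆ m ∈ S, f m

theorem SP.map_iSup {f : M → N} (hf : SP f) {ι : Sort*} (g : ι → M) :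
    f (⨆ i, g i) = ⨆ i, f (g i) := by
  rw [iSup, hf, iSup_range]

theorem SP.map_bot {f : M → N} (hf : SP f) : f ⊥ = ⊥ := by
  have := hf ∅
  simpa using this

theorem SP.map_sup {f : M → N} (hf : SP f) (a b : M) : f (a ⊔ b) = f a ⊔ f b := by
  have := hf {a, b}
  rw [sSup_pair, iSup_pair] at this
  exact this

theorem SP.mono {f : M → N} (hf : SP f) {a b : M} (h : a ≤ b) : f a ≤ f b := by
  have := hf.map_sup a b
  rw [sup_eq_right.2 h] at this
  rw [this]; exact le_sup_left

theorem SP.of_iSup {f : M → N} (h : ∀ (ι : Type v) (g : ι → M), f (⨆ i, g i) = ⨆ i, f (g i)) :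
    SP f := by
  intro S
  rw [sSup_eq_iSup', h, iSup_subtype]

theorem SP.comp {P : Type*} [CompleteLattice P] {g : N → P} {f : M → N} (hg : SP g) (hf : SP f) :
    SP (fun x => g (f x)) := by
  apply SP.of_iSup
  intro ι k
  rw [hf.map_iSup, hg.map_iSup]

theorem SP.id' : SP (fun m : M => m) := by
  intro S; exact sSup_eq_iSup

theorem SP.iSup' {ι : Sort*} {f : ι → M → N} (h : ∀ i, SP (f i)) : SP (fun m => ⨆ i, f i m) := by
  apply SP.of_iSup
  intro κ k
  rw [iSup_comm]
  exact iSup_congr fun i => (h i).map_iSup k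

theorem SP.sup' {f g : M → N} (hf : SP f) (hg : SP g) : SP (fun m => f m ⊔ g m) := by
  apply SP.of_iSup
  intro κ k
  rw [hf.map_iSup, hg.map_iSup, iSup_sup_eq]

theorem SP.eval {X : Type*} (x : X) : SP (fun p : X → M => p x) := by
  apply SP.of_iSup
  intro κ k
  simp

theorem SP.bot' : SP (fun _ : M => (⊥ : N)) := by
  intro S; simp

/-- Sup-closed predicates. -/
def SCl (P : M → Prop) : Prop := ∀ V : Set M, (∀ v ∈ V, P v) → P (sSup V)

theorem SCl.iSup {P : M → Prop} (h : SCl P) {ι : Sort*} (g : ι → M) (hg : ∀ i, P (g i)) :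
    P (⨆ i, g i) := by
  apply h
  rintro _ ⟨i, rfl⟩
  exact hg i

theorem SCl.sup {P : M → Prop} (h : SCl P) {a b : M} (ha : P a) (hb : P b) :
    P (a ⊔ b) := by
  rw [← sSup_pair]
  apply h
  rintro _ (rfl | rfl)
  · exact ha
  · exact hb

theorem SCl.bot {P : M → Prop} (h : SCl P) : P ⊥ := by
  rw [← sSup_empty]
  apply h
  intro v hv
  exact hv.elim

theorem SCl.of_iSup {P : M → Prop}
    (h : ∀ (ι : Type v) (g : ι → M), (∀ i, P (g i)) → P (⨆ i, g i)) : SCl P := by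
  intro V hV
  rw [sSup_eq_iSup']
  exact h _ _ fun i => hV _ i.2

theorem SCl.eq {f g : M → N} (hf : SP f) (hg : SP g) : SCl (fun m => f m = g m) := by
  apply SCl.of_iSup
  intro ι k h
  rw [hf.map_iSup, hg.map_iSup]
  exact iSup_congr h

theorem SCl.forall' {ι : Sort*} {P : ι → M → Prop} (h : ∀ i, SCl (P i)) :
    SCl (fun m => ∀ i, P i m) := by
  intro V hV i
  exact h i V fun v hv => hV v hv i

theorem SCl.imp {p : Prop} {P : M → Prop} (h : SCl P) : SCl (fun m => p → P m) := by
  intro V hV hp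
  exact h V fun v hv => hV v hv hp

theorem SCl.and {P Q : M → Prop} (h : SCl P) (h' : SCl Q) : SCl (fun m => P m ∧ Q m) := by
  intro V hV
  exact ⟨h V fun v hv => (hV v hv).1, h' V fun v hv => (hV v hv).2⟩

theorem SCl.comp {f : N → M} {P : M → Prop} (h : SCl P) (hf : SP f) : SCl (fun n => P (f n)) := by
  apply SCl.of_iSup
  intro ι k hk
  rw [hf.map_iSup]
  exact h.iSup _ hk

/-- existence of a witness for a sup-closed relation -/
theorem SCl.exists' {R : M → N → Prop}
    (h : ∀ (ι : Type v) (f : ι → M) (g : ι → N), (∀ i, R (f i) (g i)) → R (⨆ i, f i) (⨆ i, g i)) :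
    SCl (fun m => ∃ n, R m n) := by
  apply SCl.of_iSup
  intro ι k hk
  choose g hg using hk
  exact ⟨_, h _ _ _ hg⟩

theorem SCl.exists_eq {P : Type*} [CompleteLattice P] {f : M → P} {g : N → P} (hf : SP f)
    (hg : SP g) : SCl (fun m => ∃ n, f m = g n) := by
  apply SCl.exists'
  intro ι a b hab
  rw [hf.map_iSup, hg.map_iSup]
  exact iSup_congr hab

/-- sup-closure -/
def SC (S : Set M) : Set M := {x | ∃ U ⊆ S, x = sSup U}

theorem SC.sub {S : Set M} {s : M} (h : s ∈ S) : s ∈ SC S :=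
  ⟨{s}, by simpa using h, by simp⟩

theorem SC.ind {S : Set M} {P : M → Prop} (hP : SCl P) (hS : ∀ s ∈ S, P s) {x : M}
    (hx : x ∈ SC S) : P x := by
  obtain ⟨U, hU, rfl⟩ := hx
  exact hP _ fun u hu => hS _ (hU hu)

theorem SC.scl (S : Set M) : SCl (fun x => x ∈ SC S) := by
  intro V hV
  refine ⟨{s | s ∈ S ∧ s ≤ sSup V}, fun s hs => hs.1, le_antisymm ?_ ?_⟩
  · apply sSup_le
    intro v hv
    obtain ⟨U, hU, rfl⟩ := hV v hv
    apply sSup_le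
    intro s hs
    exact le_sSup ⟨hU hs, (le_sSup hs).trans (le_sSup hv)⟩
  · exact sSup_le fun s hs => hs.2

theorem SC.eq_sSup {S : Set M} {x : M} (hx : x ∈ SC S) : x = sSup {y | y ∈ S ∧ y ≤ x} := by
  obtain ⟨U, hU, hx⟩ := hx
  apply le_antisymm
  · rw [hx]
    apply sSup_le
    intro s hs
    exact le_sSup ⟨hU hs, le_sSup hs⟩
  · exact sSup_le fun s hs => hs.2

theorem SC.mono_sub {S : Set M} {T : Set M} (h : ∀ s ∈ S, s ∈ SC T) {x : M} (hx : x ∈ SC S) :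
    x ∈ SC T := SC.ind (SC.scl T) h hx

theorem SC.map {f : M → N} (hf : SP f) {S : Set M} {T : Set N} (h : ∀ s ∈ S, f s ∈ SC T) {x : M}
    (hx : x ∈ SC S) : f x ∈ SC T := SC.ind ((SC.scl T).comp hf) h hx

end Basic

/-- The lattice on a sup-closed subset. -/
structure SubL {M : Type v} [CompleteLattice M] (S : M → Prop) where
  val : M
  prop : S val

namespace SubL

variable {M : Type v} [CompleteLattice M] {S : M → Prop}

@[ext] theorem ext' {a b : SubL S} (h : a.val = b.val) : a = b := by
  cases a; cases b; simp at h; subst h; rfl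

instance : PartialOrder (SubL S) where
  le a b := a.val ≤ b.val
  le_refl a := le_refl a.val
  le_trans _ _ _ h h' := le_trans (α := M) h h'
  le_antisymm _ _ h h' := ext' (le_antisymm h h')

/-- complete lattice structure -/
@[reducible] noncomputable def lat (hS : SCl S) : CompleteLattice (SubL S) :=
  letI : SupSet (SubL S) := ⟨fun V => ⟨sSup (SubL.val '' V), hS _ (by
    rintro _ ⟨v, _, rfl⟩; exact v.prop)⟩⟩
  completeLatticeOfSup (SubL S) (by
    intro V
    constructor
    · intro v hv
      exact le_sSup (α := M) ⟨v, hv, rfl⟩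
    · intro w hw
      apply sSup_le (α := M)
      rintro _ ⟨v, hv, rfl⟩
      exact hw hv)

theorem val_sp (hS : SCl S) : letI := lat hS; SP (SubL.val : SubL S → M) := by
  letI := lat hS
  intro V
  show sSup (SubL.val '' V) = _
  rw [sSup_image]

end SubL

section Quant
variable {A : Type u} [InvQuantale A]

theorem mul_sp (a : A) : SP (fun b : A => a * b) := InvQuantale.mul_sSup a
theorem mul_sp' (a : A) : SP (fun b : A => b * a) := fun S => InvQuantale.sSup_mul S a
theorem star_sp : SP (fun b : A => star b) := InvQuantale.star_sSup

theorem mul_assoc' (a b c : A) : a * b * c = a * (b * c) := InvQuantale.qmul_assoc a b c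
theorem ss (a : A) : star (star a) = a := InvQuantale.qstar_star a
theorem sm (a b : A) : star (a * b) = star b * star a := InvQuantale.qstar_mul a b

theorem lsepA (hA : InvQuantale.MReg A) {a b : A} (h : ∀ c, a * c = b * c) : a = b := hA.2 a b h
theorem rsepA (hA : InvQuantale.MReg A) {a b : A} (h : ∀ c, c * a = c * b) : a = b := by
  have : star a = star b := by
    apply lsepA hA
    intro c
    have := congrArg star (h (star c))
    simpa [sm, ss] using this
  simpa [ss] using congrArg star this

theorem essA (hA : InvQuantale.MReg A) (a : A) : a ∈ SC {x : A | ∃ p q : A, x = p * q} :=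
  ⟨_, fun _ hx => hx.1, hA.1 a⟩

/-- induction over products -/
theorem indA (hA : InvQuantale.MReg A) {P : A → Prop} (hP : SCl P) (h : ∀ p q, P (p * q)) (a : A) :
    P a := SC.ind hP (by rintro _ ⟨p, q, rfl⟩; exact h p q) (essA hA a)

section Mod
variable {M : Type v} [CompleteLattice M]

theorem act_sp [QMod A M] (m : M) : SP (fun a : A => qact m a) := QMod.act_sSup m
theorem act_sp' [QMod A M] (a : A) : SP (fun m : M => qact m a) := fun S => QMod.sSup_act S a
theorem ip_sp [QPreHilb A M] (m : M) : SP (fun n : M => qip A m n) := QPreHilb.ip_sSup m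
theorem ip_sp' [QPreHilb A M] (n : M) : SP (fun m : M => qip A m n) :=
  fun S => QPreHilb.sSup_ip S n
theorem act_mul [QMod A M] (m : M) (a b : A) : qact m (a * b) = qact (qact m a) b :=
  QMod.act_mul m a b
theorem ip_act [QPreHilb A M] (m n : M) (a : A) : qip A m (qact n a) = qip A m n * a :=
  (QPreHilb.ip_mul m n a).symm
theorem star_ip [QPreHilb A M] (m n : M) : star (qip A m n) = qip A n m :=
  QPreHilb.star_ip m n
theorem act_ip [QPreHilb A M] (m n : M) (a : A) : qip A (qact m a) n = star a * qip A m n := by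
  rw [← star_ip, ip_act, sm, star_ip]
theorem ip_ext [QHilb A M] {m n : M} (h : ∀ p, qip A p m = qip A p n) : m = n :=
  QHilb.ip_sep m n h
theorem ip_ext' [QHilb A M] {m n : M} (h : ∀ p, qip A m p = qip A n p) : m = n :=
  ip_ext (A := A) fun p => by rw [← star_ip, h, star_ip]

theorem sep_of_ip (hA : InvQuantale.MReg A) [QHilb A M] : Separated A M := by
  intro m n h
  apply ip_ext (A := A)
  intro p
  apply lsepA hA
  intro c
  rw [← ip_act, ← ip_act, h]

variable {N : Type w} [CompleteLattice N]

theorem adj_sp [QHilb A M] [QHilb A N] {f : M → N} {g : N → M} (h : IsAdjointPair A f g) : SP f := by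
  apply SP.of_iSup
  intro ι k
  apply ip_ext' (A := A)
  intro p
  rw [h, qip_iSup_left, qip_iSup_left]
  exact iSup_congr fun i => (h _ _).symm

theorem adj_lin [QHilb A M] [QHilb A N] {f : M → N} {g : N → M} (h : IsAdjointPair A f g)
    (m : M) (a : A) : f (qact m a) = qact (f m) a := by
  apply ip_ext' (A := A)
  intro p
  rw [h, act_ip, act_ip, h]

theorem Adj_sp [QHilb A M] [QHilb A N] {f : M → N} (h : Adjointable A f) : SP f :=
  adj_sp h.choose_spec

theorem Adj_lin [QHilb A M] [QHilb A N] {f : M → N} (h : Adjointable A f) 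
    (m : M) (a : A) : f (qact m a) = qact (f m) a :=
  adj_lin h.choose_spec m a

theorem Adj_comp {P : Type*} [CompleteLattice P] [QPreHilb A M] [QPreHilb A N] [QPreHilb A P]
    {f : M → N} {g : N → P} (hg : Adjointable A g) (hf : Adjointable A f) :
    Adjointable A (fun x => g (f x)) := by
  obtain ⟨f', hf⟩ := hf
  obtain ⟨g', hg⟩ := hg
  exact ⟨fun p => f' (g' p), fun m p => (hg (f m) p).trans (hf m (g' p))⟩

theorem Adj_scl [QPreHilb A M] [QPreHilb A N] : SCl (fun f : M → N => Adjointable A f) := by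
  apply SCl.of_iSup
  intro ι f hf
  choose g hg using hf
  refine ⟨fun n => ⨆ i, g i n, fun m n => ?_⟩
  rw [iSup_apply, qip_iSup_left, qip_iSup_right]
  exact iSup_congr fun i => hg i m n

theorem Adj_sup [QPreHilb A M] [QPreHilb A N] {f g : M → N} (hf : Adjointable A f)
    (hg : Adjointable A g) : Adjointable A (fun x => f x ⊔ g x) := Adj_scl.sup hf hg

end Mod

/-- build an object -/
def mkObj (hA : InvQuantale.MReg A) (M : Type u) [CompleteLattice M] [QHilb A M]
    (h : Essential A M) : HObj A := ⟨M, h, sep_of_ip hA⟩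

theorem ess_of_SC {M : Type v} [CompleteLattice M] [QMod A M]
    (h : ∀ m : M, m ∈ SC {x | ∃ (p : M) (a : A), x = qact p a}) : Essential A M :=
  fun m => SC.eq_sSup (h m)

theorem essM (M : HObj A) (m : M.carrier) :
    m ∈ SC {x : M.carrier | ∃ (p : M.carrier) (a : A), x = qact p a} :=
  ⟨_, fun _ hx => hx.1, M.ess m⟩

theorem indM (M : HObj A) {P : M.carrier → Prop} (hP : SCl P) (h : ∀ m (a : A), P (qact m a))
    (m : M.carrier) : P m := SC.ind hP (by rintro _ ⟨p, q, rfl⟩; exact h p q) (essM M m)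

/-- Data for a hyperbolic module. -/
structure Hyp (A : Type u) [InvQuantale A] (P Q : Type u) [CompleteLattice P] [CompleteLattice Q]
    where
  aP : P → A → P
  aQ : Q → A → Q
  β : Q → P → A
  aP_mul : ∀ p a b, aP p (a * b) = aP (aP p a) b
  aQ_mul : ∀ p a b, aQ p (a * b) = aQ (aQ p a) b
  aP_sp : ∀ p, SP (aP p)
  aQ_sp : ∀ p, SP (aQ p)
  aP_sp' : ∀ a, SP (fun p => aP p a)
  aQ_sp' : ∀ a, SP (fun p => aQ p a)
  β_sp : ∀ q, SP (β q)
  β_sp' : ∀ p, SP (fun q => β q p)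
  βP : ∀ q p a, β q (aP p a) = β q p * a
  βQ : ∀ q p a, β (aQ q a) p = star a * β q p
  sepP : ∀ p p', (∀ q, β q p = β q p') → p = p'
  sepQ : ∀ q q', (∀ p, β q p = β q' p) → q = q'
  essP : ∀ p : P, p ∈ SC {x | ∃ p a, x = aP p a}
  essQ : ∀ p : Q, p ∈ SC {x | ∃ p a, x = aQ p a}

namespace Hyp
variable {P Q : Type u} [CompleteLattice P] [CompleteLattice Q] (D : Hyp A P Q)

theorem fst_sp : SP (fun x : P × Q => x.1) := by
  apply SP.of_iSup; intro ι g; simp [Prod.fst_iSup]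
theorem snd_sp : SP (fun x : P × Q => x.2) := by
  apply SP.of_iSup; intro ι g; simp [Prod.snd_iSup]

/-- hyperbolic Hilbert module -/
@[reducible] def hilb : QHilb A (P × Q) where
  act x a := (D.aP x.1 a, D.aQ x.2 a)
  act_mul x a b := by simp only [D.aP_mul, D.aQ_mul]
  sSup_act S a := by
    have h1 : SP (fun x : P × Q => D.aP x.1 a) := (D.aP_sp' a).comp fst_sp
    have h2 : SP (fun x : P × Q => D.aQ x.2 a) := (D.aQ_sp' a).comp snd_sp
    ext
    · rw [Prod.fst_iSup]; simp only [Prod.fst_iSup]; exact h1 S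
    · rw [Prod.snd_iSup]; simp only [Prod.snd_iSup]; exact h2 S
  act_sSup x S := by
    ext
    · rw [Prod.fst_iSup]; simp only [Prod.fst_iSup]; exact D.aP_sp _ S
    · rw [Prod.snd_iSup]; simp only [Prod.snd_iSup]; exact D.aQ_sp _ S
  ip x y := star (D.β y.2 x.1) ⊔ D.β x.2 y.1
  ip_mul x y a := by
    rw [(mul_sp' a).map_sup, D.βP, D.βQ, sm, ss]
  sSup_ip S y := by
    have h1 : SP (fun x : P × Q => D.β y.2 x.1) := (D.β_sp _).comp fst_sp
    have h2 : SP (fun x : P × Q => D.β x.2 y.1) := (D.β_sp' _).comp snd_sp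
    exact (star_sp.comp h1).sup' h2 S
  ip_sSup x S := by
    have h1 : SP (fun y : P × Q => D.β y.2 x.1) := (D.β_sp' _).comp snd_sp
    have h2 : SP (fun y : P × Q => D.β x.2 y.1) := (D.β_sp _).comp fst_sp
    exact (star_sp.comp h1).sup' h2 S
  star_ip x y := by rw [star_sp.map_sup, ss, sup_comm]
  ip_sep x y h := by
    ext
    · apply D.sepP
      intro q
      have := h (⊥, q)
      simpa [(D.β_sp _).map_bot, (star_sp (A := A)).map_bot] using this
    · apply D.sepQ
      intro p
      have := h (p, ⊥)
      have e : ∀ p, D.β ⊥ p = ⊥ := fun p => (D.β_sp' p).map_bot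
      simp only [e, sup_bot_eq] at this
      have := congrArg star this
      simpa [ss] using this

theorem ess' : letI := D.hilb; Essential A (P × Q) := by
  letI := D.hilb
  apply ess_of_SC
  rintro ⟨p, q⟩
  have : ((p, q) : P × Q) = (p, ⊥) ⊔ (⊥, q) := by simp
  rw [this]
  apply (SC.scl _).sup
  · have h1 : SP (fun p : P => ((p, ⊥) : P × Q)) := by
      apply SP.of_iSup; intro ι g; ext <;> simp [Prod.fst_iSup, Prod.snd_iSup]
    refine SC.map h1 ?_ (D.essP p)
    rintro _ ⟨p, a, rfl⟩
    refine SC.sub ⟨(p, ⊥), a, ?_⟩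
    show _ = (D.aP p a, D.aQ ⊥ a)
    rw [(D.aQ_sp' a).map_bot]
  · have h1 : SP (fun q : Q => ((⊥, q) : P × Q)) := by
      apply SP.of_iSup; intro ι g; ext <;> simp [Prod.fst_iSup, Prod.snd_iSup]
    refine SC.map h1 ?_ (D.essQ q)
    rintro _ ⟨q, a, rfl⟩
    refine SC.sub ⟨(⊥, q), a, ?_⟩
    show _ = (D.aP ⊥ a, D.aQ q a)
    rw [(D.aP_sp' a).map_bot]

/-- hyperbolic object -/
def obj (hA : InvQuantale.MReg A) : HObj A :=
  letI := D.hilb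
  mkObj hA (P × Q) D.ess'

end Hyp

end Quant
end MC

namespace MC

namespace SubL
variable {M : Type v} [CompleteLattice M]

theorem sp_of_val {S : M → Prop} (hS : SCl S) {N : Type w} [CompleteLattice N] {f : N → SubL S}
    (hf : SP (fun n => (f n).val)) : letI := lat hS; SP f := by
  let _ := lat hS
  apply SP.of_iSup
  intro ι g
  apply ext'
  rw [(val_sp hS).map_iSup]
  exact hf.map_iSup g

theorem ind {S : Set M} {P : SubL (fun x => x ∈ SC S) → Prop}
    (hP : letI := lat (SC.scl S); SCl P) (h : ∀ s (hs : s ∈ S), P ⟨s, SC.sub hs⟩)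
    (z : SubL (fun x => x ∈ SC S)) : P z := by
  let _ := lat (SC.scl S)
  obtain ⟨z, hz⟩ := z
  obtain ⟨U, hU, rfl⟩ := id hz
  have : (⟨sSup U, hz⟩ : SubL (fun x => x ∈ SC S)) = ⨆ u : U, ⟨u.1, SC.sub (hU u.2)⟩ := by
    apply ext'
    rw [(val_sp (SC.scl S)).map_iSup]
    exact sSup_eq_iSup' U
  rw [this]
  apply hP.iSup
  intro i
  exact h _ (hU i.2)
end SubL

namespace Hyp
variable {A : Type u} [InvQuantale A] {P Q : Type u} [CompleteLattice P] [CompleteLattice Q]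
  (D : Hyp A P Q) (hA : InvQuantale.MReg A)

/-- pairing -/
def mk' (p : P) (q : Q) : (D.obj hA).carrier := (show P × Q from (p, q))
/-- first component -/
def f (x : (D.obj hA).carrier) : P := (show P × Q from x).1
/-- second component -/
def s (x : (D.obj hA).carrier) : Q := (show P × Q from x).2

@[simp] theorem f_mk (p : P) (q : Q) : D.f hA (D.mk' hA p q) = p := rfl
@[simp] theorem s_mk (p : P) (q : Q) : D.s hA (D.mk' hA p q) = q := rfl
theorem ext'' {x y : (D.obj hA).carrier} (h : D.f hA x = D.f hA y) (h' : D.s hA x = D.s hA y) :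
    x = y := Prod.ext h h'
theorem f_sp : SP (D.f hA) := fst_sp
theorem s_sp : SP (D.s hA) := snd_sp
theorem ip_eq (x y : (D.obj hA).carrier) :
    qip A x y = star (D.β (D.s hA y) (D.f hA x)) ⊔ D.β (D.s hA x) (D.f hA y) := rfl
theorem f_act (x : (D.obj hA).carrier) (a : A) : D.f hA (qact x a) = D.aP (D.f hA x) a := rfl
theorem s_act (x : (D.obj hA).carrier) (a : A) : D.s hA (qact x a) = D.aQ (D.s hA x) a := rfl
theorem β_bot (q : Q) : D.β q ⊥ = ⊥ := (D.β_sp q).map_bot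
theorem β_bot' (p : P) : D.β ⊥ p = ⊥ := (D.β_sp' p).map_bot
end Hyp
theorem star_bot' {A : Type u} [InvQuantale A] : star (⊥ : A) = ⊥ := star_sp.map_bot

section Self
variable {B : Type u} [InvQuantale B] (hB : InvQuantale.MReg B)

/-- coercion from the self object -/
def toB (x : (selfObj B hB).carrier) : B := x
/-- coercion to the self object -/
def ofB (x : B) : (selfObj B hB).carrier := x

@[simp] theorem toB_ofB (x : B) : toB hB (ofB hB x) = x := rfl
@[simp] theorem ofB_toB (x : (selfObj B hB).carrier) : ofB hB (toB hB x) = x := rfl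
theorem toB_sp : SP (toB hB) := SP.id'
theorem ofB_sp : SP (ofB hB) := SP.id'
theorem self_ip (x y : (selfObj B hB).carrier) : qip B x y = star (toB hB x) * toB hB y := rfl
theorem toB_act (x : (selfObj B hB).carrier) (b : B) : toB hB (qact x b) = toB hB x * b := rfl
theorem ofB_act (x : B) (b : B) : qact (ofB hB x) b = ofB hB (x * b) := rfl
theorem toB_inj {x y : (selfObj B hB).carrier} (h : toB hB x = toB hB y) : x = y := h
end Self

/-- Abstract context extracted from an equivalence of module categories. -/
structure Ctx (A B : Type u) [InvQuantale A] [InvQuantale B] where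
  hA : InvQuantale.MReg A
  hB : InvQuantale.MReg B
  X : HObj B
  lam : A → X.carrier → X.carrier
  Rl : HObj A → HObj B → Type u
  th : ∀ {M : HObj A} {N : HObj B}, Rl M N → M.carrier → X.carrier → N.carrier
  ths : ∀ {M : HObj A} {N : HObj B}, Rl M N → M.carrier → N.carrier → X.carrier
  th_adj : ∀ {M : HObj A} {N : HObj B} (r : Rl M N) (m : M.carrier),
    IsAdjointPair B (th r m) (ths r m)
  th_sp : ∀ {M : HObj A} {N : HObj B} (r : Rl M N) (x : X.carrier), SP (fun m => th r m x)
  th_act : ∀ {M : HObj A} {N : HObj B} (r : Rl M N) (m : M.carrier) (a : A) (x : X.carrier),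
    th r (qact m a) x = th r m (lam a x)
  ths_th : ∀ {M : HObj A} {N : HObj B} (r : Rl M N) (m m' : M.carrier) (x : X.carrier),
    ths r m (th r m' x) = lam (qip A m m') x
  th_sep : ∀ {M : HObj A} {N : HObj B} (r : Rl M N) (n n' : N.carrier),
    (∀ m, ths r m n = ths r m n') → n = n'
  th_full : ∀ {M : HObj A} {N : HObj B} (r : Rl M N) (φ : X.carrier → N.carrier),
    Adjointable B φ → ∀ a : A, ∃ m, ∀ x, th r m x = φ (lam a x)
  trans : ∀ {M M' : HObj A} {N N' : HObj B} (r : Rl M N) (r' : Rl M' N')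
    (s : M.carrier → M'.carrier) (s' : M'.carrier → M.carrier), IsAdjointPair A s s' →
    ∃ (t : N.carrier → N'.carrier) (t' : N'.carrier → N.carrier), IsAdjointPair B t t' ∧
      (∀ m x, t (th r m x) = th r' (s m) x) ∧ ∀ m' x, t' (th r' m' x) = th r (s' m') x
  exN : ∀ N : HObj B, ∃ M : HObj A, Nonempty (Rl M N)
  exM : ∀ M : HObj A, ∃ N : HObj B, Nonempty (Rl M N)
  lam_inj : ∀ a b : A, (∀ x, lam a x = lam b x) → a = b
  lam_sp : ∀ x, SP (fun a => lam a x)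
  lam_adj : ∀ a, IsAdjointPair B (lam a) (lam (star a))
  lam_mul : ∀ a b x, lam (a * b) x = lam a (lam b x)
  lam_full : ∀ φ : X.carrier → X.carrier, Adjointable B φ → ∀ a, ∃ a', ∀ x, φ (lam a x) = lam a' x

namespace Ctx
variable {A B : Type u} [InvQuantale A] [InvQuantale B] (C : Ctx A B)

theorem lam_Adj (a : A) : Adjointable B (C.lam a) := ⟨_, C.lam_adj a⟩
theorem th_Adj {M : HObj A} {N : HObj B} (r : C.Rl M N) (m : M.carrier) :
    Adjointable B (C.th r m) := ⟨_, C.th_adj r m⟩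
theorem ths_Adj {M : HObj A} {N : HObj B} (r : C.Rl M N) (m : M.carrier) :
    Adjointable B (C.ths r m) := ⟨_, (C.th_adj r m).symm'⟩
theorem lam_sp' (a : A) : SP (C.lam a) := Adj_sp (C.lam_Adj a)
theorem lam_lin (a : A) (x : C.X.carrier) (b : B) : C.lam a (qact x b) = qact (C.lam a x) b :=
  Adj_lin (C.lam_Adj a) x b

theorem lam_full' (φ : C.X.carrier → C.X.carrier) (h : Adjointable B φ) (a : A) :
    ∃ a', ∀ x, C.lam a (φ x) = C.lam a' x := by
  obtain ⟨ψ, hψ⟩ := h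
  obtain ⟨a', ha'⟩ := C.lam_full ψ ⟨φ, hψ.symm'⟩ (star a)
  refine ⟨star a', fun x => ?_⟩
  apply ip_ext (A := B)
  intro p
  have h1 := C.lam_adj (star a) p (φ x)
  rw [ss] at h1
  rw [← h1, ← C.lam_adj a', ← ha', ← hψ.symm']

theorem ths_sp {M : HObj A} {N : HObj B} (r : C.Rl M N) (n : N.carrier) :
    SP (fun m => C.ths r m n) := by
  apply SP.of_iSup
  intro ι g
  apply ip_ext (A := B)
  intro p
  rw [qip_iSup_right, ← C.th_adj, (C.th_sp r p).map_iSup, qip_iSup_left]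
  exact iSup_congr fun i => C.th_adj r _ _ _

theorem ths_act {M : HObj A} {N : HObj B} (r : C.Rl M N) (m : M.carrier) (a : A) (n : N.carrier) :
    C.ths r (qact m a) n = C.lam (star a) (C.ths r m n) := by
  apply ip_ext (A := B)
  intro p
  rw [← C.th_adj, C.th_act, C.th_adj, C.lam_adj]

theorem th_inj {M : HObj A} {N : HObj B} (r : C.Rl M N) {m m' : M.carrier}
    (h : ∀ x, C.th r m x = C.th r m' x) : m = m' := by
  apply ip_ext (A := A)
  intro p
  apply C.lam_inj
  intro x
  rw [← C.ths_th r, ← C.ths_th r, h]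

theorem ip_th {M : HObj A} {N : HObj B} (r : C.Rl M N) (m m' : M.carrier) (x x' : C.X.carrier) :
    qip B (C.th r m x) (C.th r m' x') = qip B x (C.lam (qip A m m') x') := by
  rw [C.th_adj, C.ths_th]

theorem ip_th_ext {M M' : HObj A} {N N' : HObj B} (r : C.Rl M N) (r' : C.Rl M' N')
    (m n : M.carrier) (m' n' : M'.carrier)
    (h : ∀ x x', qip B (C.th r m x) (C.th r n x') = qip B (C.th r' m' x) (C.th r' n' x')) :
    qip A m n = qip A m' n' := by
  apply C.lam_inj
  intro x'
  apply ip_ext (A := B)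
  intro x
  rw [← C.ip_th r, ← C.ip_th r', h]

theorem th_fam {M M' : HObj A} {N : HObj B} (r : C.Rl M N) (φ : M'.carrier → C.X.carrier → N.carrier)
    (hsp : ∀ x, SP (fun m => φ m x)) (hact : ∀ m a x, φ (qact m a) x = φ m (C.lam a x))
    (hadj : ∀ m, Adjointable B (φ m)) :
    ∃ s : M'.carrier → M.carrier, ∀ m x, C.th r (s m) x = φ m x := by
  have : ∀ m, ∃ n, ∀ x, C.th r n x = φ m x := by
    refine indM M' ?_ ?_
    · apply SCl.exists'
      intro ι f g h x
      rw [(C.th_sp r x).map_iSup, (hsp x).map_iSup]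
      exact iSup_congr fun i => h i x
    · intro m a
      obtain ⟨n, hn⟩ := C.th_full r (φ m) (hadj m) a
      exact ⟨n, fun x => by rw [hn, hact]⟩
  choose s hs using this
  exact ⟨s, hs⟩

/-- orthogonality-type relation: the functional `⟨t, p ·⟩` is representable -/
def perp {K : HObj B} (t : K.carrier) (p : C.X.carrier → K.carrier) : Prop :=
  ∃ ψ, ∀ x, qip B (p x) t = qip B x ψ

theorem perp_scl {K : HObj B} (p : C.X.carrier → K.carrier) :
    SCl (fun t : K.carrier => C.perp t p) := by
  apply SCl.exists'
  intro ι f g h x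
  rw [qip_iSup_right, qip_iSup_right]
  exact iSup_congr fun i => h i x

theorem perp_scl' {K : HObj B} (t : K.carrier) :
    SCl (fun p : C.X.carrier → K.carrier => C.perp t p) := by
  apply SCl.exists'
  intro ι f g h x
  rw [iSup_apply, qip_iSup_left, qip_iSup_right]
  exact iSup_congr fun i => h i x

theorem perp_act {K : HObj B} {t : K.carrier} {p : C.X.carrier → K.carrier} (h : C.perp t p)
    (b : B) : C.perp (qact t b) p := by
  obtain ⟨ψ, h⟩ := h
  exact ⟨qact ψ b, fun x => by rw [ip_act, ip_act, h]⟩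

theorem perp_lam {K : HObj B} {t : K.carrier} {p : C.X.carrier → K.carrier} (h : C.perp t p)
    (a : A) : C.perp t (fun x => p (C.lam a x)) := by
  obtain ⟨ψ, h⟩ := h
  exact ⟨C.lam (star a) ψ, fun x => by rw [h, C.lam_adj]⟩

theorem perp_of_adj {K : HObj B} (t : K.carrier) {p : C.X.carrier → K.carrier}
    (h : Adjointable B p) : C.perp t p := by
  obtain ⟨q, h⟩ := h
  exact ⟨q t, fun x => h x t⟩

theorem adj_of_perp {K : HObj B} {p : C.X.carrier → K.carrier} (h : ∀ t, C.perp t p) :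
    Adjointable B p := by
  choose q hq using h
  exact ⟨q, fun x t => hq t x⟩

theorem adj_of_perp' {K : HObj B} {p : C.X.carrier → K.carrier}
    (h : ∀ t (b : B), C.perp (qact t b) p) :
    Adjointable B p := C.adj_of_perp (indM K (C.perp_scl p) h)

theorem Jsep {K : HObj B} {k k' : K.carrier}
    (h : ∀ θ : C.X.carrier → K.carrier, Adjointable B θ → ∀ a x,
      qip B (θ (C.lam a x)) k = qip B (θ (C.lam a x)) k') : k = k' := by
  obtain ⟨M, ⟨r⟩⟩ := C.exN K
  apply C.th_sep r
  intro m
  apply ip_ext (A := B)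
  intro x
  rw [← C.th_adj, ← C.th_adj]
  refine indM M (P := fun m => qip B (C.th r m x) k = qip B (C.th r m x) k') ?_ ?_ m
  · exact SCl.eq ((ip_sp' k).comp (C.th_sp r x)) ((ip_sp' k').comp (C.th_sp r x))
  · intro m a
    rw [C.th_act]
    exact h _ (C.th_Adj r m) a x

theorem Jsep' {K : HObj B} {k k' : K.carrier}
    (h : ∀ θ : C.X.carrier → K.carrier, Adjointable B θ → ∀ a x,
      qip B k (θ (C.lam a x)) = qip B k' (θ (C.lam a x))) : k = k' := by
  apply C.Jsep
  intro θ hθ a x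
  rw [← star_ip, h θ hθ, star_ip]

/-- submodule spanned -/
abbrev TT {K : HObj B} (T0 : Set K.carrier) : Set K.carrier :=
  SC {x | ∃ t ∈ T0, ∃ b : B, x = qact t b}

theorem TT_act {K : HObj B} {T0 : Set K.carrier} {x : K.carrier} (h : x ∈ TT (B := B) T0) (b : B) :
    qact x b ∈ TT (B := B) T0 := by
  refine SC.map (act_sp' b) ?_ h
  rintro _ ⟨t, ht, c, rfl⟩
  exact SC.sub ⟨t, ht, c * b, by rw [act_mul]⟩

theorem act_sub_lin {K : HObj B} (y : K.carrier) {Y : HObj A} (r : C.Rl Y (selfObj B C.hB))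
    (m : Y.carrier) :
    Adjointable B (fun x => qact y (toB C.hB (C.th r m x))) := by
  refine ⟨fun k => C.ths r m (ofB C.hB (qip B y k)), fun x k => ?_⟩
  show _ = qip B x (C.ths r m _)
  rw [← C.th_adj, act_ip, self_ip, toB_ofB]

theorem BT (K : HObj B) (T0 : Set K.carrier)
    (hT : ∀ θ : C.X.carrier → K.carrier, Adjointable B θ → ∀ a x, θ (C.lam a x) ∈ TT T0)
    (y : K.carrier)
    (hy : ∀ p : C.X.carrier → K.carrier, (∀ t ∈ T0, ∀ b : B, C.perp (qact t b) p) →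
      ∀ a, C.perp y (fun x => p (C.lam a x))) (b : B) : qact y b ∈ TT T0 := by
  let hS : SCl (fun k : K.carrier => k ∈ TT T0) := SC.scl _
  let _ : CompleteLattice (SubL (fun k : K.carrier => k ∈ TT T0)) := SubL.lat hS
  have vsp : SP (SubL.val : SubL (fun k : K.carrier => k ∈ TT T0) → K.carrier) := SubL.val_sp hS
  let D : Hyp B K.carrier (SubL (fun k : K.carrier => k ∈ TT T0)) :=
    { aP := fun k b => qact k b
      aQ := fun t b => ⟨qact t.val b, TT_act t.prop b⟩
      β := fun t k => qip B t.val k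
      aP_mul := act_mul
      aQ_mul := fun p a b => SubL.ext' (act_mul _ _ _)
      aP_sp := act_sp
      aQ_sp := fun p => SubL.sp_of_val hS (act_sp _)
      aP_sp' := act_sp'
      aQ_sp' := fun a => SubL.sp_of_val hS ((act_sp' a).comp vsp)
      β_sp := fun q => ip_sp _
      β_sp' := fun p => (ip_sp' p).comp vsp
      βP := fun q p a => ip_act _ _ _
      βQ := fun q p a => act_ip _ _ _
      sepP := fun p p' h => C.Jsep fun θ hθ a x => h ⟨_, hT θ hθ a x⟩
      sepQ := fun q q' h => SubL.ext' (ip_ext' (A := B) h)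
      essP := essM K
      essQ := by
        refine SubL.ind (S := {x | ∃ t ∈ T0, ∃ b : B, x = qact t b}) ?_ ?_
        · exact SC.scl _
        · rintro _ ⟨t, ht, b, rfl⟩
          have hb := essA C.hB b
          let g : B → SubL (fun k : K.carrier => k ∈ TT T0) := fun b =>
            ⟨qact t b, SC.sub ⟨t, ht, b, rfl⟩⟩
          have hg : SP g := SubL.sp_of_val hS (act_sp t)
          refine SC.map hg ?_ hb
          rintro _ ⟨b1, b2, rfl⟩
          refine SC.sub ⟨g b1, b2, SubL.ext' ?_⟩
          exact act_mul _ _ _ }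
  let H := D.obj C.hB
  obtain ⟨M, ⟨rH⟩⟩ := C.exN H
  obtain ⟨Y, ⟨rB⟩⟩ := C.exN (selfObj B C.hB)
  let p : M.carrier → C.X.carrier → K.carrier := fun m x => D.f C.hB (C.th rH m x)
  have psp : ∀ x, SP (fun m => p m x) := fun x => (D.f_sp C.hB).comp (C.th_sp rH x)
  have pact : ∀ m a x, p (qact m a) x = p m (C.lam a x) := fun m a x => by
    simp only [p, C.th_act]
  have hp1 : ∀ m, ∀ t ∈ T0, ∀ b : B, C.perp (qact t b) (p m) := by
    intro m t ht b
    refine ⟨C.ths rH m (D.mk' C.hB ⊥ ⟨qact t b, SC.sub ⟨t, ht, b, rfl⟩⟩), fun x => ?_⟩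
    rw [← C.th_adj, D.ip_eq]
    simp only [D.s_mk, D.f_mk, D.β_bot, sup_bot_eq]
    exact (star_ip _ _).symm
  have hp2 : ∀ m, C.perp y (p m) := by
    refine indM M ?_ ?_
    · have : SP p := by
        apply SP.of_iSup
        intro ι g
        funext x
        rw [(psp x).map_iSup, iSup_apply]
      exact (C.perp_scl' y).comp this
    · intro m a
      have := hy (p m) (hp1 m) a
      simpa only [← pact] using this
  have hs : ∃ s : M.carrier → Y.carrier, ∀ m x, C.th rB (s m) x = ofB C.hB (qip B y (p m x)) := by
    apply C.th_fam rB (fun m x => ofB C.hB (qip B y (p m x)))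
    · intro x
      exact (ofB_sp C.hB).comp ((ip_sp y).comp (psp x))
    · intro m a x
      rw [pact]
    · intro m
      obtain ⟨ψ, hψ⟩ := hp2 m
      refine ⟨fun b => qact ψ (toB C.hB b), fun x b => ?_⟩
      rw [ip_act, ← hψ, self_ip, toB_ofB, star_ip]
  obtain ⟨s, hs⟩ := hs
  have hT2 : ∀ y' x, qact y (toB C.hB (C.th rB y' x)) ∈ TT T0 := by
    intro y' x
    refine indM Y (P := fun y' => qact y (toB C.hB (C.th rB y' x)) ∈ TT T0) ?_ ?_ y'
    · exact hS.comp ((act_sp y).comp ((toB_sp C.hB).comp (C.th_sp rB x)))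
    · intro y' a
      rw [C.th_act]
      exact hT _ (C.act_sub_lin y rB y') a x
  have hs' : ∃ s' : Y.carrier → M.carrier, ∀ y' x, C.th rH (s' y') x =
      D.mk' C.hB ⊥ ⟨qact y (toB C.hB (C.th rB y' x)), hT2 y' x⟩ := by
    apply C.th_fam rH (fun y' x =>
      D.mk' C.hB ⊥ ⟨qact y (toB C.hB (C.th rB y' x)), hT2 y' x⟩)
    · intro x
      apply SP.of_iSup
      intro ι g
      apply D.ext''
      · rw [(D.f_sp C.hB).map_iSup]
        simp
      · rw [(D.s_sp C.hB).map_iSup]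
        apply SubL.ext'
        rw [vsp.map_iSup]
        exact ((act_sp y).comp ((toB_sp C.hB).comp (C.th_sp rB x))).map_iSup g
    · intro m a x
      congr 2
      rw [C.th_act]
    · intro y'
      obtain ⟨g, hg⟩ := C.act_sub_lin y rB y'
      refine ⟨fun h => g (D.f C.hB h), fun x h => ?_⟩
      rw [← hg, D.ip_eq]
      simp only [D.s_mk, D.f_mk, D.β_bot, star_bot', bot_sup_eq]
      rfl
  obtain ⟨s', hs'⟩ := hs'
  have hadj : IsAdjointPair A s' s := by
    intro y' m
    apply C.ip_th_ext rH rB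
    intro x x'
    rw [hs', hs, D.ip_eq]
    simp only [D.s_mk, D.f_mk, D.β_bot, star_bot', bot_sup_eq]
    rw [self_ip, toB_ofB]
    exact act_ip _ _ _
  obtain ⟨t, t', htt, ht1, ht2⟩ := C.trans rB rH s' s hadj
  have key : ∀ m x, qip B (C.th rH m x) (t (ofB C.hB b)) = qip B (p m x) (qact y b) := by
    intro m x
    rw [← htt.symm', ht2, hs, ip_act, self_ip, toB_ofB, toB_ofB, star_ip]
  have : (D.s C.hB (t (ofB C.hB b))).val = qact y b := by
    apply C.Jsep
    intro θ hθ a x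
    have hθ' : Adjointable B (fun x => D.mk' C.hB (θ x) ⊥) := by
      obtain ⟨g, hg⟩ := hθ
      refine ⟨fun h => g (D.s C.hB h).val, fun x h => ?_⟩
      rw [← hg, D.ip_eq]
      simp only [D.s_mk, D.f_mk, D.β_bot', sup_bot_eq]
      exact star_ip _ _
    obtain ⟨m, hm⟩ := C.th_full rH _ hθ' a
    have := key m x
    simp only [p] at this
    rw [hm, D.ip_eq] at this
    simp only [D.s_mk, D.f_mk, D.β_bot', sup_bot_eq] at this
    rw [← this]
    exact (star_ip _ _).symm
  rw [← this]
  exact (D.s C.hB (t (ofB C.hB b))).prop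

end Ctx
end MC

namespace MC

namespace Ctx
variable {A B : Type u} [InvQuantale A] [InvQuantale B] (C : Ctx A B)

/-- span of `p ∘ lam a` -/
abbrev PP {K : HObj B} (P0 : Set (C.X.carrier → K.carrier)) : Set (C.X.carrier → K.carrier) :=
  SC {q | ∃ p ∈ P0, ∃ a : A, q = fun x => p (C.lam a x)}

theorem comp_lam_sp {K : HObj B} (a : A) :
    SP (fun p : C.X.carrier → K.carrier => fun x => p (C.lam a x)) := by
  apply SP.of_iSup
  intro ι g
  funext x
  simp

theorem PP_act {K : HObj B} {P0 : Set (C.X.carrier → K.carrier)} {q : C.X.carrier → K.carrier}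
    (h : q ∈ C.PP P0) (a : A) : (fun x => q (C.lam a x)) ∈ C.PP P0 := by
  refine SC.map (C.comp_lam_sp a) ?_ h
  rintro _ ⟨p, hp, a', rfl⟩
  exact SC.sub ⟨p, hp, a' * a, by funext x; rw [C.lam_mul]⟩

theorem sp_of_perp {K : HObj B} {p : C.X.carrier → K.carrier}
    (h : ∀ θ : C.X.carrier → K.carrier, Adjointable B θ → ∀ a x, C.perp (θ (C.lam a x)) p) :
    SP p := by
  apply SP.of_iSup
  intro ι g
  apply C.Jsep'
  intro θ hθ a x
  obtain ⟨ψ, hψ⟩ := h θ hθ a x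
  rw [hψ, qip_iSup_left, qip_iSup_left]
  exact iSup_congr fun i => (hψ _).symm

theorem sp_scl {M : Type v} {N : Type w} [CompleteLattice M] [CompleteLattice N] :
    SCl (fun f : M → N => SP f) := by
  apply SCl.of_iSup
  intro ι f hf
  have := SP.iSup' hf
  intro S
  simpa using this S

theorem BP (K : HObj B) (P0 : Set (C.X.carrier → K.carrier))
    (h1 : ∀ p ∈ P0, ∀ θ : C.X.carrier → K.carrier, Adjointable B θ → ∀ a x,
      C.perp (θ (C.lam a x)) p)
    (h2 : ∀ θ : C.X.carrier → K.carrier, Adjointable B θ → ∀ a,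
      (fun x => θ (C.lam a x)) ∈ C.PP P0)
    (r : C.X.carrier → K.carrier)
    (hr : ∀ t : K.carrier, (∀ p ∈ P0, ∀ a, C.perp t (fun x => p (C.lam a x))) →
      ∀ b : B, C.perp (qact t b) r) (a : A) : (fun x => r (C.lam a x)) ∈ C.PP P0 := by
  obtain ⟨Y, ⟨ρ⟩⟩ := C.exN K
  let hS : SCl (fun q => q ∈ C.PP P0) := SC.scl _
  let _ : CompleteLattice (SubL (fun q => q ∈ C.PP P0)) := SubL.lat hS
  have vsp : SP (SubL.val : SubL (fun q => q ∈ C.PP P0) → _) := SubL.val_sp hS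
  have vspx : ∀ x, SP (fun p : SubL (fun q => q ∈ C.PP P0) => p.val x) := fun x =>
    (SP.eval x).comp vsp
  have psp : ∀ q ∈ C.PP P0, SP q := by
    intro q hq
    refine SC.ind sp_scl ?_ hq
    rintro _ ⟨p, hp, a, rfl⟩
    exact (C.sp_of_perp (h1 p hp)).comp (C.lam_sp' a)
  have hβ : ∀ (y : Y.carrier) (p : SubL (fun q => q ∈ C.PP P0)),
      ∃ a, ∀ x, C.lam a x = C.ths ρ y (p.val x) := by
    intro y p
    refine SC.ind (P := fun q => ∃ a, ∀ x, C.lam a x = C.ths ρ y (q x)) ?_ ?_ p.prop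
    · apply SCl.exists'
      intro ι f g h x
      rw [(C.lam_sp x).map_iSup, iSup_apply, (Adj_sp (C.ths_Adj ρ y)).map_iSup]
      exact iSup_congr fun i => h i x
    · rintro _ ⟨p, hp, a, rfl⟩
      refine indM Y (P := fun y => ∃ a', ∀ x, C.lam a' x = C.ths ρ y (p (C.lam a x))) ?_ ?_ y
      · apply SCl.exists'
        intro ι f g h x
        rw [(C.lam_sp x).map_iSup, (C.ths_sp ρ _).map_iSup]
        exact iSup_congr fun i => h i x
      · intro y a'
        have hadj : Adjointable B (fun x => C.ths ρ (qact y a') (p x)) := by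
          have : ∀ x', ∃ ψ, ∀ x, qip B (p x) (C.th ρ y (C.lam a' x')) = qip B x ψ :=
            fun x' => h1 p hp _ (C.th_Adj ρ y) a' x'
          choose g hg using this
          refine ⟨g, fun x x' => ?_⟩
          rw [← hg, ← C.th_act, (C.th_adj ρ _).symm']
        obtain ⟨a'', h⟩ := C.lam_full _ hadj a
        exact ⟨a'', fun x => (h x).symm⟩
  choose β hβ using hβ
  have thP : ∀ y, C.th ρ y ∈ C.PP P0 := by
    refine indM Y ?_ ?_
    · apply hS.comp
      apply SP.of_iSup
      intro ι g
      funext x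
      rw [(C.th_sp ρ x).map_iSup, iSup_apply]
    · intro y a
      have := h2 _ (C.th_Adj ρ y) a
      simp only [← C.th_act] at this
      exact this
  have βth : ∀ y y', β y ⟨C.th ρ y', thP y'⟩ = qip A y y' := by
    intro y y'
    apply C.lam_inj
    intro x
    rw [hβ, C.ths_th]
  let D : Hyp A (SubL (fun q => q ∈ C.PP P0)) Y.carrier :=
    { aP := fun p a => ⟨fun x => p.val (C.lam a x), C.PP_act p.prop a⟩
      aQ := fun y a => qact y a
      β := β
      aP_mul := fun p a b => SubL.ext' (by funext x; simp only [C.lam_mul])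
      aQ_mul := act_mul
      aP_sp := fun p => SubL.sp_of_val hS (by
        apply SP.of_iSup
        intro ι g
        funext x
        simp only [iSup_apply]
        exact ((psp _ p.prop).comp (C.lam_sp x)).map_iSup g)
      aQ_sp := act_sp
      aP_sp' := fun a => SubL.sp_of_val hS ((C.comp_lam_sp a).comp vsp)
      aQ_sp' := act_sp'
      β_sp := fun y => by
        apply SP.of_iSup
        intro ι g
        apply C.lam_inj
        intro x
        rw [hβ, (C.lam_sp x).map_iSup, (vspx x).map_iSup, (Adj_sp (C.ths_Adj ρ y)).map_iSup]
        exact iSup_congr fun i => (hβ _ _ _).symm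
      β_sp' := fun p => by
        apply SP.of_iSup
        intro ι g
        apply C.lam_inj
        intro x
        rw [hβ, (C.lam_sp x).map_iSup, (C.ths_sp ρ _).map_iSup]
        exact iSup_congr fun i => (hβ _ _ _).symm
      βP := fun y p a => by
        apply C.lam_inj
        intro x
        rw [hβ, C.lam_mul, hβ]
      βQ := fun y p a => by
        apply C.lam_inj
        intro x
        rw [hβ, C.lam_mul, hβ, C.ths_act]
      sepP := fun p p' h => by
        apply SubL.ext'
        funext x
        apply C.th_sep ρ
        intro y
        rw [← hβ, ← hβ, h]
      sepQ := fun y y' h => by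
        apply ip_ext' (A := A)
        intro z
        rw [← βth, ← βth, h]
      essP := by
        refine SubL.ind (S := {q | ∃ p ∈ P0, ∃ a : A, q = fun x => p (C.lam a x)}) ?_ ?_
        · exact SC.scl _
        · rintro _ ⟨p, hp, a, rfl⟩
          let g : A → SubL (fun q => q ∈ C.PP P0) := fun a =>
            ⟨fun x => p (C.lam a x), SC.sub ⟨p, hp, a, rfl⟩⟩
          have hg : SP g := SubL.sp_of_val hS (by
            apply SP.of_iSup
            intro ι f
            funext x
            simp only [iSup_apply]
            exact ((C.sp_of_perp (h1 p hp)).comp (C.lam_sp x)).map_iSup f)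
          refine SC.map hg ?_ (essA C.hA a)
          rintro _ ⟨a1, a2, rfl⟩
          refine SC.sub ⟨g a1, a2, SubL.ext' ?_⟩
          funext x
          exact congrArg p (C.lam_mul _ _ _)
      essQ := essM Y }
  have Dβ : ∀ y p, D.β y p = β y p := fun _ _ => rfl
  let MP := D.obj C.hA
  have hi : IsAdjointPair A (fun y => D.mk' C.hA ⟨C.th ρ y, thP y⟩ ⊥) (fun m => D.s C.hA m) := by
    intro y m
    rw [D.ip_eq]
    simp only [D.s_mk, D.f_mk, D.β_bot', sup_bot_eq]
    rw [Dβ, βth, star_ip]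
  obtain ⟨N, ⟨τ⟩⟩ := C.exM MP
  obtain ⟨i, i', hii, hi1, hi2⟩ := C.trans ρ τ _ _ hi
  have key1 : ∀ m k, C.ths τ m (i k) = C.ths ρ (D.s C.hA m) k := by
    intro m k
    apply ip_ext (A := B)
    intro x
    rw [← C.th_adj, ← C.th_adj, ← hii.symm', hi2]
  have key2 : ∀ p x, C.th τ (D.mk' C.hA p ⊥) x = i (p.val x) := by
    intro p x
    apply C.th_sep τ
    intro m
    rw [C.ths_th, key1, D.ip_eq]
    simp only [D.s_mk, D.f_mk, D.β_bot', star_bot', bot_sup_eq]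
    rw [Dβ, hβ]
  have hρ : Adjointable B (fun x => i (r x)) := by
    apply C.adj_of_perp'
    intro w b
    have : C.perp (qact (i' w) b) r := by
      apply hr
      intro p hp a
      refine ⟨C.ths τ (D.mk' C.hA ⟨_, SC.sub ⟨p, hp, a, rfl⟩⟩ ⊥) w, fun x => ?_⟩
      rw [← C.th_adj, key2, hii]
    obtain ⟨ψ, hψ⟩ := this
    refine ⟨ψ, fun x => ?_⟩
    rw [← hψ, hii, adj_lin hii.symm']
  obtain ⟨m, hm⟩ := C.th_full τ _ hρ a
  have : (fun x => r (C.lam a x)) = (D.f C.hA m).val := by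
    funext x
    apply C.th_sep ρ
    intro y
    have e : C.ths τ (D.mk' C.hA ⊥ y) (C.th τ m x) = C.ths τ (D.mk' C.hA ⊥ y) (i (r (C.lam a x))) := by
      rw [hm]
    rw [C.ths_th, key1, D.ip_eq] at e
    simp only [D.s_mk, D.f_mk, D.β_bot, star_bot', bot_sup_eq] at e
    rw [← e, Dβ, hβ]
  rw [this]
  exact (D.f C.hA m).prop

end Ctx
end MC

namespace MC

section K2
variable {B : Type u} [InvQuantale B]

/-- the Hilbert module `B ⊕ B` -/
@[reducible] def hilb2 (hB : InvQuantale.MReg B) : QHilb B (B × B) where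
  act x a := (x.1 * a, x.2 * a)
  act_mul x a b := by simp only [mul_assoc']
  sSup_act S a := by
    have h1 : SP (fun x : B × B => x.1 * a) := (mul_sp' a).comp Hyp.fst_sp
    have h2 : SP (fun x : B × B => x.2 * a) := (mul_sp' a).comp Hyp.snd_sp
    ext
    · rw [Prod.fst_iSup]; simp only [Prod.fst_iSup]; exact h1 S
    · rw [Prod.snd_iSup]; simp only [Prod.snd_iSup]; exact h2 S
  act_sSup x S := by
    ext
    · rw [Prod.fst_iSup]; simp only [Prod.fst_iSup]; exact mul_sp _ S
    · rw [Prod.snd_iSup]; simp only [Prod.snd_iSup]; exact mul_sp _ S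
  ip x y := star x.1 * y.1 ⊔ star x.2 * y.2
  ip_mul x y a := by
    rw [(mul_sp' a).map_sup, mul_assoc', mul_assoc']
  sSup_ip S y := by
    have h1 : SP (fun x : B × B => star x.1 * y.1) :=
      (mul_sp' _).comp (star_sp.comp Hyp.fst_sp)
    have h2 : SP (fun x : B × B => star x.2 * y.2) :=
      (mul_sp' _).comp (star_sp.comp Hyp.snd_sp)
    exact h1.sup' h2 S
  ip_sSup x S := by
    have h1 : SP (fun y : B × B => star x.1 * y.1) := (mul_sp _).comp Hyp.fst_sp
    have h2 : SP (fun y : B × B => star x.2 * y.2) := (mul_sp _).comp Hyp.snd_sp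
    exact h1.sup' h2 S
  star_ip x y := by rw [star_sp.map_sup, sm, sm, ss, ss]
  ip_sep x y h := by
    have e : ∀ c : B, ⊥ * c = ⊥ := fun c => (mul_sp' c).map_bot
    ext
    · apply rsepA hB
      intro q
      have := h (star q, ⊥)
      simpa [star_bot', e, ss] using this
    · apply rsepA hB
      intro q
      have := h (⊥, star q)
      simpa [star_bot', e, ss] using this

theorem pair_sup {P Q : Type*} [CompleteLattice P] [CompleteLattice Q] (p : P) (q : Q) :
    ((p, q) : P × Q) = (p, ⊥) ⊔ (⊥, q) := by simp

/-- `B ⊕ B` as an object -/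
def K2 (hB : InvQuantale.MReg B) : HObj B :=
  letI := hilb2 hB
  mkObj hB (B × B) (by
    apply ess_of_SC
    rintro ⟨p, q⟩
    rw [pair_sup]
    have e : ∀ c : B, ⊥ * c = ⊥ := fun c => (mul_sp' c).map_bot
    apply (SC.scl _).sup
    · have h1 : SP (fun p : B => ((p, ⊥) : B × B)) := by
        apply SP.of_iSup; intro ι g; ext <;> simp [Prod.fst_iSup, Prod.snd_iSup]
      refine SC.map h1 ?_ (essA hB p)
      rintro _ ⟨p, a, rfl⟩
      refine SC.sub ⟨(p, ⊥), a, ?_⟩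
      show _ = (p * a, ⊥ * a)
      rw [e]
    · have h1 : SP (fun p : B => ((⊥, p) : B × B)) := by
        apply SP.of_iSup; intro ι g; ext <;> simp [Prod.fst_iSup, Prod.snd_iSup]
      refine SC.map h1 ?_ (essA hB q)
      rintro _ ⟨p, a, rfl⟩
      refine SC.sub ⟨(⊥, p), a, ?_⟩
      show _ = (⊥ * a, p * a)
      rw [e])

variable (hB : InvQuantale.MReg B)
/-- pairing -/
def k2 (p q : B) : (K2 hB).carrier := (show B × B from (p, q))
/-- first component -/
def kf (x : (K2 hB).carrier) : B := (show B × B from x).1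
/-- second component -/
def ks (x : (K2 hB).carrier) : B := (show B × B from x).2

@[simp] theorem kf_mk (p q : B) : kf hB (k2 hB p q) = p := rfl
@[simp] theorem ks_mk (p q : B) : ks hB (k2 hB p q) = q := rfl
theorem k2_eta (x : (K2 hB).carrier) : k2 hB (kf hB x) (ks hB x) = x := rfl
theorem kf_sp : SP (kf hB) := Hyp.fst_sp
theorem ks_sp : SP (ks hB) := Hyp.snd_sp
theorem k_ip (x y : (K2 hB).carrier) :
    qip B x y = star (kf hB x) * kf hB y ⊔ star (ks hB x) * ks hB y := rfl
theorem kf_act (x : (K2 hB).carrier) (b : B) : kf hB (qact x b) = kf hB x * b := rfl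
theorem ks_act (x : (K2 hB).carrier) (b : B) : ks hB (qact x b) = ks hB x * b := rfl
end K2

namespace Ctx
variable {A B : Type u} [InvQuantale A] [InvQuantale B] (C : Ctx A B)

/-- `perp` for `B`-valued maps -/
def bp (t : B) (p : C.X.carrier → B) : Prop := ∃ ψ, ∀ x, star (p x) * t = qip B x ψ

/-- `perp` for pairs -/
def bp2 (t1 t2 : B) (p1 p2 : C.X.carrier → B) : Prop :=
  ∃ ψ, ∀ x, star (p1 x) * t1 ⊔ star (p2 x) * t2 = qip B x ψ

/-- adjointable `B`-valued maps -/
def ad (p : C.X.carrier → B) : Prop := ∀ t, C.bp t p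

theorem bp_eq (t : B) (p : C.X.carrier → B) :
    C.bp t p = C.perp (K := selfObj B C.hB) (ofB C.hB t) (fun x => ofB C.hB (p x)) := rfl

theorem bp_scl (p : C.X.carrier → B) : SCl (fun t => C.bp t p) := by
  apply SCl.exists'
  intro ι f g h x
  rw [(mul_sp _).map_iSup, qip_iSup_right]
  exact iSup_congr fun i => h i x

theorem bp_scl' (t : B) : SCl (fun p => C.bp t p) := by
  apply SCl.exists'
  intro ι f g h x
  rw [iSup_apply, star_sp.map_iSup, (mul_sp' _).map_iSup, qip_iSup_right]
  exact iSup_congr fun i => h i x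

theorem ad_scl : SCl (fun p => C.ad p) := SCl.forall' fun t => C.bp_scl' t

theorem bp_act {t : B} {p : C.X.carrier → B} (h : C.bp t p) (b : B) : C.bp (t * b) p := by
  obtain ⟨ψ, h⟩ := h
  exact ⟨qact ψ b, fun x => by rw [← mul_assoc', h, ip_act]⟩

theorem bp_lam {t : B} {p : C.X.carrier → B} (h : C.bp t p) (a : A) :
    C.bp t (fun x => p (C.lam a x)) := by
  obtain ⟨ψ, h⟩ := h
  exact ⟨C.lam (star a) ψ, fun x => by rw [h, C.lam_adj]⟩

theorem bp_mul {t : B} {p : C.X.carrier → B} {b : B} (h : C.bp (star b * t) p) :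
    C.bp t (fun x => b * p x) := by
  obtain ⟨ψ, h⟩ := h
  exact ⟨ψ, fun x => by rw [← h, sm, mul_assoc']⟩

theorem ad_lam {p : C.X.carrier → B} (h : C.ad p) (a : A) :
    C.ad (fun x => p (C.lam a x)) := fun t => C.bp_lam (h t) a

theorem ad_mul {p : C.X.carrier → B} (h : C.ad p) (b : B) :
    C.ad (fun x => b * p x) := fun t => C.bp_mul (h _)

theorem ad_bot : C.ad ⊥ := C.ad_scl.bot

theorem bp2_of {t1 t2 : B} {p1 p2 : C.X.carrier → B} (h1 : C.bp t1 p1) (h2 : C.bp t2 p2) :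
    C.bp2 t1 t2 p1 p2 := by
  obtain ⟨ψ, h1⟩ := h1
  obtain ⟨ψ', h2⟩ := h2
  exact ⟨ψ ⊔ ψ', fun x => by rw [h1, h2, (ip_sp x).map_sup]⟩

theorem bp2_act {t1 t2 : B} {p1 p2 : C.X.carrier → B} (h : C.bp2 t1 t2 p1 p2) (b : B) :
    C.bp2 (t1 * b) (t2 * b) p1 p2 := by
  obtain ⟨ψ, h⟩ := h
  exact ⟨qact ψ b, fun x => by
    rw [← mul_assoc', ← mul_assoc', ← (mul_sp' b).map_sup, h, ip_act]⟩

theorem ad_Adj {p : C.X.carrier → B} (h : C.ad p) :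
    Adjointable B (fun x => ofB C.hB (p x)) := C.adj_of_perp h

theorem Adj_ad {p : C.X.carrier → (selfObj B C.hB).carrier} (h : Adjointable B p) :
    C.ad (fun x => toB C.hB (p x)) := fun t => C.perp_of_adj (K := selfObj B C.hB) t h

theorem ad_lin {p : C.X.carrier → B} (h : C.ad p) (x : C.X.carrier) (b : B) :
    p (qact x b) = p x * b := Adj_lin (C.ad_Adj h) x b

theorem ad_sp {p : C.X.carrier → B} (h : C.ad p) : SP p := by
  have h' : SP (fun x => ofB C.hB (p x)) := Adj_sp (C.ad_Adj h)
  exact (toB_sp C.hB).comp h'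

/-- the trace ideal -/
def J : Set B := SC {b | ∃ (θ : C.X.carrier → B) (a : A) (x : C.X.carrier), C.ad θ ∧ b = θ (C.lam a x)}

theorem J_mem {θ : C.X.carrier → B} (h : C.ad θ) (a : A) (x : C.X.carrier) : θ (C.lam a x) ∈ C.J :=
  SC.sub ⟨θ, a, x, h, rfl⟩

theorem J_scl : SCl (fun b => b ∈ C.J) := SC.scl _

theorem J_mul {j : B} (h : j ∈ C.J) (b : B) : j * b ∈ C.J := by
  refine SC.map (mul_sp' b) ?_ h
  rintro _ ⟨θ, a, x, hθ, rfl⟩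
  refine SC.sub ⟨θ, a, qact x b, hθ, ?_⟩
  rw [C.lam_lin, C.ad_lin hθ]

theorem mul_J {j : B} (h : j ∈ C.J) (b : B) : b * j ∈ C.J := by
  refine SC.map (mul_sp b) ?_ h
  rintro _ ⟨θ, a, x, hθ, rfl⟩
  exact SC.sub ⟨fun x => b * θ x, a, x, C.ad_mul hθ b, rfl⟩

theorem J_ind {P : B → Prop} (hP : SCl P) (h : ∀ j ∈ C.J, ∀ b, P (j * b)) {j : B} (hj : j ∈ C.J) :
    P j := by
  refine SC.ind hP ?_ hj
  rintro _ ⟨θ, a, x, hθ, rfl⟩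
  refine indM C.X (P := fun x => P (θ (C.lam a x))) ?_ ?_ x
  · exact hP.comp ((C.ad_sp hθ).comp (C.lam_sp' a))
  · intro x b
    rw [C.lam_lin, C.ad_lin hθ]
    exact h _ (C.J_mem hθ a x) b

theorem BT1 (T0 : Set B) (hT : ∀ j ∈ C.J, j ∈ T0) (y : B)
    (hy : ∀ p : C.X.carrier → B, (∀ t ∈ T0, ∀ b, C.bp (t * b) p) →
      ∀ a, C.bp y (fun x => p (C.lam a x)))
    {Q : B → Prop} (hQ : SCl Q) (hQ' : ∀ t ∈ T0, ∀ b, Q (t * b)) (b : B) : Q (y * b) := by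
  have := C.BT (selfObj B C.hB) T0 ?_ (ofB C.hB y) hy b
  · refine SC.ind (P := fun k => Q (toB C.hB k)) (hQ.comp (toB_sp C.hB)) ?_ this
    rintro _ ⟨t, ht, b, rfl⟩
    exact hQ' t ht b
  · intro θ hθ a x
    refine indM C.X (P := fun x => θ (C.lam a x) ∈ TT T0) ?_ ?_ x
    · exact (SC.scl _).comp ((Adj_sp hθ).comp (C.lam_sp' a))
    · intro x b
      rw [C.lam_lin, Adj_lin hθ]
      exact SC.sub ⟨_, hT _ (C.J_mem (C.Adj_ad hθ) a x), b, rfl⟩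

theorem kf_ad {θ : C.X.carrier → (K2 C.hB).carrier} (h : Adjointable B θ) :
    C.ad (fun x => kf C.hB (θ x)) := by
  intro t
  obtain ⟨ψ, h⟩ := C.perp_of_adj (k2 C.hB t ⊥) h
  refine ⟨ψ, fun x => ?_⟩
  rw [← h, k_ip, kf_mk, ks_mk, (mul_sp _).map_bot, sup_bot_eq]

theorem ks_ad {θ : C.X.carrier → (K2 C.hB).carrier} (h : Adjointable B θ) :
    C.ad (fun x => ks C.hB (θ x)) := by
  intro t
  obtain ⟨ψ, h⟩ := C.perp_of_adj (k2 C.hB ⊥ t) h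
  refine ⟨ψ, fun x => ?_⟩
  rw [← h, k_ip, kf_mk, ks_mk, (mul_sp _).map_bot, bot_sup_eq]

theorem BT2 (T0 : B → B → Prop) (hT : ∀ j ∈ C.J, ∀ j' ∈ C.J, T0 j j') (y1 y2 : B)
    (hy : ∀ p1 p2 : C.X.carrier → B, (∀ t1 t2, T0 t1 t2 → ∀ b, C.bp2 (t1 * b) (t2 * b) p1 p2) →
      ∀ a, C.bp2 y1 y2 (fun x => p1 (C.lam a x)) (fun x => p2 (C.lam a x)))
    {Q : B → B → Prop} (hQ : ∀ (ι : Type u) (f g : ι → B), (∀ i, Q (f i) (g i)) →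
      Q (⨆ i, f i) (⨆ i, g i))
    (hQ' : ∀ t1 t2, T0 t1 t2 → ∀ b, Q (t1 * b) (t2 * b)) (b : B) : Q (y1 * b) (y2 * b) := by
  have := C.BT (K2 C.hB) {k | T0 (kf C.hB k) (ks C.hB k)} ?_ (k2 C.hB y1 y2) ?_ b
  · refine SC.ind (P := fun k => Q (kf C.hB k) (ks C.hB k)) ?_ ?_ this
    · apply SCl.of_iSup
      intro ι g h
      rw [(kf_sp C.hB).map_iSup, (ks_sp C.hB).map_iSup]
      exact hQ _ _ _ h
    rintro _ ⟨t, ht, b, rfl⟩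
    exact hQ' _ _ ht b
  · intro θ hθ a x
    refine indM C.X (P := fun x => θ (C.lam a x) ∈ TT _) ?_ ?_ x
    · exact (SC.scl _).comp ((Adj_sp hθ).comp (C.lam_sp' a))
    · intro x b
      rw [C.lam_lin, Adj_lin hθ]
      exact SC.sub ⟨_, hT _ (C.J_mem (C.kf_ad hθ) a x) _ (C.J_mem (C.ks_ad hθ) a x), b, rfl⟩
  · intro p hp a
    exact hy (fun x => kf C.hB (p x)) (fun x => ks C.hB (p x))
      (fun t1 t2 ht b => hp (k2 C.hB t1 t2) ht b) a

theorem BP2 (P0 : (C.X.carrier → B) → (C.X.carrier → B) → Prop)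
    (h1 : ∀ p1 p2, P0 p1 p2 → ∀ j ∈ C.J, C.bp j p1 ∧ C.bp j p2)
    (h2 : ∀ θ1 θ2, C.ad θ1 → C.ad θ2 → P0 θ1 θ2)
    (r1 r2 : C.X.carrier → B)
    (hr : ∀ t1 t2, (∀ p1 p2, P0 p1 p2 → ∀ a,
      C.bp2 t1 t2 (fun x => p1 (C.lam a x)) (fun x => p2 (C.lam a x))) →
      ∀ b, C.bp2 (t1 * b) (t2 * b) r1 r2)
    {Q : (C.X.carrier → B) → (C.X.carrier → B) → Prop}
    (hQ : ∀ (ι : Type u) (f g : ι → C.X.carrier → B), (∀ i, Q (f i) (g i)) →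
      Q (⨆ i, f i) (⨆ i, g i))
    (hQ' : ∀ p1 p2, P0 p1 p2 → ∀ a, Q (fun x => p1 (C.lam a x)) (fun x => p2 (C.lam a x)))
    (a : A) : Q (fun x => r1 (C.lam a x)) (fun x => r2 (C.lam a x)) := by
  have := C.BP (K2 C.hB) {p | P0 (fun x => kf C.hB (p x)) (fun x => ks C.hB (p x))} ?_ ?_
    (fun x => k2 C.hB (r1 x) (r2 x)) ?_ a
  · refine SC.ind (P := fun q => Q (fun x => kf C.hB (q x)) (fun x => ks C.hB (q x))) ?_ ?_ this
    · apply SCl.of_iSup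
      intro ι g h
      have e1 : (fun x => kf C.hB ((⨆ i, g i) x)) = ⨆ i, fun x => kf C.hB (g i x) := by
        funext x; rw [iSup_apply, iSup_apply, (kf_sp C.hB).map_iSup]
      have e2 : (fun x => ks C.hB ((⨆ i, g i) x)) = ⨆ i, fun x => ks C.hB (g i x) := by
        funext x; rw [iSup_apply, iSup_apply, (ks_sp C.hB).map_iSup]
      rw [e1, e2]
      exact hQ _ _ _ h
    · rintro _ ⟨p, hp, a, rfl⟩
      exact hQ' _ _ hp a
  · intro p hp θ hθ a x
    have e1 := (h1 _ _ hp _ (C.J_mem (C.kf_ad hθ) a x)).1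
    have e2 := (h1 _ _ hp _ (C.J_mem (C.ks_ad hθ) a x)).2
    exact C.bp2_of e1 e2
  · intro θ hθ a
    exact SC.sub ⟨θ, h2 _ _ (C.kf_ad hθ) (C.ks_ad hθ), a, rfl⟩
  · intro t ht b
    refine hr (kf C.hB t) (ks C.hB t) ?_ b
    intro p1 p2 hp a
    exact ht (fun x => k2 C.hB (p1 x) (p2 x)) hp a

end Ctx
end MC

namespace MC


namespace Ctx
variable {A B : Type u} [InvQuantale A] [InvQuantale B] (C : Ctx A B)

/-- maps perpendicular to the trace ideal -/
def Hm (p : C.X.carrier → B) : Prop := ∀ j ∈ C.J, C.bp j p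

theorem ad_Hm {p : C.X.carrier → B} (h : C.ad p) : C.Hm p := fun j _ => h j

theorem Hm_scl : SCl (fun p => C.Hm p) :=
  SCl.forall' fun j => SCl.imp (C.bp_scl' j)

theorem Hm_mul {p : C.X.carrier → B} (h : C.Hm p) (b : B) : C.Hm (fun x => b * p x) :=
  fun j hj => C.bp_mul (h _ (C.mul_J hj _))

theorem Hm_lam {p : C.X.carrier → B} (h : C.Hm p) (a : A) : C.Hm (fun x => p (C.lam a x)) :=
  fun j hj => C.bp_lam (h j hj) a

theorem Hm_sp {p : C.X.carrier → B} (h : C.Hm p) : SP p := by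
  have : SP (fun x => ofB C.hB (p x)) := by
    apply C.sp_of_perp
    intro θ hθ a x
    exact h _ (C.J_mem (C.Adj_ad hθ) a x)
  exact (toB_sp C.hB).comp this

theorem Hm_of {p : C.X.carrier → B} (h : ∀ j ∈ C.J, ∀ b, C.bp (j * b) p) : C.Hm p :=
  fun _ hj => C.J_ind (C.bp_scl p) h hj

theorem ad_of {p : C.X.carrier → B} (h : ∀ t b, C.bp (t * b) p) : C.ad p :=
  indA C.hB (C.bp_scl p) h

theorem bp2_bot_right {t : B} {p1 p2 : C.X.carrier → B} (h : C.bp2 t ⊥ p1 p2) : C.bp t p1 := by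
  obtain ⟨ψ, h⟩ := h
  exact ⟨ψ, fun x => by rw [← h, (mul_sp _).map_bot, sup_bot_eq]⟩

theorem bp2_bot_left {t : B} {p1 p2 : C.X.carrier → B} (h : C.bp2 ⊥ t p1 p2) : C.bp t p2 := by
  obtain ⟨ψ, h⟩ := h
  exact ⟨ψ, fun x => by rw [← h, (mul_sp _).map_bot, bot_sup_eq]⟩

theorem bp2_bot1 {t1 t2 : B} {p2 : C.X.carrier → B}
    (h : C.bp2 t1 t2 (fun _ => ⊥) p2) : C.bp t2 p2 := by
  obtain ⟨ψ, h⟩ := h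
  exact ⟨ψ, fun x => by rw [← h, star_bot', (mul_sp' _).map_bot, bot_sup_eq]⟩

theorem star_mono {x y : B} (h : x ≤ y) : star x ≤ star y := star_sp.mono h
theorem mul_mono_l {x y : B} (h : x ≤ y) (z : B) : z * x ≤ z * y := (mul_sp z).mono h
theorem mul_mono_r {x y : B} (h : x ≤ y) (z : B) : x * z ≤ y * z := (mul_sp' z).mono h

theorem S2 {b κ : B} (hκ : star κ ∈ C.J) (hκb : κ ≤ b) {r : C.X.carrier → B} (hr : C.Hm r) (a : A) :
    ∃ z, C.ad z ∧ (∀ x, r (C.lam a x) ≤ z x) ∧ ∀ x, κ * z x ≤ b * r (C.lam a x) := by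
  have key := C.BP2
    (fun q1 q2 => ∃ p γ i1 i2, C.Hm p ∧ C.ad γ ∧ C.ad (p ⊔ γ) ∧ C.ad i1 ∧ C.ad i2 ∧
      q1 = p ⊔ i1 ∧ q2 = (fun x => b * p x) ⊔ (fun x => κ * γ x) ⊔ i2) ?_ ?_ r (fun x => b * r x) ?_
    (Q := fun q1 q2 => ∃ z i, C.ad z ∧ C.ad i ∧ q1 ≤ z ⊔ i ∧ i ≤ q1 ∧ (fun x => κ * z x) ≤ q2)
    ?_ ?_ a
  · obtain ⟨z, i, hz, hi, h1, h2, h3⟩ := key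
    refine ⟨z ⊔ i, C.ad_scl.sup hz hi, fun x => h1 x, fun x => ?_⟩
    show κ * (z x ⊔ i x) ≤ _
    rw [(mul_sp κ).map_sup]
    refine sup_le (h3 x) ?_
    exact (mul_mono_l (h2 x) κ).trans (mul_mono_r hκb _)
  · rintro _ _ ⟨p, γ, i1, i2, hp, hγ, hpγ, h1, h2, rfl, rfl⟩ j hj
    exact ⟨C.Hm_scl.sup hp (C.ad_Hm h1) j hj,
      C.Hm_scl.sup (C.Hm_scl.sup (C.Hm_mul hp b) (C.ad_Hm (C.ad_mul hγ κ))) (C.ad_Hm h2) j hj⟩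
  · intro θ1 θ2 h1 h2
    refine ⟨⊥, ⊥, θ1, θ2, C.Hm_scl.bot, C.ad_bot, C.ad_scl.sup C.ad_bot C.ad_bot, h1, h2, by simp, ?_⟩
    funext x
    show _ = b * ⊥ ⊔ κ * ⊥ ⊔ θ2 x
    rw [(mul_sp b).map_bot, (mul_sp κ).map_bot]
    simp
  · intro t1 t2 ht b''
    have hJ : (t1 ⊔ star b * t2) * b'' ∈ C.J := by
      have := C.BT2 (fun u w => ∃ j s, j ∈ C.J ∧ s ≤ w ∧ u = j ⊔ s) ?_ (t1 ⊔ star b * t2)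
        (star κ * t2) ?_ (Q := fun u v => ∃ j ∈ C.J, j ≤ u ∧ u ≤ j ⊔ v) ?_ ?_ b''
      · obtain ⟨j, hj, h1, h2⟩ := this
        have e : (t1 ⊔ star b * t2) * b'' = j ⊔ star κ * t2 * b'' := by
          apply le_antisymm h2
          refine sup_le h1 (mul_mono_r ?_ _)
          exact le_sup_of_le_right (mul_mono_r (star_mono hκb) _)
        rw [e]
        exact C.J_scl.sup hj (C.J_mul (C.J_mul hκ _) _)
      · intro j hj j' _
        exact ⟨j, ⊥, hj, bot_le, by simp⟩
      · intro p γ h a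
        have hp : C.Hm p := C.Hm_of fun j hj b1 => by
          have := h j ⊥ ⟨j, ⊥, hj, le_rfl, by simp⟩ b1
          rw [(mul_sp' b1).map_bot] at this
          exact C.bp2_bot_right this
        have hγ : C.ad γ := C.ad_of fun t b1 => by
          have := h ⊥ t ⟨⊥, ⊥, C.J_scl.bot, bot_le, by simp⟩ b1
          rw [(mul_sp' b1).map_bot] at this
          exact C.bp2_bot_left this
        have hpγ : C.ad (p ⊔ γ) := C.ad_of fun t b1 => by
          obtain ⟨ψ, h⟩ := h t t ⟨⊥, t, C.J_scl.bot, le_rfl, by simp⟩ b1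
          refine ⟨ψ, fun x => ?_⟩
          rw [← h, Pi.sup_apply, star_sp.map_sup, (mul_sp' _).map_sup]
        obtain ⟨ψ, h⟩ := ht p ((fun x => b * p x) ⊔ (fun x => κ * γ x))
          ⟨p, γ, ⊥, ⊥, hp, hγ, hpγ, C.ad_bot, C.ad_bot, by simp, by simp⟩ a
        refine ⟨ψ, fun x => ?_⟩
        rw [← h]
        simp only [Pi.sup_apply]
        rw [star_sp.map_sup, (mul_sp' _).map_sup, (mul_sp _).map_sup, sm, sm, mul_assoc', mul_assoc',
          sup_assoc]
      · intro ι f g h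
        choose j hj h1 h2 using h
        refine ⟨⨆ i, j i, C.J_scl.iSup _ hj, iSup_mono h1, ?_⟩
        rw [← iSup_sup_eq]
        exact iSup_mono h2
      · rintro _ t2 ⟨j, s, hj, hs, rfl⟩ b1
        refine ⟨j * b1, C.J_mul hj _, mul_mono_r le_sup_left _, ?_⟩
        rw [(mul_sp' _).map_sup]
        exact sup_le_sup le_rfl (mul_mono_r hs _)
    obtain ⟨ψ, h⟩ := hr _ hJ
    refine ⟨ψ, fun x => ?_⟩
    rw [← h, (mul_sp' _).map_sup, (mul_sp _).map_sup, sm]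
    simp only [mul_assoc']
  · intro ι f g h
    choose z i hz hi h1 h2 h3 using h
    refine ⟨⨆ k, z k, ⨆ k, i k, C.ad_scl.iSup _ hz, C.ad_scl.iSup _ hi, ?_, iSup_mono h2, ?_⟩
    · rw [← iSup_sup_eq]; exact iSup_mono h1
    · intro x
      show κ * (⨆ k, z k) x ≤ (⨆ k, g k) x
      rw [iSup_apply, iSup_apply, (mul_sp _).map_iSup]
      exact iSup_mono fun k => h3 k x
  · rintro _ _ ⟨p, γ, i1, i2, hp, hγ, hpγ, h1, h2, rfl, rfl⟩ a
    refine ⟨_, _, C.ad_lam hpγ a, C.ad_lam h1 a, fun x => ?_, fun x => ?_, fun x => ?_⟩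
    · simp only [Pi.sup_apply]
      exact sup_le_sup le_sup_left le_rfl
    · simp only [Pi.sup_apply]
      exact le_sup_right
    · simp only [Pi.sup_apply]
      rw [(mul_sp _).map_sup]
      refine le_sup_of_le_left (sup_le_sup (mul_mono_r hκb _) le_rfl)

/-- auxiliary relation -/
def TR (b κ : B) (q1 q2 : C.X.carrier → B) : Prop :=
  ∃ i r z, q1 = i ⊔ r ∧ z ≤ q2 ∧ C.ad i ∧ C.ad z ∧ C.Hm r ∧ C.Hm q2 ∧ r ≤ z ∧
    ∀ x, κ * z x ≤ b * r x

theorem TR_scl (b κ : B) (ι : Type u) (f g : ι → C.X.carrier → B) (h : ∀ k, C.TR b κ (f k) (g k)) :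
    C.TR b κ (⨆ k, f k) (⨆ k, g k) := by
  choose i r z h1 h2 h3 h4 h5 h6 h7 h8 using h
  refine ⟨⨆ k, i k, ⨆ k, r k, ⨆ k, z k, ?_, iSup_mono h2, C.ad_scl.iSup _ h3, C.ad_scl.iSup _ h4,
    C.Hm_scl.iSup _ h5, C.Hm_scl.iSup _ h6, iSup_mono h7, fun x => ?_⟩
  · rw [← iSup_sup_eq]; exact iSup_congr h1
  · rw [iSup_apply, iSup_apply, (mul_sp _).map_iSup, (mul_sp _).map_iSup]
    exact iSup_mono fun k => h8 k x

theorem TR_lam {b κ : B} {q1 q2 : C.X.carrier → B} (h : C.TR b κ q1 q2) (a : A) :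
    C.TR b κ (fun x => q1 (C.lam a x)) (fun x => q2 (C.lam a x)) := by
  obtain ⟨i, r, z, rfl, h2, h3, h4, h5, h6, h7, h8⟩ := h
  exact ⟨_, _, _, rfl, fun x => h2 _, C.ad_lam h3 a, C.ad_lam h4 a, C.Hm_lam h5 a, C.Hm_lam h6 a,
    fun x => h7 _, fun x => h8 _⟩

theorem TR_ad {b κ : B} {q1 q2 : C.X.carrier → B} (h1 : C.ad q1) (h2 : C.Hm q2) :
    C.TR b κ q1 q2 := by
  refine ⟨q1, ⊥, ⊥, by simp, bot_le, h1, C.ad_bot, C.Hm_scl.bot, h2, le_rfl, fun x => ?_⟩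
  simp only [Pi.bot_apply]
  rw [(mul_sp κ).map_bot]; exact bot_le

theorem TR_Hm {b κ : B} {q1 q2 : C.X.carrier → B} (h : C.TR b κ q1 q2) : C.Hm q1 ∧ C.Hm q2 := by
  obtain ⟨i, r, z, rfl, h2, h3, h4, h5, h6, h7, h8⟩ := h
  exact ⟨C.Hm_scl.sup (C.ad_Hm h3) h5, h6⟩

/-- auxiliary ideal -/
def LL (b κ : B) : Set B := {l | ∃ t1 t2, l = t1 ⊔ t2 ∧ t2 ∈ C.J ∧ ∀ q1 q2, C.TR b κ q1 q2 → ∀ a,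
  C.bp2 t1 t2 (fun x => q1 (C.lam a x)) (fun x => q2 (C.lam a x))}

theorem LL_scl (b κ : B) : SCl (fun l => l ∈ C.LL b κ) := by
  apply SCl.of_iSup
  intro ι g h
  choose t1 t2 h1 h2 h3 using h
  refine ⟨⨆ k, t1 k, ⨆ k, t2 k, ?_, C.J_scl.iSup _ h2, ?_⟩
  · rw [← iSup_sup_eq]; exact iSup_congr h1
  · intro q1 q2 hq a
    choose ψ hψ using fun k => h3 k q1 q2 hq a
    refine ⟨⨆ k, ψ k, fun x => ?_⟩
    rw [(mul_sp _).map_iSup, (mul_sp _).map_iSup, ← iSup_sup_eq, qip_iSup_right]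
    exact iSup_congr fun k => hψ k x

theorem LL_mul {b κ l : B} (h : l ∈ C.LL b κ) (c : B) : l * c ∈ C.LL b κ := by
  obtain ⟨t1, t2, rfl, h2, h3⟩ := h
  exact ⟨t1 * c, t2 * c, (mul_sp' c).map_sup _ _, C.J_mul h2 c, fun q1 q2 hq a => C.bp2_act (h3 q1 q2 hq a) c⟩

theorem J_LL {b κ j : B} (h : j ∈ C.J) : j ∈ C.LL b κ := by
  refine ⟨j, ⊥, by simp, C.J_scl.bot, fun q1 q2 hq a => ?_⟩
  refine C.bp2_of (C.bp_lam ((C.TR_Hm hq).1 j h) a) (C.bp_scl _).bot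

theorem LL_top (b κ l : B) : l ∈ C.LL b κ := by
  refine indA C.hB (C.LL_scl b κ) ?_ l
  intro y c
  refine C.BT1 (C.LL b κ) (fun j hj => C.J_LL hj) y ?_ (C.LL_scl b κ) (fun t ht c => C.LL_mul ht c) c
  intro q hq a
  have key := C.BP2 (C.TR b κ) (fun p1 p2 h j hj => ⟨(C.TR_Hm h).1 j hj, (C.TR_Hm h).2 j hj⟩)
    (fun p1 p2 h1 h2 => C.TR_ad h1 (C.ad_Hm h2)) q q ?_ (Q := C.TR b κ) (C.TR_scl b κ)
    (fun p1 p2 h a => C.TR_lam h a) a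
  · obtain ⟨i, r, z, h1, h2, h3, h4, h5, h6, h7, h8⟩ := key
    have e : (fun x => q (C.lam a x)) = i ⊔ z := by
      apply le_antisymm
      · rw [h1]; exact sup_le_sup le_rfl h7
      · refine sup_le ?_ h2
        rw [h1]; exact le_sup_left
    rw [e]
    exact C.ad_scl.sup h3 h4 y
  · intro t1 t2 ht b''
    have hJ : ∀ c, t2 * c ∈ C.J := by
      refine C.BT1 C.J (fun j hj => hj) t2 ?_ C.J_scl (fun t ht c => C.J_mul ht c)
      intro p hp a
      exact C.bp2_bot1 (ht ⊥ p (C.TR_ad C.ad_bot (C.Hm_of hp)) a)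
    have hL : ∀ c, (t1 ⊔ t2) * c ∈ C.LL b κ := fun c =>
      ⟨t1 * c, t2 * c, (mul_sp' c).map_sup _ _, hJ c, fun q1 q2 hq a => C.bp2_act (ht q1 q2 hq a) c⟩
    have h2 : C.bp ((t1 ⊔ t2) * b'') q := by
      refine indA C.hB (P := fun c => C.bp ((t1 ⊔ t2) * c) q) ?_ ?_ b''
      · exact (C.bp_scl q).comp (mul_sp _)
      · intro c d
        rw [← mul_assoc']
        exact hq _ (hL c) d
    obtain ⟨ψ, h2⟩ := h2
    refine ⟨ψ, fun x => ?_⟩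
    rw [← h2, (mul_sp' _).map_sup, (mul_sp _).map_sup]

theorem J_top (l : B) : l ∈ C.J := by
  suffices h : ∀ b c : B, star b * c ∈ C.J by
    refine indA C.hB C.J_scl (fun p q => ?_) l
    have := h (star p) q
    rwa [ss] at this
  intro b c
  refine C.BT1 C.J (fun j hj => hj) (star b) ?_ C.J_scl (fun t ht c => C.J_mul ht c) c
  intro r hr a
  have hr := C.Hm_of hr
  let κ : B := sSup {v | star v ∈ C.J ∧ v ≤ b}
  have hκ : star κ ∈ C.J :=
    (C.J_scl.comp star_sp) _ fun v hv => hv.1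
  have hκb : κ ≤ b := sSup_le fun v hv => hv.2
  obtain ⟨t1, t2, e, h2, h3⟩ := C.LL_top b κ (star b)
  have ht2 : star t2 ≤ κ := by
    apply le_sSup
    refine ⟨by rwa [ss], ?_⟩
    have : t2 ≤ star b := by rw [e]; exact le_sup_right
    have := star_mono this
    rwa [ss] at this
  refine indA C.hA (P := fun a => C.bp (star b) (fun x => r (C.lam a x))) ?_ ?_ a
  · refine (C.bp_scl' (star b)).comp ?_
    apply SP.of_iSup
    intro ι g
    funext x
    rw [(C.lam_sp x).map_iSup, (C.Hm_sp hr).map_iSup, iSup_apply]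
  · intro a a'
    obtain ⟨z, hz, h4, h5⟩ := C.S2 hκ hκb hr a
    obtain ⟨ψ, h6⟩ := h3 (fun x => r (C.lam a x)) z
      ⟨⊥, _, z, by simp, le_rfl, C.ad_bot, hz, C.Hm_lam hr a, C.ad_Hm hz, h4, h5⟩ a'
    refine ⟨ψ, fun x => ?_⟩
    rw [← h6]
    beta_reduce
    rw [C.lam_mul]
    apply le_antisymm
    · rw [e, (mul_sp _).map_sup]
      exact sup_le_sup le_rfl (mul_mono_r (star_mono (h4 _)) _)
    · refine sup_le ?_ ?_
      · rw [e]; exact mul_mono_l le_sup_left _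
      · have := star_mono ((mul_mono_r ht2 _).trans (h5 (C.lam a' x)))
        rwa [sm, ss, sm] at this

end Ctx
end MC

namespace MC


section Cat
variable {A : Type u} [InvQuantale A]

theorem hom_ext {M N : HObj A} {f g : M ⟶ N} (h : ∀ x, f.1 x = g.1 x) : f = g :=
  Subtype.ext (funext h)

theorem comp_app {M N P : HObj A} (f : M ⟶ N) (g : N ⟶ P) (x : M.carrier) :
    (f ≫ g).1 x = g.1 (f.1 x) := rfl

theorem id_app {M : HObj A} (x : M.carrier) : (𝟙 M : M ⟶ M).1 x = x := rfl

theorem hStar_eq {M N : HObj A} {f : M ⟶ N} {g : N ⟶ M} (h : IsAdjointPair A f.1 g.1) :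
    hStar f = g := by
  apply hom_ext
  intro n
  apply ip_ext (A := A)
  intro p
  rw [← hStar_adj f, h]

theorem hStar_hStar {M N : HObj A} (f : M ⟶ N) : hStar (hStar f) = f :=
  hStar_eq (hStar_adj f).symm'

theorem hStar_comp {M N P : HObj A} (f : M ⟶ N) (g : N ⟶ P) :
    hStar (f ≫ g) = hStar g ≫ hStar f := by
  apply hStar_eq
  intro m p
  rw [comp_app, comp_app, hStar_adj, hStar_adj]

/-- the map `a ↦ m ⋄ a` -/
def Tm (hA : InvQuantale.MReg A) {M : HObj A} (m : M.carrier) : selfObj A hA ⟶ M :=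
  ⟨fun a => qact m (toB hA a), ⟨fun n => ofB hA (qip A m n), fun a n => act_ip _ _ _⟩⟩

/-- the map `n ↦ ⟨m, n⟩` -/
def Ts (hA : InvQuantale.MReg A) {M : HObj A} (m : M.carrier) : M ⟶ selfObj A hA :=
  ⟨fun n => ofB hA (qip A m n), ⟨fun a => qact m (toB hA a), IsAdjointPair.symm' fun a n => act_ip _ _ _⟩⟩

theorem Tm_app (hA : InvQuantale.MReg A) {M : HObj A} (m : M.carrier) (a : (selfObj A hA).carrier) :
    (Tm hA m).1 a = qact m (toB hA a) := rfl

theorem Tm_star (hA : InvQuantale.MReg A) {M : HObj A} (m : M.carrier) : hStar (Tm hA m) = Ts hA m :=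
  hStar_eq fun _ _ => act_ip _ _ _

theorem Tm_act (hA : InvQuantale.MReg A) {M : HObj A} (m : M.carrier) (a : A) :
    Tm hA (qact m a) = lmulHom A hA a ≫ Tm hA m :=
  hom_ext fun b => (act_mul m a b).symm

theorem Tm_Ts (hA : InvQuantale.MReg A) {M : HObj A} (m m' : M.carrier) :
    Tm hA m' ≫ Ts hA m = lmulHom A hA (qip A m m') :=
  hom_ext fun b => ip_act m m' (toB hA b)

theorem Tm_comp (hA : InvQuantale.MReg A) {M N : HObj A} (m : M.carrier) (f : M ⟶ N) :
    Tm hA m ≫ f = Tm hA (f.1 m) := hom_ext fun b => Adj_lin f.2 _ _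

theorem Tm_self (hA : InvQuantale.MReg A) (a : (selfObj A hA).carrier) :
    Tm hA a = lmulHom A hA (toB hA a) := rfl

theorem Tm_inj (hA : InvQuantale.MReg A) {M : HObj A} {m m' : M.carrier} (h : Tm hA m = Tm hA m') :
    m = m' := by
  apply M.sep
  intro a
  exact congrArg (fun f => f.1 (ofB hA a)) h

theorem cancel_l {M N P : HObj A} {w : M ⟶ N} (hw : IsUnitaryHom w) {f g : N ⟶ P}
    (h : w ≫ f = w ≫ g) : f = g := by
  have : hStar w ≫ w ≫ f = hStar w ≫ w ≫ g := by rw [h]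
  rwa [← Category.assoc, ← Category.assoc, hw.2, Category.id_comp, Category.id_comp] at this

theorem cancel_r {M N P : HObj A} {w : N ⟶ P} (hw : IsUnitaryHom w) {f g : M ⟶ N}
    (h : f ≫ w = g ≫ w) : f = g := by
  have : (f ≫ w) ≫ hStar w = (g ≫ w) ≫ hStar w := by rw [h]
  rwa [Category.assoc, Category.assoc, hw.1, Category.comp_id, Category.comp_id] at this

end Cat

/-- bundled Morita data -/
structure Eqv (A B : Type u) [InvQuantale A] [InvQuantale B] where
  hA : InvQuantale.MReg A
  hB : InvQuantale.MReg B
  F : StarFunctor A B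
  G : StarFunctor B A
  η : F.toFunctor ⋙ G.toFunctor ⟶ 𝟭 (HObj A)
  ζ : G.toFunctor ⋙ F.toFunctor ⟶ 𝟭 (HObj B)
  hη : ∀ M : HObj A, IsUnitaryHom (η.app M)
  hζ : ∀ N : HObj B, IsUnitaryHom (ζ.app N)

namespace Eqv
variable {A B : Type u} [InvQuantale A] [InvQuantale B]

/-- symmetry -/
def symm (E : Eqv A B) : Eqv B A := ⟨E.hB, E.hA, E.G, E.F, E.ζ, E.η, E.hζ, E.hη⟩

variable (E : Eqv A B)

/-- component of the unit -/
def et (M : HObj A) : E.G.toFunctor.obj (E.F.toFunctor.obj M) ⟶ M := E.η.app M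

theorem et_uni (M : HObj A) : IsUnitaryHom (E.et M) := E.hη M

theorem et_nat {M N : HObj A} (f : M ⟶ N) :
    E.G.toFunctor.map (E.F.toFunctor.map f) ≫ E.et N = E.et M ≫ f := E.η.naturality f

theorem faithful {M N : HObj A} {f g : M ⟶ N}
    (h : E.F.toFunctor.map f = E.F.toFunctor.map g) : f = g := by
  have e1 := E.et_nat f
  rw [h, E.et_nat g] at e1
  exact (cancel_l (E.et_uni M) e1).symm

theorem full {M N : HObj A} (φ : E.F.toFunctor.obj M ⟶ E.F.toFunctor.obj N) :
    ∃ f : M ⟶ N, E.F.toFunctor.map f = φ := by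
  refine ⟨hStar (E.et M) ≫ E.G.toFunctor.map φ ≫ E.et N, ?_⟩
  apply E.symm.faithful
  show E.G.toFunctor.map (E.F.toFunctor.map _) = E.G.toFunctor.map φ
  apply cancel_r (E.et_uni N)
  rw [E.et_nat, ← Category.assoc, (E.et_uni M).1, Category.id_comp]

theorem F_iSup {M N : HObj A} {ι : Type u} (f : M ⟶ N) (g : ι → (M ⟶ N))
    (h : ∀ x, f.1 x = ⨆ i, (g i).1 x) (x : (E.F.toFunctor.obj M).carrier) :
    (E.F.toFunctor.map f).1 x = ⨆ i, (E.F.toFunctor.map (g i)).1 x := by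
  have e : f = hSup (Set.range g) := by
    apply hom_ext
    intro x
    rw [h]
    show _ = ⨆ f ∈ Set.range g, (f : M ⟶ N).1 x
    rw [iSup_range]
  rw [e, E.F.map_hSup]
  show (⨆ f ∈ (E.F.toFunctor.map '' Set.range g), (f : _ ⟶ _).1 x) = _
  rw [iSup_image, iSup_range]

theorem F_comp {M N P : HObj A} (f : M ⟶ N) (g : N ⟶ P) (x : (E.F.toFunctor.obj M).carrier) :
    (E.F.toFunctor.map (f ≫ g)).1 x = (E.F.toFunctor.map g).1 ((E.F.toFunctor.map f).1 x) := by
  rw [E.F.toFunctor.map_comp]; rfl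

theorem uni1 {M N : HObj A} {w : M ⟶ N} (h : IsUnitaryHom w) (x : M.carrier) :
    (hStar w).1 (w.1 x) = x := congrArg (fun k => k.1 x) h.1

theorem uni2 {M N : HObj A} {w : M ⟶ N} (h : IsUnitaryHom w) (x : N.carrier) :
    w.1 ((hStar w).1 x) = x := congrArg (fun k => k.1 x) h.2

/-- shorthand for the action of `F` on morphisms -/
abbrev m {M N : HObj A} (f : M ⟶ N) : E.F.toFunctor.obj M ⟶ E.F.toFunctor.obj N :=
  E.F.toFunctor.map f

theorem m_adj {M N : HObj A} (f : M ⟶ N) : IsAdjointPair B (E.m f).1 (E.m (hStar f)).1 := by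
  rw [m, m, E.F.map_star]; exact hStar_adj _

theorem m_sep {M : HObj A} (k k' : (E.F.toFunctor.obj M).carrier)
    (h : ∀ m : M.carrier, (E.m (Ts E.hA m)).1 k = (E.m (Ts E.hA m)).1 k') : k = k' := by
  let ζB : E.F.toFunctor.obj (E.G.toFunctor.obj (selfObj B E.hB)) ⟶ selfObj B E.hB :=
    E.ζ.app (selfObj B E.hB)
  have hζB : IsUnitaryHom ζB := E.hζ _
  obtain ⟨g, hg⟩ := E.full (ζB ≫ Tm E.hB k)
  obtain ⟨g', hg'⟩ := E.full (ζB ≫ Tm E.hB k')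
  have e : g = g' := by
    apply hom_ext
    intro y
    apply ip_ext (A := A)
    intro p
    have : g ≫ Ts E.hA p = g' ≫ Ts E.hA p := by
      apply E.faithful
      rw [E.F.toFunctor.map_comp, E.F.toFunctor.map_comp, hg, hg', Category.assoc, Category.assoc,
        Tm_comp, Tm_comp]
      have := h p
      rw [m] at this
      rw [this]
    exact congrArg (fun f => f.1 y) this
  rw [e, hg'] at hg
  exact (Tm_inj E.hB (cancel_l hζB hg)).symm

/-- the context -/
noncomputable def ctx : Ctx A B where
  hA := E.hA
  hB := E.hB
  X := E.F.toFunctor.obj (selfObj A E.hA)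
  lam a := (E.m (lmulHom A E.hA a)).1
  Rl M N := {w : E.F.toFunctor.obj M ⟶ N // IsUnitaryHom w}
  th w m x := w.1.1 ((E.m (Tm E.hA m)).1 x)
  ths w m n := (E.m (Ts E.hA m)).1 ((hStar w.1).1 n)
  th_adj w m := by
    intro x n
    rw [hStar_adj w.1, E.m_adj, Tm_star]
  th_sp {M N} w x := by
    refine (Adj_sp w.1.2).comp (f := fun m : M.carrier => (E.m (Tm E.hA m)).1 x) ?_
    apply SP.of_iSup
    intro ι g
    apply E.F_iSup
    intro a
    exact qact_iSup_left _ _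
  th_act w m a x := by
    rw [Tm_act, Eqv.m, E.F_comp]
  ths_th w m m' x := by
    rw [uni1 w.2, Eqv.m, Eqv.m, ← E.F_comp, Tm_Ts]
  th_sep w n n' h := by
    have := E.m_sep _ _ h
    have := congrArg w.1.1 this
    rwa [uni2 w.2, uni2 w.2] at this
  th_full {M N} w φ hφ a := by
    obtain ⟨f, hf⟩ := E.full (M := selfObj A E.hA) (N := M) (mkHom φ hφ ≫ hStar w.1)
    refine ⟨f.1 (ofB E.hA a), fun x => ?_⟩
    rw [← Tm_comp, m, E.F_comp, hf, comp_app, uni2 w.2]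
    rfl
  trans {M M' N N'} w w' s s' h := by
    let S : M ⟶ M' := mkHom s ⟨s', h⟩
    have hS : hStar S = mkHom s' ⟨s, h.symm'⟩ := hStar_eq h
    refine ⟨(hStar w.1 ≫ E.m S ≫ w'.1).1, (hStar w'.1 ≫ E.m (hStar S) ≫ w.1).1, ?_, ?_, ?_⟩
    · have e : hStar (hStar w.1 ≫ E.m S ≫ w'.1) = hStar w'.1 ≫ E.m (hStar S) ≫ w.1 := by
        rw [hStar_comp, hStar_comp, hStar_hStar, m, m, E.F.map_star, Category.assoc]
      rw [← e]
      exact hStar_adj _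
    · intro m x
      rw [comp_app, comp_app, uni1 w.2, Eqv.m, Eqv.m, ← E.F_comp, Tm_comp]
      rfl
    · intro m x
      rw [comp_app, comp_app, uni1 w'.2, Eqv.m, Eqv.m, ← E.F_comp, Tm_comp, hS]
      rfl
  exN N := ⟨E.G.toFunctor.obj N, ⟨⟨E.ζ.app N, E.hζ N⟩⟩⟩
  exM M := by
    refine ⟨E.F.toFunctor.obj M, ⟨⟨𝟙 _, ?_⟩⟩⟩
    have : hStar (𝟙 (E.F.toFunctor.obj M)) = 𝟙 _ := hStar_eq fun _ _ => rfl
    exact ⟨by rw [this]; rfl, by rw [this]; rfl⟩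
  lam_inj a b h := by
    have : lmulHom A E.hA a = lmulHom A E.hA b := E.faithful (hom_ext h)
    apply lsepA E.hA
    intro c
    exact congrArg (fun f => toB E.hA (f.1 (ofB E.hA c))) this
  lam_sp x := by
    apply SP.of_iSup
    intro ι g
    apply E.F_iSup
    intro a
    exact (mul_sp' (toB E.hA a)).map_iSup g
  lam_adj a := by
    have : hStar (lmulHom A E.hA a) = lmulHom A E.hA (star a) := hStar_eq fun x y => by
      show star (a * toB E.hA x) * toB E.hA y = star (toB E.hA x) * (star a * toB E.hA y)
      rw [sm, mul_assoc']
    rw [← this]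
    exact E.m_adj _
  lam_mul a b x := by
    have e : lmulHom A E.hA (a * b) = lmulHom A E.hA b ≫ lmulHom A E.hA a :=
      hom_ext fun c => mul_assoc' a b (toB E.hA c)
    rw [e, m, m, m, E.F_comp]
  lam_full φ hφ a := by
    obtain ⟨f, hf⟩ := E.full (M := selfObj A E.hA) (N := selfObj A E.hA) (mkHom φ hφ)
    refine ⟨toB E.hA (f.1 (ofB E.hA a)), fun x => ?_⟩
    rw [← Tm_self, ← Tm_comp, m, E.F_comp, hf]
    rfl

end Eqv
end MC

namespace MC


namespace Ctx
variable {A B : Type u} [InvQuantale A] [InvQuantale B] (C : Ctx A B)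

theorem full_ip (b : B) :
    b ∈ SC {c : B | ∃ (m y : C.X.carrier) (a : A), c = qip B m (C.lam a y)} := by
  refine indA C.hB (SC.scl _) ?_ b
  intro b1 b2
  refine SC.map (mul_sp b1) ?_ (C.J_top b2)
  rintro _ ⟨θ, a, x, hθ, rfl⟩
  obtain ⟨m, hm⟩ := hθ (star b1)
  refine SC.sub ⟨m, x, a, ?_⟩
  rw [← star_ip, ← hm, sm, ss, ss]

theorem rfull (b : B) : b ∈ SC {c : B | ∃ x y : C.X.carrier, c = qip B x y} :=
  SC.mono_sub (by rintro _ ⟨m, y, a, rfl⟩; exact SC.sub ⟨m, _, rfl⟩) (C.full_ip b)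

theorem theta_Adj (x y : C.X.carrier) : Adjointable B (fun z => qact x (qip B y z)) :=
  ⟨fun z => qact y (qip B x z), fun z w => by rw [act_ip, star_ip, ip_act]⟩

theorem lip_ex (x y : C.X.carrier) : ∃ a, ∀ z, C.lam a z = qact x (qip B y z) := by
  refine indM C.X (P := fun x => ∃ a, ∀ z, C.lam a z = qact x (qip B y z)) ?_ ?_ x
  · apply SCl.exists'
    intro ι f g h z
    rw [(C.lam_sp z).map_iSup, qact_iSup_left]
    exact iSup_congr fun i => h i z
  intro x b
  refine SC.ind (P := fun b => ∃ a, ∀ z, C.lam a z = qact (qact x b) (qip B y z)) ?_ ?_ (C.J_top b)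
  · apply SCl.exists'
    intro ι f g h z
    rw [(C.lam_sp z).map_iSup, qact_iSup_right, qact_iSup_left]
    exact iSup_congr fun i => h i z
  rintro _ ⟨θ, a, x', hθ, rfl⟩
  have h1 : Adjointable B (fun u => qact x (θ u)) :=
    Adj_comp (g := (Tm C.hB x).1) (f := fun u => ofB C.hB (θ u)) (Tm C.hB x).2 (C.ad_Adj hθ)
  obtain ⟨a1, h1⟩ := C.lam_full _ h1 a
  obtain ⟨a2, h2⟩ := C.lam_full' _ (C.theta_Adj x' y) a1
  refine ⟨a2, fun z => ?_⟩
  rw [← h2, ← h1, C.lam_lin, C.ad_lin hθ, act_mul]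

/-- left inner product -/
noncomputable def lip (x y : C.X.carrier) : A := (C.lip_ex x y).choose

theorem lam_lip (x y z : C.X.carrier) : C.lam (C.lip x y) z = qact x (qip B y z) :=
  (C.lip_ex x y).choose_spec z

theorem rsep' {x y : C.X.carrier}
    (h : ∀ z w : C.X.carrier, qact x (qip B z w) = qact y (qip B z w)) : x = y := by
  apply C.X.sep
  intro b
  refine SC.ind (P := fun b => qact x b = qact y b) (SCl.eq (act_sp x) (act_sp y)) ?_ (C.rfull b)
  rintro _ ⟨z, w, rfl⟩
  exact h z w

/-- the imprimitivity bimodule -/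
noncomputable def imp (hl : ∀ a : A, a ∈ SC {c : A | ∃ x y : C.X.carrier,
    ∀ z, C.lam c z = qact x (qip B y z)}) : ImprimObj A B where
  carrier := C.X.carrier
  lact := C.lam
  lip := C.lip
  imprim :=
    { bimod :=
        { lact_mul := C.lam_mul
          sSup_lact := fun S m => C.lam_sp m S
          lact_sSup := fun a S => C.lam_sp' a S
          lact_act := C.lam_lin
          ip_lact := fun a x y => C.lam_adj a x y }
      lip_lact := fun a x y => C.lam_inj _ _ fun z => by
        rw [C.lam_mul, C.lam_lip, C.lam_lip, C.lam_lin]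
      sSup_lip := fun S y => by
        refine SP.of_iSup (f := fun x => C.lip x y) (fun ι g => ?_) S
        apply C.lam_inj
        intro z
        rw [(C.lam_sp z).map_iSup, C.lam_lip, qact_iSup_left]
        exact iSup_congr fun i => (C.lam_lip _ _ _).symm
      lip_sSup := fun x S => by
        refine SP.of_iSup (f := fun y => C.lip x y) (fun ι g => ?_) S
        apply C.lam_inj
        intro z
        rw [(C.lam_sp z).map_iSup, C.lam_lip, qip_iSup_left, qact_iSup_right]
        exact iSup_congr fun i => (C.lam_lip _ _ _).symm
      star_lip := fun x y => C.lam_inj _ _ fun z => by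
        apply ip_ext (A := B)
        intro p
        rw [← C.lam_adj, C.lam_lip, C.lam_lip, act_ip, star_ip, ip_act]
      lip_sep := fun x y h => C.rsep' fun z w => by
        rw [← C.lam_lip, h, C.lam_lip]
      rfull := fun b => SC.eq_sSup (C.rfull b)
      lfull := fun a => by
        refine SC.eq_sSup (S := {c | ∃ x y, c = C.lip x y}) (SC.mono_sub ?_ (hl a))
        rintro c ⟨x, y, h⟩
        refine SC.sub ⟨x, y, C.lam_inj _ _ fun z => ?_⟩
        rw [h, C.lam_lip]
      ress := C.X.ess
      rsep := C.X.sep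
      less := fun m => by
        refine SC.eq_sSup (S := {x | ∃ (a : A) (p : C.X.carrier), x = C.lam a p}) ?_
        refine indM C.X (SC.scl _) ?_ m
        intro x b
        refine SC.map (act_sp x) ?_ (C.rfull b)
        rintro _ ⟨y, z, rfl⟩
        exact SC.sub ⟨C.lip x y, z, (C.lam_lip _ _ _).symm⟩
      lsep := fun m n h => by
        apply ip_ext (A := B)
        intro y
        apply rsepA C.hB
        intro b
        refine SC.ind (P := fun b => b * qip B y m = b * qip B y n)
          (SCl.eq (mul_sp' _) (mul_sp' _)) ?_ (C.rfull b)
        rintro _ ⟨w, x, rfl⟩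
        rw [← ip_act, ← ip_act, ← C.lam_lip, ← C.lam_lip, h]
      imp1 := C.lam_lip
      imp2 := fun x y b => C.lam_inj _ _ fun z => by
        rw [C.lam_lip, C.lam_lip, act_ip, ss, act_mul] }

end Ctx

namespace Eqv
variable {A B : Type u} [InvQuantale A] [InvQuantale B] (E : Eqv A B)

/-- realization of `B` -/
noncomputable def zr : E.ctx.Rl (E.symm.ctx.X) (selfObj B E.hB) := ⟨E.ζ.app _, E.hζ _⟩

theorem th_zr (b : B) (y : E.symm.ctx.X.carrier) (z : E.ctx.X.carrier) :
    toB E.hB (E.ctx.th E.zr (E.symm.ctx.lam b y) z) = b * toB E.hB (E.ctx.th E.zr y z) := by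
  have e1 : Tm E.hA (E.symm.ctx.lam b y) = Tm E.hA y ≫ E.symm.m (lmulHom B E.hB b) :=
    (Tm_comp _ _ _).symm
  have e2 := E.symm.et_nat (lmulHom B E.hB b)
  have e3 : E.ctx.th E.zr (E.symm.ctx.lam b y) z
      = (E.symm.et _).1 ((E.m (Tm E.hA (E.symm.ctx.lam b y))).1 z) := rfl
  have e4 : (E.m (Tm E.hA (E.symm.ctx.lam b y))).1 z
      = (E.m (E.symm.m (lmulHom B E.hB b))).1 ((E.m (Tm E.hA y)).1 z) := by
    rw [e1]; exact E.F_comp _ _ _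
  rw [e3, e4]
  exact congrArg (fun f => f.1 ((E.m (Tm E.hA y)).1 z)) e2

theorem hl (a : A) : a ∈ SC {c : A | ∃ x y : E.ctx.X.carrier,
    ∀ z, E.ctx.lam c z = qact x (qip B y z)} := by
  refine SC.mono_sub ?_ (E.symm.ctx.full_ip a)
  rintro _ ⟨m, y, b, rfl⟩
  refine SC.map (f := fun b => qip A m (E.symm.ctx.lam b y))
    ((ip_sp m).comp (E.symm.ctx.lam_sp y)) ?_ (essA E.hB b)
  rintro _ ⟨b1, b2, rfl⟩
  refine SC.sub ⟨E.ctx.ths E.zr m (ofB E.hB b1), E.ctx.ths E.zr y (ofB E.hB (star b2)), fun z => ?_⟩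
  have e := E.ctx.ths_th E.zr m (E.symm.ctx.lam (b1 * b2) y) z
  refine e.symm.trans ?_
  have e1 : E.ctx.th E.zr (E.symm.ctx.lam (b1 * b2) y) z =
      qact (ofB E.hB b1) (b2 * toB E.hB (E.ctx.th E.zr y z)) :=
    (E.th_zr (b1 * b2) y z).trans (mul_assoc' _ _ _)
  rw [e1, Adj_lin (E.ctx.ths_Adj E.zr m)]
  congr 1
  rw [← star_ip, ← E.ctx.th_adj, star_ip, self_ip, toB_ofB, ss]

noncomputable def imprim : ImprimObj A B := E.ctx.imp E.hl

end Eqv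
end MC

namespace MC


section Centre
variable {A : Type u} [InvQuantale A]

theorem cen_sp (f : Cen A) : SP f.1 := f.2.1

theorem cen_of {h : A → A} (h1 : SP h) (h2 : ∀ a b, h (a * b) = h a * b)
    (h3 : ∀ a b, h (a * b) = a * h b) : IsCen A h := by
  refine ⟨h1, h2, h3, ⟨fun b => star (h (star b)), fun a b => ?_⟩, fun b => star (h (star b)),
    fun a b => ?_⟩
  · show star (h a) * b = star a * star (h (star b))
    rw [← sm, ← h2, h3, sm, ss]
  · rw [ss, ← h2, h3]

theorem cen_comm (hA : InvQuantale.MReg A) (f g : Cen A) (s : A) : f.1 (g.1 s) = g.1 (f.1 s) := by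
  refine indA hA (P := fun s => f.1 (g.1 s) = g.1 (f.1 s)) ?_ ?_ s
  · exact SCl.eq ((cen_sp f).comp (cen_sp g)) ((cen_sp g).comp (cen_sp f))
  · intro p q
    rw [g.2.2.1, f.2.2.2.1, f.2.2.2.1, g.2.2.1]
end Centre

namespace Imp
variable {A B : Type u} [InvQuantale A] [InvQuantale B]

theorem lsp (W : ImprimObj A B) (x : W.carrier) : SP (fun a => W.lact a x) := fun S => W.imprim.bimod.sSup_lact S x
theorem lsp' (W : ImprimObj A B) (a : A) : SP (fun x => W.lact a x) := fun S => W.imprim.bimod.lact_sSup a S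
theorem lact_mul (W : ImprimObj A B) (a b : A) (x : W.carrier) : W.lact (a * b) x = W.lact a (W.lact b x) :=
  W.imprim.bimod.lact_mul a b x
theorem lact_act (W : ImprimObj A B) (a : A) (x : W.carrier) (b : B) : W.lact a (qact x b) = qact (W.lact a x) b :=
  W.imprim.bimod.lact_act a x b

theorem lfull (W : ImprimObj A B) (a : A) : a ∈ SC {c : A | ∃ x y : W.carrier, c = W.lip x y} :=
  ⟨_, fun _ h => h.1, W.imprim.lfull a⟩
theorem rfull (W : ImprimObj A B) (b : B) : b ∈ SC {c : B | ∃ x y : W.carrier, c = qip B x y} :=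
  ⟨_, fun _ h => h.1, W.imprim.rfull b⟩
theorem less (W : ImprimObj A B) (x : W.carrier) : x ∈ SC {c : W.carrier | ∃ (a : A) (p : W.carrier), c = W.lact a p} :=
  ⟨_, fun _ h => h.1, W.imprim.less x⟩
theorem ress (W : ImprimObj A B) (x : W.carrier) : x ∈ SC {c : W.carrier | ∃ (p : W.carrier) (b : B), c = qact p b} :=
  ⟨_, fun _ h => h.1, W.imprim.ress x⟩

theorem rfull' (W : ImprimObj A B) (b : B) :
    b ∈ SC {c : B | ∃ (x : W.carrier) (r : A) (y : W.carrier), c = qip B x (W.lact r y)} := by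
  refine SC.mono_sub ?_ (rfull W b)
  rintro _ ⟨x, y, rfl⟩
  refine SC.map (ip_sp x) ?_ (less W y)
  rintro _ ⟨a, p, rfl⟩
  exact SC.sub ⟨x, a, p, rfl⟩

theorem faith (hA : InvQuantale.MReg A) (W : ImprimObj A B) {a a' : A} (h : ∀ x, W.lact a x = W.lact a' x) : a = a' := by
  apply lsepA hA
  intro c
  refine SC.ind (P := fun c => a * c = a' * c) (SCl.eq (mul_sp a) (mul_sp a')) ?_ (lfull W c)
  rintro _ ⟨x, y, rfl⟩
  rw [W.imprim.lip_lact, W.imprim.lip_lact, h]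

theorem faith' (hA : InvQuantale.MReg A) (W : ImprimObj A B) {a a' : A} (h : ∀ (x : W.carrier) (b : B), W.lact a (qact x b) = W.lact a' (qact x b)) :
    a = a' := by
  apply faith hA W
  intro x
  refine SC.ind (P := fun x => W.lact a x = W.lact a' x) (SCl.eq (lsp' W a) (lsp' W a')) ?_ (ress W x)
  rintro _ ⟨p, b, rfl⟩
  exact h p b

/-- the graph of the map induced by a central map -/
def R (W : ImprimObj A B) (f : A → A) (b b' : B) : Prop :=
  ∀ (s : A) (z : W.carrier), W.lact s (qact z b') = W.lact (f s) (qact z b)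

theorem R_uniq (hB : InvQuantale.MReg B) (W : ImprimObj A B) {f : A → A} {b b' b'' : B} (h : R W f b b') (h' : R W f b b'') : b' = b'' := by
  apply rsepA hB
  intro c
  refine SC.ind (P := fun c => c * b' = c * b'') (SCl.eq (mul_sp' _) (mul_sp' _)) ?_ (rfull W c)
  rintro _ ⟨w, z, rfl⟩
  rw [← ip_act, ← ip_act]
  congr 1
  apply W.imprim.lsep
  intro s
  rw [h s z, h' s z]

theorem R_iSup (W : ImprimObj A B) {f : A → A} {ι : Type u} {b b' : ι → B} (h : ∀ i, R W f (b i) (b' i)) :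
    R W f (⨆ i, b i) (⨆ i, b' i) := by
  intro s z
  rw [qact_iSup_right, qact_iSup_right, (lsp' W _).map_iSup, (lsp' W _).map_iSup]
  exact iSup_congr fun i => h i s z

theorem R_gen (W : ImprimObj A B) (f : Cen A) (x : W.carrier) (r : A) (y : W.carrier) :
    R W f.1 (qip B x (W.lact r y)) (qip B x (W.lact (f.1 r) y)) := by
  intro s z
  rw [← W.imprim.imp1, ← W.imprim.imp1, ← lact_mul, ← lact_mul, ← lact_mul, ← lact_mul]
  congr 1
  rw [← f.2.2.2.1, f.2.2.1, f.2.2.1]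

theorem R_ex (W : ImprimObj A B) (f : Cen A) (b : B) : ∃ b', R W f.1 b b' := by
  refine SC.ind (P := fun b => ∃ b', R W f.1 b b') ?_ ?_ (rfull' W b)
  · apply SCl.exists'
    intro ι g g' h
    exact R_iSup W h
  · rintro _ ⟨x, r, y, rfl⟩
    exact ⟨_, R_gen W f x r y⟩

/-- the induced map -/
noncomputable def gf (W : ImprimObj A B) (f : Cen A) (b : B) : B := (R_ex W f b).choose

theorem R_gf (W : ImprimObj A B) (f : Cen A) (b : B) : R W f.1 b (gf W f b) := (R_ex W f b).choose_spec

theorem gf_eq (hB : InvQuantale.MReg B) (W : ImprimObj A B) {f : Cen A} {b b' : B} (h : R W f.1 b b') : gf W f b = b' :=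
  R_uniq hB W (R_gf W f b) h

theorem gf_sp (hB : InvQuantale.MReg B) (W : ImprimObj A B) (f : Cen A) : SP (gf W f) := by
  apply SP.of_iSup
  intro ι g
  exact gf_eq hB W (R_iSup W fun i => R_gf W f (g i))

theorem gf_cen (hB : InvQuantale.MReg B) (W : ImprimObj A B) (f : Cen A) : IsCen B (gf W f) := by
  apply cen_of (gf_sp hB W f)
  · intro b c
    apply gf_eq hB W
    intro s z
    rw [act_mul, act_mul, lact_act, R_gf W f b s z, ← lact_act]
  · intro b c
    apply gf_eq hB W
    intro s z
    rw [act_mul, act_mul, R_gf W f c s]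

/-- the isomorphism of centres -/
noncomputable def gam (hB : InvQuantale.MReg B) (W : ImprimObj A B) (f : Cen A) : Cen B := ⟨gf W f, gf_cen hB W f⟩

theorem gam_inj (hA : InvQuantale.MReg A) (hB : InvQuantale.MReg B) (W : ImprimObj A B) : Function.Injective (gam hB W) := by
  intro f g h
  apply Subtype.ext
  funext s
  apply faith' hA W
  intro x b
  have e : gf W f b = gf W g b := congrArg (fun k => k.1 b) h
  rw [← R_gf W f b s x, e, R_gf W g b s x]

theorem gam_surj (hA : InvQuantale.MReg A) (hB : InvQuantale.MReg B) (W : ImprimObj A B) : Function.Surjective (gam hB W) := by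
  intro h
  have ex : ∀ s : A, ∃ t : A, ∀ (z : W.carrier) (b : B),
      W.lact t (qact z b) = W.lact s (qact z (h.1 b)) := by
    have hc : SCl (fun s : A => ∃ t : A, ∀ (z : W.carrier) (b : B),
      W.lact t (qact z b) = W.lact s (qact z (h.1 b))) := by
      apply SCl.exists'
      intro ι f g hfg z b
      rw [(lsp W _).map_iSup, (lsp W _).map_iSup]
      exact iSup_congr fun i => hfg i z b
    intro s
    refine SC.ind hc ?_ (lfull W s)
    rintro _ ⟨x, y, rfl⟩
    have hx : SP (fun x => W.lip x y) := fun S => W.imprim.sSup_lip S y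
    refine SC.ind (hc.comp hx) ?_ (ress W x)
    rintro _ ⟨x, c, rfl⟩
    refine ⟨W.lip (qact x (h.1 c)) y, fun z b => ?_⟩
    rw [W.imprim.imp1, W.imprim.imp1, ← act_mul, ← act_mul, ip_act, ip_act]
    congr 1
    rw [← h.2.2.1, h.2.2.2.1, h.2.2.2.1]
  choose f hf using ex
  have fc : IsCen A f := by
    apply cen_of
    · apply SP.of_iSup
      intro ι g
      apply faith' hA W
      intro x b
      rw [hf, (lsp W _).map_iSup, (lsp W _).map_iSup]
      exact iSup_congr fun i => (hf (g i) x b).symm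
    · intro s t
      apply faith' hA W
      intro x b
      rw [hf, lact_mul, lact_mul, lact_act W t x b, hf, lact_act W t x (h.1 b)]
    · intro s t
      apply faith' hA W
      intro x b
      rw [hf, lact_mul, lact_mul, hf]
  refine ⟨⟨f, fc⟩, Subtype.ext (funext fun b => ?_)⟩
  exact gf_eq hB W fun s z => (hf s z b).symm

theorem gf_gen (hB : InvQuantale.MReg B) (W : ImprimObj A B) (f : Cen A) (x : W.carrier) (r : A) (y : W.carrier) :
    gf W f (qip B x (W.lact r y)) = qip B x (W.lact (f.1 r) y) := gf_eq hB W (R_gen W f x r y)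

theorem final (hA : InvQuantale.MReg A) (hB : InvQuantale.MReg B) (W : ImprimObj A B) : ∃ (γ : Cen A → Cen B),
      Function.Bijective γ ∧
      (∀ (ι : Type u) (f : ι → Cen A) (F : Cen A),
        (∀ a : A, F.1 a = ⨆ i, (f i).1 a) →
        ∀ b : B, (γ F).1 b = ⨆ i, (γ (f i)).1 b) ∧
      (∀ f g fg : Cen A, fg.1 = f.1 ∘ g.1 → (γ fg).1 = (γ f).1 ∘ (γ g).1) ∧
      (∀ f fs : Cen A, (fs.1 = fun a => Star.star (f.1 (Star.star a))) →
        (γ fs).1 = fun b => Star.star ((γ f).1 (Star.star b))) ∧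
      (∀ (f : Cen A) (S : Set (W.carrier × A × W.carrier)),
        (γ f).1 (⨆ p ∈ S, qip B p.1 (W.lact p.2.1 p.2.2)) =
          ⨆ p ∈ S, qip B p.1 (W.lact (f.1 p.2.1) p.2.2)) := by
  refine ⟨gam hB W, ⟨gam_inj hA hB W, gam_surj hA hB W⟩, ?_, ?_, ?_, ?_⟩
  · intro ι f F h b
    apply gf_eq hB W
    intro s z
    rw [h, qact_iSup_right, (lsp' W _).map_iSup, (lsp W _).map_iSup]
    exact iSup_congr fun i => R_gf W (f i) b s z
  · intro f g fg h
    funext b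
    apply gf_eq hB W
    intro s z
    rw [h]
    show W.lact s (qact z (gf W f (gf W g b))) = W.lact (f.1 (g.1 s)) (qact z b)
    rw [R_gf W f _ s z, R_gf W g _ _ z, cen_comm hA]
  · intro f fs h
    funext b
    show gf W fs b = star (gf W f (star b))
    refine SC.ind (P := fun b => gf W fs b = star (gf W f (star b))) ?_ ?_ (rfull' W b)
    · exact SCl.eq (gf_sp hB W fs) (star_sp.comp ((gf_sp hB W f).comp star_sp))
    · rintro _ ⟨x, r, y, rfl⟩
      rw [gf_gen hB W, star_ip, W.imprim.bimod.ip_lact, gf_gen hB W, star_ip,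
        W.imprim.bimod.ip_lact, h]
  · intro f S
    show gf W f _ = _
    rw [(gf_sp hB W f).map_iSup]
    refine iSup_congr fun p => ?_
    rw [(gf_sp hB W f).map_iSup]
    exact iSup_congr fun _ => gf_gen hB W f _ _ _

end Imp
end MC

/-- If `A` and `B` are Morita equivalent m-regular involutive
quantales then `Cen(A) ≅ Cen(B)` as involutive quantales; an isomorphism `γ` is
given, via an imprimitivity `A`–`B` bimodule `X` implementing the equivalence, by
`γ(f)(⋁ᵢ ⟨xᵢ, rᵢ • yᵢ⟩_B) = ⋁ᵢ ⟨xᵢ, f(rᵢ) • yᵢ⟩_B`. -/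
theorem morita_centres_isomorphic (A B : Type u) [InvQuantale A] [InvQuantale B]
    (hA : InvQuantale.MReg A) (hB : InvQuantale.MReg B) (h : Morita A B) :
    ∃ (W : ImprimObj A B) (γ : Cen A → Cen B),
      Function.Bijective γ ∧
      (∀ (ι : Type u) (f : ι → Cen A) (F : Cen A),
        (∀ a : A, F.1 a = ⨆ i, (f i).1 a) →
        ∀ b : B, (γ F).1 b = ⨆ i, (γ (f i)).1 b) ∧
      (∀ f g fg : Cen A, fg.1 = f.1 ∘ g.1 → (γ fg).1 = (γ f).1 ∘ (γ g).1) ∧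
      (∀ f fs : Cen A, (fs.1 = fun a => Star.star (f.1 (Star.star a))) →
        (γ fs).1 = fun b => Star.star ((γ f).1 (Star.star b))) ∧
      (∀ (f : Cen A) (S : Set (W.carrier × A × W.carrier)),
        (γ f).1 (⨆ p ∈ S, qip B p.1 (W.lact p.2.1 p.2.2)) =
          ⨆ p ∈ S, qip B p.1 (W.lact (f.1 p.2.1) p.2.2)) := by
  obtain ⟨F, G, η, ζ, hη, hζ⟩ := h
  let E : MC.Eqv A B := ⟨hA, hB, F, G, η, ζ, hη, hζ⟩
  exact ⟨E.imprim, MC.Imp.final hA hB E.imprim⟩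
end

section
/- Let A and B be Morita equivalent m-regular involutive quantales which are commutative. Then A and B are isomorphic as involutive quantales. -/
universe u v w

set_option autoImplicit false

open CategoryTheory

namespace MoritaComm

open CategoryTheory

section Basic

variable {A : Type u} [InvQuantale A]

theorem hext {M N : HObj A} {f g : M ⟶ N} (h : ∀ m, f.1 m = g.1 m) : f = g :=
  Subtype.ext (funext h)

theorem ip_hom {M N : HObj A} (f : M ⟶ N) (n : N.carrier) (m : M.carrier) :
    qip A n (f.1 m) = qip A ((hStar f).1 n) m :=
  ((hStar_adj f).symm' n m).symm

theorem hom_act {M N : HObj A} (f : M ⟶ N) (m : M.carrier) (a : A) :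
    f.1 (qact m a) = qact (f.1 m) a := by
  apply QHilb.ip_sep (A := A)
  intro p
  have h1 := ip_hom f p (qact m a)
  have h2 := ip_hom f p m
  have h3 : qip A ((hStar f).1 p) m * a = qip A ((hStar f).1 p) (qact m a) :=
    QPreHilb.ip_mul _ _ _
  have h4 : qip A p (f.1 m) * a = qip A p (qact (f.1 m) a) := QPreHilb.ip_mul _ _ _
  exact h1.trans (h3.symm.trans (by rw [← h2]; exact h4))

theorem hom_iSup {M N : HObj A} (f : M ⟶ N) {ι : Sort*} (m : ι → M.carrier) :
    f.1 (⨆ i, m i) = ⨆ i, f.1 (m i) := by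
  apply QHilb.ip_sep (A := A)
  intro p
  have h1 := ip_hom f p (⨆ i, m i)
  refine h1.trans ?_
  refine (qip_iSup_right _ _).trans ?_
  refine Eq.trans ?_ (qip_iSup_right _ _).symm
  exact iSup_congr fun i => (ip_hom f p (m i)).symm

theorem hom_sSup {M N : HObj A} (f : M ⟶ N) (S : Set M.carrier) :
    f.1 (sSup S) = ⨆ x : S, f.1 x := by
  rw [sSup_eq_iSup', hom_iSup]

theorem hStar_unique {M N : HObj A} (f : M ⟶ N) (g : N ⟶ M)
    (h : IsAdjointPair A f.1 g.1) : hStar f = g := by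
  apply hext
  intro n
  apply QHilb.ip_sep (A := A)
  intro p
  exact ((hStar_adj f) p n).symm.trans (h p n)

/-- right multiplication as an endomorphism -/
def rho (cA : ∀ a b : A, a * b = b * a) (M : HObj A) (a : A) : M ⟶ M :=
  mkHom (fun m => qact m a) ⟨fun m => qact m (star a), by
    intro m n
    have h1 : star (qip A n (qact m a)) = qip A (qact m a) n := QPreHilb.star_ip _ _
    have h2 : qip A n m * a = qip A n (qact m a) := QPreHilb.ip_mul _ _ _
    have h3 : star (qip A n m) = qip A m n := QPreHilb.star_ip _ _
    have h4 : qip A m n * star a = qip A m (qact n (star a)) := QPreHilb.ip_mul _ _ _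
    rw [← h1, ← h2, InvQuantale.qstar_mul, h3, cA, h4]⟩

theorem rho_apply (cA : ∀ a b : A, a * b = b * a) (M : HObj A) (a : A) (m : M.carrier) :
    (rho cA M a).1 m = qact m a := rfl

theorem rho_nat (cA : ∀ a b : A, a * b = b * a) {M N : HObj A} (f : M ⟶ N) (a : A) :
    f ≫ rho cA N a = rho cA M a ≫ f :=
  hext fun m => (hom_act f m a).symm

theorem rho_mul (cA : ∀ a b : A, a * b = b * a) (M : HObj A) (a b : A) :
    rho cA M (a * b) = rho cA M a ≫ rho cA M b :=
  hext fun m => QMod.act_mul m a b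

theorem rho_star (cA : ∀ a b : A, a * b = b * a) (M : HObj A) (a : A) :
    rho cA M (star a) = hStar (rho cA M a) := by
  symm
  apply hStar_unique
  intro m n
  have h1 : star (qip A n (qact m a)) = qip A (qact m a) n := QPreHilb.star_ip _ _
  have h2 : qip A n m * a = qip A n (qact m a) := QPreHilb.ip_mul _ _ _
  have h3 : star (qip A n m) = qip A m n := QPreHilb.star_ip _ _
  have h4 : qip A m n * star a = qip A m (qact n (star a)) := QPreHilb.ip_mul _ _ _
  show qip A (qact m a) n = qip A m (qact n (star a))
  rw [← h1, ← h2, InvQuantale.qstar_mul, h3, cA, h4]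

theorem rho_iSup (cA : ∀ a b : A, a * b = b * a) (M : HObj A) {ι : Type u} (a : ι → A) :
    rho cA M (⨆ i, a i) = hSup (Set.range fun i => rho cA M (a i)) := by
  apply hext
  intro m
  show qact m (⨆ i, a i) = ⨆ f ∈ Set.range fun i => rho cA M (a i), (f : M ⟶ M).1 m
  rw [iSup_range, qact_iSup_right]
  rfl

/-- the morphism `a ↦ m a` -/
def lhom (hA : InvQuantale.MReg A) (M : HObj A) (m : M.carrier) : selfObj A hA ⟶ M :=
  mkHom (M := selfObj A hA) (fun (a : A) => qact m a) ⟨fun n => qip A m n, by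
    intro (a : A) n
    show qip A (qact m a) n = star a * qip A m n
    have h1 : star (qip A n (qact m a)) = qip A (qact m a) n := QPreHilb.star_ip _ _
    have h2 : qip A n m * a = qip A n (qact m a) := QPreHilb.ip_mul _ _ _
    have h3 : star (qip A n m) = qip A m n := QPreHilb.star_ip _ _
    rw [← h1, ← h2, InvQuantale.qstar_mul, h3]⟩

theorem lhom_comp (hA : InvQuantale.MReg A) {M N : HObj A} (f : M ⟶ N) (m : M.carrier) :
    lhom hA M m ≫ f = lhom hA N (f.1 m) :=
  hext fun a => hom_act f m a

theorem lhom_inj (hA : InvQuantale.MReg A) {M : HObj A} {m n : M.carrier}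
    (h : lhom hA M m = lhom hA M n) : m = n := by
  apply M.sep
  intro a
  exact congrFun (congrArg Subtype.val h) a

end Basic

section Sub

variable {A : Type u} [InvQuantale A]

/-- sup-closed subset as a complete lattice -/
@[reducible] def subLat {L : Type u} [CompleteLattice L] (P : L → Prop)
    (hsup : ∀ S : Set L, (∀ x ∈ S, P x) → P (sSup S)) : CompleteLattice {m : L // P m} :=
  letI : SupSet {m : L // P m} := ⟨fun S => ⟨sSup (Subtype.val '' S), hsup _ (by
    rintro _ ⟨x, _, rfl⟩; exact x.2)⟩⟩
  completeLatticeOfSup _ (by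
    intro S
    constructor
    · intro x hx
      exact le_sSup (α := L) ⟨x, hx, rfl⟩
    · intro y hy
      refine sSup_le (α := L) ?_
      rintro _ ⟨x, hx, rfl⟩
      exact hy hx)

theorem subLat_sSup {L : Type u} [CompleteLattice L] (P : L → Prop)
    (hsup : ∀ S : Set L, (∀ x ∈ S, P x) → P (sSup S)) (S : Set {m : L // P m}) :
    ((subLat P hsup).sSup S).1 = ⨆ x ∈ S, x.1 := by
  show sSup (Subtype.val '' S) = _
  rw [sSup_image]

theorem subLat_iSup {L : Type u} [CompleteLattice L] (P : L → Prop)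
    (hsup : ∀ S : Set L, (∀ x ∈ S, P x) → P (sSup S)) {ι : Sort*}
    (f : ι → {m : L // P m}) :
    (@iSup _ _ (subLat P hsup).toSupSet f).1 = ⨆ i, (f i).1 := by
  refine (subLat_sSup P hsup _).trans ?_
  rw [iSup_range]

/-- submodule object -/
def subObj (M : HObj A) (P : M.carrier → Prop)
    (hsup : ∀ S : Set M.carrier, (∀ x ∈ S, P x) → P (sSup S))
    (hact : ∀ m (a : A), P m → P (qact m a))
    (hess : ∀ d, P d → d ≤ sSup {x | (∃ p, P p ∧ ∃ a : A, x = qact p a) ∧ x ≤ d})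
    (hsep : ∀ d d', P d → P d' → (∀ p, P p → qip A p d = qip A p d') → d = d') : HObj A :=
  letI L := subLat P hsup
  letI Q : QHilb A {m : M.carrier // P m} :=
    { act := fun m a => ⟨qact m.1 a, hact _ _ m.2⟩
      act_mul := fun m a b => Subtype.ext (QMod.act_mul _ _ _)
      sSup_act := fun S a => Subtype.ext (by
        simp only [subLat_iSup]
        refine (congrArg (fun z => qact z a) (subLat_sSup P hsup S)).trans ?_
        simp only [qact_iSup_left])
      act_sSup := fun m S => Subtype.ext (by
        simp only [subLat_iSup]
        exact QMod.act_sSup _ _)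
      ip := fun m n => qip A m.1 n.1
      ip_mul := fun m n a => QPreHilb.ip_mul _ _ _
      sSup_ip := fun S n => by
        refine (congrArg (fun z => qip A z n.1) (subLat_sSup P hsup S)).trans ?_
        simp only [qip_iSup_left]
      ip_sSup := fun m S => by
        refine (congrArg (fun z => qip A m.1 z) (subLat_sSup P hsup S)).trans ?_
        simp only [qip_iSup_right]
      star_ip := fun m n => QPreHilb.star_ip _ _
      ip_sep := fun m n h => Subtype.ext (hsep _ _ m.2 n.2 fun p hp => h ⟨p, hp⟩) }
  { carrier := {m : M.carrier // P m}
    lat := L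
    str := Q
    ess := by
      intro d
      apply le_antisymm
      · show d.1 ≤ (sSup _ : {m : M.carrier // P m}).1
        rw [subLat_sSup]
        refine (hess d.1 d.2).trans (sSup_le ?_)
        rintro _ ⟨⟨p, hp, a, rfl⟩, hle⟩
        exact le_iSup₂_of_le (⟨qact p a, hact _ _ hp⟩ : {m : M.carrier // P m})
          ⟨⟨⟨p, hp⟩, a, rfl⟩, hle⟩ le_rfl
      · exact sSup_le fun x hx => hx.2
    sep := by
      intro m n h
      exact Subtype.ext (M.sep _ _ fun a => congrArg Subtype.val (h a)) }

theorem exists_sub (M : HObj A) (P : M.carrier → Prop)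
    (hsup : ∀ S : Set M.carrier, (∀ x ∈ S, P x) → P (sSup S))
    (hact : ∀ m (a : A), P m → P (qact m a))
    (hess : ∀ d, P d → d ≤ sSup {x | (∃ p, P p ∧ ∃ a : A, x = qact p a) ∧ x ≤ d})
    (hsep : ∀ d d', P d → P d' → (∀ p, P p → qip A p d = qip A p d') → d = d') :
    ∃ (D : HObj A) (i : D.carrier → M.carrier), Function.Injective i ∧ (∀ d, P (i d)) ∧
      (∀ m, P m → ∃ d, i d = m) ∧
      (∀ d e, qip A d e = qip A (i d) (i e)) ∧
      (∀ S : Set D.carrier, i (sSup S) = ⨆ x ∈ S, i x) := by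
  refine ⟨subObj M P hsup hact hess hsep, fun d => Subtype.val (p := P) d, ?_, ?_, ?_, ?_, ?_⟩
  · exact Subtype.val_injective
  · exact fun d => Subtype.property (p := P) d
  · exact fun m hm => ⟨(⟨m, hm⟩ : {m // P m}), rfl⟩
  · exact fun d e => rfl
  · exact fun S => subLat_sSup P hsup S

end Sub

section Mult

variable {B : Type u} [InvQuantale B]

theorem mult_exists {X Y : HObj B} (K : B → (X ⟶ Y))
    (h : ∀ b c x, qact ((K b).1 x) c = (K c).1 (qact x b)) (y : X.carrier) :
    ∃ z : Y.carrier, ∀ c : B, qact z c = (K c).1 y := by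
  refine ⟨⨆ p : {p : X.carrier × B // qact p.1 p.2 ≤ y}, (K p.1.2).1 p.1.1, fun c => ?_⟩
  rw [qact_iSup_left]
  simp only [h]
  rw [← hom_iSup]
  refine congrArg (K c).1 ?_
  apply le_antisymm
  · exact iSup_le fun p => p.2
  · refine (X.ess y).le.trans (sSup_le ?_)
    rintro _ ⟨⟨p, a, rfl⟩, hle⟩
    exact le_iSup (fun p : {p : X.carrier × B // qact p.1 p.2 ≤ y} => qact p.1.1 p.1.2)
      ⟨(p, a), hle⟩

theorem mult_hom (hB : InvQuantale.MReg B) (cB : ∀ a b : B, a * b = b * a)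
    {X Y : HObj B} (K : B → (X ⟶ Y)) (L : B → (Y ⟶ X))
    (hK : ∀ b c x, qact ((K b).1 x) c = (K c).1 (qact x b))
    (hL : ∀ b c x, qact ((L b).1 x) c = (L c).1 (qact x b))
    (hKL : ∀ c, hStar (K c) = L (star c)) :
    ∃ (U : X ⟶ Y) (V : Y ⟶ X), (∀ y (c : B), qact (U.1 y) c = (K c).1 y) ∧
      (∀ z (c : B), qact (V.1 z) c = (L c).1 z) := by
  choose U hU using mult_exists K hK
  choose V hV using mult_exists L hL
  have adj : IsAdjointPair B V U := by
    intro z y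
    apply hB.2
    intro c
    show qip B (V z) y * c = qip B z (U y) * c
    have h1 : qip B z (U y) * c = qip B z (qact (U y) c) := QPreHilb.ip_mul _ _ _
    have h2 : qip B y (V z) * star c = qip B y (qact (V z) (star c)) := QPreHilb.ip_mul _ _ _
    have h3 : star (qip B y (V z)) = qip B (V z) y := QPreHilb.star_ip _ _
    have h4 : star (qip B y (qact (V z) (star c))) = qip B (qact (V z) (star c)) y :=
      QPreHilb.star_ip _ _
    rw [h1, hU, ip_hom, hKL, ← hV, ← h4, ← h2, InvQuantale.qstar_mul, h3,
      InvQuantale.qstar_star, cB]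
  exact ⟨mkHom U ⟨V, adj.symm'⟩, mkHom V ⟨U, adj⟩, hU, hV⟩

end Mult

section Key

variable {A B : Type u} [InvQuantale A] [InvQuantale B]

theorem s_nat (cB : ∀ a b : B, a * b = b * a) (F : StarFunctor A B)
    (faith : ∀ {M N : HObj A} (f g : M ⟶ N), F.toFunctor.map f = F.toFunctor.map g → f = g)
    (s : ∀ M : HObj A, B → (M ⟶ M))
    (hs : ∀ M b, F.toFunctor.map (s M b) = rho cB (F.toFunctor.obj M) b)
    {M N : HObj A} (f : M ⟶ N) (b : B) : f ≫ s N b = s M b ≫ f := by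
  apply faith
  rw [Functor.map_comp, Functor.map_comp, hs, hs, rho_nat]

theorem s_star (cB : ∀ a b : B, a * b = b * a) (F : StarFunctor A B)
    (faith : ∀ {M N : HObj A} (f g : M ⟶ N), F.toFunctor.map f = F.toFunctor.map g → f = g)
    (s : ∀ M : HObj A, B → (M ⟶ M))
    (hs : ∀ M b, F.toFunctor.map (s M b) = rho cB (F.toFunctor.obj M) b)
    (M : HObj A) (b : B) : hStar (s M b) = s M (star b) := by
  apply faith
  rw [F.map_star, hs, hs, rho_star]

theorem happ {M N : HObj A} {f g : M ⟶ N} (h : f = g) (m : M.carrier) : f.1 m = g.1 m := by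
  rw [h]

theorem key (hA : InvQuantale.MReg A) (hB : InvQuantale.MReg B)
    (cB : ∀ a b : B, a * b = b * a) (F : StarFunctor A B)
    (faith : ∀ {M N : HObj A} (f g : M ⟶ N), F.toFunctor.map f = F.toFunctor.map g → f = g)
    (full : ∀ {M N : HObj A} (h : F.toFunctor.obj M ⟶ F.toFunctor.obj N),
      ∃ f : M ⟶ N, F.toFunctor.map f = h)
    (s : ∀ M : HObj A, B → (M ⟶ M))
    (hs : ∀ M b, F.toFunctor.map (s M b) = rho cB (F.toFunctor.obj M) b)
    (M : HObj A) (m : M.carrier) :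
    m ≤ sSup {x | (∃ b m', x = (s M b).1 m') ∧ x ≤ m} := by
  have snat : ∀ {M N : HObj A} (f : M ⟶ N) (b : B), f ≫ s N b = s M b ≫ f :=
    fun f b => s_nat cB F faith s hs f b
  have sstar := s_star cB F faith s hs
  have scomm : ∀ b c x, (s M b).1 ((s M c).1 x) = (s M c).1 ((s M b).1 x) :=
    fun b c x => happ (snat (s M c) b) x
  let P : M.carrier → Prop := fun d => d ≤ sSup {x | (∃ b m', x = (s M b).1 m') ∧ x ≤ d}
  have hPs : ∀ b m', P ((s M b).1 m') := fun b m' => le_sSup ⟨⟨b, m', rfl⟩, le_rfl⟩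
  have hPeq : ∀ d, P d → d = ⨆ x : {x | (∃ b m', x = (s M b).1 m') ∧ x ≤ d}, x.1 := by
    intro d hd
    rw [← sSup_eq_iSup']
    exact le_antisymm hd (sSup_le fun x hx => hx.2)
  have mono : ∀ (x y : M.carrier) (a : A), x ≤ y → qact x a ≤ qact y a := by
    intro x y a hxy
    have h := happ (f := 𝟙 M) rfl x
    have h2 : qact (⨆ c : Bool, cond c x y) a = ⨆ c : Bool, qact (cond c x y) a :=
      qact_iSup_left _ _
    rw [iSup_bool_eq, iSup_bool_eq] at h2
    simp only [cond_true, cond_false, sup_eq_right.2 hxy] at h2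
    rw [h2]
    exact le_sup_left
  have smono : ∀ (b : B) (x y : M.carrier), x ≤ y → (s M b).1 x ≤ (s M b).1 y := by
    intro b x y hxy
    have h2 := hom_iSup (s M b) (fun c : Bool => cond c x y)
    rw [iSup_bool_eq, iSup_bool_eq] at h2
    simp only [cond_true, cond_false, sup_eq_right.2 hxy] at h2
    rw [h2]
    exact le_sup_left
  obtain ⟨D, i, inj, hiP, hPi, iip, isup⟩ := exists_sub M P
    (by
      intro S hS
      refine sSup_le fun x hx => (hS x hx).trans (sSup_le_sSup ?_)
      rintro y ⟨hy, hle⟩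
      exact ⟨hy, hle.trans (le_sSup hx)⟩)
    (by
      intro d a hd
      have h1 : qact d a = ⨆ x : {x | (∃ b m', x = (s M b).1 m') ∧ x ≤ d}, qact x.1 a := by
        conv_lhs => rw [hPeq d hd]
        exact qact_iSup_left _ _
      show qact d a ≤ _
      conv_lhs => rw [h1]
      refine iSup_le ?_
      rintro ⟨_, ⟨b, m', rfl⟩, hle⟩
      exact le_sSup ⟨⟨b, qact m' a, (hom_act _ _ _).symm⟩, mono _ _ _ hle⟩)
    (by
      intro d hd
      refine le_trans (b := sSup _) hd (sSup_le ?_)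
      rintro _ ⟨⟨b, m', rfl⟩, hle⟩
      conv_lhs => rw [M.ess m']
      rw [hom_sSup]
      refine iSup_le ?_
      rintro ⟨_, ⟨p, a, rfl⟩, hle'⟩
      exact le_sSup ⟨⟨(s M b).1 p, hPs b p, a, hom_act _ _ _⟩, (smono b _ _ hle').trans hle⟩)
    (by
      intro d d' hd hd' h
      have h1 : ∀ b, (s M b).1 d = (s M b).1 d' := by
        intro b
        apply QHilb.ip_sep (A := A)
        intro p
        have e1 := ip_hom (s M b) p d
        have e2 := ip_hom (s M b) p d'
        rw [sstar] at e1 e2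
        exact e1.trans ((h _ (hPs _ _)).trans e2.symm)
      apply lhom_inj hA
      apply faith
      apply hext
      intro x
      apply HObj.sep
      intro b
      have h2 : lhom hA M d ≫ s M b = lhom hA M d' ≫ s M b := by
        rw [lhom_comp, lhom_comp, h1]
      have h3 := congrArg F.toFunctor.map h2
      rw [Functor.map_comp, Functor.map_comp, hs] at h3
      exact happ h3 x)
  have hch : ∀ b m', ∃ d, i d = (s M b).1 m' := fun b m' => hPi _ (hPs b m')
  choose β₀ hβ₀ using hch
  have adj : ∀ b, IsAdjointPair A (β₀ b) (fun d => (s M (star b)).1 (i d)) := by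
    intro b m' d
    show qip A (β₀ b m') d = qip A m' ((s M (star b)).1 (i d))
    rw [iip, hβ₀, hStar_adj (s M b), sstar]
  let β : B → (M ⟶ D) := fun b => mkHom (β₀ b) ⟨_, adj b⟩
  have hβ : ∀ b x, i ((β b).1 x) = (s M b).1 x := hβ₀
  let γ : B → (D ⟶ M) := fun b => mkHom (fun d => (s M b).1 (i d)) ⟨β₀ (star b), by
    have h := (adj (star b)).symm'
    rw [InvQuantale.qstar_star] at h
    exact h⟩
  have hγ : ∀ b x, (γ b).1 x = (s M b).1 (i x) := fun _ _ => rfl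
  have hβγ : ∀ b, hStar (β b) = γ (star b) := fun b => hStar_unique _ _ (adj b)
  have rβ : ∀ b c, β b ≫ s D c = s M b ≫ β c := by
    intro b c
    rw [snat]
    apply hext
    intro x
    apply inj
    show i ((β b).1 ((s M c).1 x)) = i ((β c).1 ((s M b).1 x))
    rw [hβ, hβ, scomm]
  have rγ : ∀ b c, γ b ≫ s M c = s D b ≫ γ c := by
    intro b c
    rw [← snat (γ c) b]
    apply hext
    intro x
    show (s M c).1 ((s M b).1 (i x)) = (s M b).1 ((s M c).1 (i x))
    rw [scomm]
  have rβγ : ∀ b c, β b ≫ γ c = s M c ≫ s M b := by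
    intro b c
    apply hext
    intro x
    show (s M c).1 (i ((β b).1 x)) = (s M b).1 ((s M c).1 x)
    rw [hβ, scomm]
  obtain ⟨U, V, hU, hV⟩ := mult_hom hB cB (fun b => F.toFunctor.map (β b))
    (fun b => F.toFunctor.map (γ b))
    (by
      intro b c x
      have h3 := congrArg F.toFunctor.map (rβ b c)
      rw [Functor.map_comp, Functor.map_comp, hs, hs] at h3
      exact happ h3 x)
    (by
      intro b c x
      have h3 := congrArg F.toFunctor.map (rγ b c)
      rw [Functor.map_comp, Functor.map_comp, hs, hs] at h3
      exact happ h3 x)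
    (by
      intro c
      show hStar (F.toFunctor.map (β c)) = _
      rw [← F.map_star, hβγ])
  have hUV : U ≫ V = 𝟙 _ := by
    apply hext
    intro y
    apply HObj.sep
    intro c
    apply HObj.sep
    intro d
    show qact (qact (V.1 (U.1 y)) c) d = qact (qact y c) d
    rw [hV, ← hom_act, hU]
    have h3 := congrArg F.toFunctor.map (rβγ d c)
    rw [Functor.map_comp, Functor.map_comp, hs, hs] at h3
    exact happ h3 y
  obtain ⟨f', hf'⟩ := full U
  obtain ⟨f, hf⟩ := full V
  have hff : f' ≫ f = 𝟙 _ := by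
    apply faith
    rw [Functor.map_comp, hf, hf', hUV, CategoryTheory.Functor.map_id]
  have hβf : ∀ b, β b = s M b ≫ f' := by
    intro b
    apply faith
    rw [Functor.map_comp, hs, hf']
    apply hext
    intro y
    apply HObj.sep
    intro c
    show qact ((F.toFunctor.map (β b)).1 y) c = qact (U.1 (qact y b)) c
    rw [hU]
    have h3 := congrArg F.toFunctor.map (rβ b c)
    rw [Functor.map_comp, Functor.map_comp, hs, hs] at h3
    exact happ h3 y
  have hfi : ∀ d, f.1 d = i d := by
    intro d
    have e0 : i d = ⨆ p : {p : B × M.carrier // (s M p.1).1 p.2 ≤ i d}, (s M p.1.1).1 p.1.2 := by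
      apply le_antisymm
      · refine le_trans (b := sSup _) (hiP d) (sSup_le ?_)
        rintro _ ⟨⟨b, m', rfl⟩, hle⟩
        exact le_iSup (fun p : {p : B × M.carrier // (s M p.1).1 p.2 ≤ i d} =>
          (s M p.1.1).1 p.1.2) ⟨(b, m'), hle⟩
      · exact iSup_le fun p => p.2
    have e1 : d = ⨆ p : {p : B × M.carrier // (s M p.1).1 p.2 ≤ i d}, (β p.1.1).1 p.1.2 := by
      apply inj
      rw [iSup, isup, iSup_range]
      simp only [hβ]
      exact e0
    have e2 : f.1 d = ⨆ p : {p : B × M.carrier // (s M p.1).1 p.2 ≤ i d},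
        f.1 ((β p.1.1).1 p.1.2) := by
      conv_lhs => rw [e1]
      exact hom_iSup _ _
    rw [e2]
    conv_rhs => rw [e0]
    refine iSup_congr fun p => ?_
    rw [hβf]
    exact happ hff _
  have hm : i (f'.1 m) = m := (hfi _).symm.trans (happ hff m)
  have := hiP (f'.1 m)
  rw [hm] at this
  exact this

end Key

section Equiv

variable {A B : Type u} [InvQuantale A] [InvQuantale B]

theorem eta_conj (F : StarFunctor A B) (G : StarFunctor B A)
    (η : F.toFunctor ⋙ G.toFunctor ⟶ 𝟭 (HObj A)) (hη : ∀ M : HObj A, IsUnitaryHom (η.app M))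
    {M N : HObj A} (f : M ⟶ N) :
    f = hStar (η.app M) ≫ G.toFunctor.map (F.toFunctor.map f) ≫ η.app N := by
  have h : G.toFunctor.map (F.toFunctor.map f) ≫ η.app N = η.app M ≫ f := η.naturality f
  rw [h, ← Category.assoc]
  have h2 := (hη M).2
  exact ((congrArg (fun k : M ⟶ M => k ≫ f) h2).trans (Category.id_comp f)).symm

theorem faithful_of (F : StarFunctor A B) (G : StarFunctor B A)
    (η : F.toFunctor ⋙ G.toFunctor ⟶ 𝟭 (HObj A)) (hη : ∀ M : HObj A, IsUnitaryHom (η.app M))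
    {M N : HObj A} (f g : M ⟶ N) (h : F.toFunctor.map f = F.toFunctor.map g) : f = g := by
  rw [eta_conj F G η hη f, eta_conj F G η hη g, h]

/-- conjugation by `η` recovers `G.map h` -/
theorem eta_conj' (F : StarFunctor A B) (G : StarFunctor B A)
    (η : F.toFunctor ⋙ G.toFunctor ⟶ 𝟭 (HObj A)) (hη : ∀ M : HObj A, IsUnitaryHom (η.app M))
    {M N : HObj A} (f : M ⟶ N) :
    G.toFunctor.map (F.toFunctor.map f) = η.app M ≫ f ≫ hStar (η.app N) := by
  have h : G.toFunctor.map (F.toFunctor.map f) ≫ η.app N = η.app M ≫ f := η.naturality f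
  have h1 := congrArg (fun k => k ≫ hStar (η.app N)) h
  simp only [Category.assoc] at h1
  exact ((congrArg (fun k => G.toFunctor.map (F.toFunctor.map f) ≫ k) (hη N).1).trans
    (Category.comp_id _)).symm.trans h1

theorem full_of (F : StarFunctor A B) (G : StarFunctor B A)
    (η : F.toFunctor ⋙ G.toFunctor ⟶ 𝟭 (HObj A)) (hη : ∀ M : HObj A, IsUnitaryHom (η.app M))
    (faithG : ∀ {M N : HObj B} (f g : M ⟶ N),
      G.toFunctor.map f = G.toFunctor.map g → f = g)
    {M N : HObj A} (h : F.toFunctor.obj M ⟶ F.toFunctor.obj N) :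
    ∃ f : M ⟶ N, F.toFunctor.map f = h := by
  refine ⟨hStar (η.app M) ≫ G.toFunctor.map h ≫ η.app N, faithG _ _ ?_⟩
  rw [eta_conj' F G η hη]
  apply hext
  intro x
  have h1 := happ (hη M).1 x
  have h2 : ∀ y, (hStar (η.app N)).1 ((η.app N).1 y) = y := fun y => happ (hη N).1 y
  refine (h2 _).trans ?_
  exact congrArg (G.toFunctor.map h).1 h1

theorem GF_rho (cA : ∀ a b : A, a * b = b * a) (F : StarFunctor A B) (G : StarFunctor B A)
    (η : F.toFunctor ⋙ G.toFunctor ⟶ 𝟭 (HObj A)) (hη : ∀ M : HObj A, IsUnitaryHom (η.app M))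
    (M : HObj A) (a : A) :
    G.toFunctor.map (F.toFunctor.map (rho cA M a))
      = rho cA (G.toFunctor.obj (F.toFunctor.obj M)) a := by
  rw [eta_conj' F G η hη]
  apply hext
  intro x
  have h1 : (hStar (η.app M)).1 ((η.app M).1 x) = x := happ (hη M).1 x
  show (hStar (η.app M)).1 (qact ((η.app M).1 x) a) = qact x a
  exact (hom_act (hStar (η.app M)) _ _).trans (congrArg (fun y => qact y a) h1)

/-- the correspondence between the two quantales -/
def Rel (cA : ∀ a b : A, a * b = b * a) (cB : ∀ a b : B, a * b = b * a)
    (F : StarFunctor A B) (a : A) (b : B) : Prop :=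
  ∀ M : HObj A, F.toFunctor.map (rho cA M a) = rho cB (F.toFunctor.obj M) b

theorem Rel.iSup (cA : ∀ a b : A, a * b = b * a) (cB : ∀ a b : B, a * b = b * a)
    (F : StarFunctor A B) {ι : Type u} (a : ι → A) (b : ι → B)
    (h : ∀ i, Rel cA cB F (a i) (b i)) : Rel cA cB F (⨆ i, a i) (⨆ i, b i) := by
  intro M
  rw [rho_iSup, rho_iSup, F.map_hSup, ← Set.range_comp]
  congr 2
  funext i
  exact h i M

theorem Rel.mul (cA : ∀ a b : A, a * b = b * a) (cB : ∀ a b : B, a * b = b * a)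
    (F : StarFunctor A B) {a a' : A} {b b' : B}
    (h : Rel cA cB F a b) (h' : Rel cA cB F a' b') : Rel cA cB F (a * a') (b * b') := by
  intro M
  rw [rho_mul, rho_mul, Functor.map_comp, h, h']

theorem Rel.star' (cA : ∀ a b : A, a * b = b * a) (cB : ∀ a b : B, a * b = b * a)
    (F : StarFunctor A B) {a : A} {b : B}
    (h : Rel cA cB F a b) : Rel cA cB F (star a) (star b) := by
  intro M
  rw [rho_star, rho_star, F.map_star, h]

theorem rho_self_inj (hA : InvQuantale.MReg A) (cA : ∀ a b : A, a * b = b * a) {a a' : A}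
    (h : rho cA (selfObj A hA) a = rho cA (selfObj A hA) a') : a = a' := by
  apply hA.2
  intro c
  have h1 : c * a = c * a' := happ h c
  show a * c = a' * c
  rw [cA a, cA a', h1]

theorem Rel.left_unique (hA : InvQuantale.MReg A)
    (cA : ∀ a b : A, a * b = b * a) (cB : ∀ a b : B, a * b = b * a)
    (F : StarFunctor A B)
    (faith : ∀ {M N : HObj A} (f g : M ⟶ N), F.toFunctor.map f = F.toFunctor.map g → f = g)
    {a a' : A} {b : B} (h : Rel cA cB F a b) (h' : Rel cA cB F a' b) : a = a' := by
  apply rho_self_inj hA cA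
  apply faith
  rw [h, h']

theorem Rel.right_unique (hB : InvQuantale.MReg B)
    (cA : ∀ a b : A, a * b = b * a) (cB : ∀ a b : B, a * b = b * a)
    (F : StarFunctor A B) (G : StarFunctor B A)
    (ζ : G.toFunctor ⋙ F.toFunctor ⟶ 𝟭 (HObj B)) (hζ : ∀ N : HObj B, IsUnitaryHom (ζ.app N))
    {a : A} {b b' : B} (h : Rel cA cB F a b) (h' : Rel cA cB F a b') : b = b' := by
  apply rho_self_inj hB cB
  have h1 : rho cB (F.toFunctor.obj (G.toFunctor.obj (selfObj B hB))) b
      = rho cB (F.toFunctor.obj (G.toFunctor.obj (selfObj B hB))) b' := by rw [← h, ← h']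
  rw [eta_conj G F ζ hζ (rho cB (selfObj B hB) b), eta_conj G F ζ hζ (rho cB (selfObj B hB) b'),
    GF_rho cB G F ζ hζ, GF_rho cB G F ζ hζ, h1]

theorem Rel.basic (hA : InvQuantale.MReg A) (hB : InvQuantale.MReg B)
    (cA : ∀ a b : A, a * b = b * a) (cB : ∀ a b : B, a * b = b * a)
    (F : StarFunctor A B) (G : StarFunctor B A)
    (η : F.toFunctor ⋙ G.toFunctor ⟶ 𝟭 (HObj A)) (hη : ∀ M : HObj A, IsUnitaryHom (η.app M))
    (faithF : ∀ {M N : HObj A} (f g : M ⟶ N), F.toFunctor.map f = F.toFunctor.map g → f = g)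
    (faithG : ∀ {M N : HObj B} (f g : M ⟶ N), G.toFunctor.map f = G.toFunctor.map g → f = g)
    (s : ∀ M : HObj A, B → (M ⟶ M))
    (hs : ∀ M b, F.toFunctor.map (s M b) = rho cB (F.toFunctor.obj M) b)
    (t : ∀ N : HObj B, A → (N ⟶ N))
    (ht : ∀ N a, G.toFunctor.map (t N a) = rho cA (G.toFunctor.obj N) a)
    (a : A) (b : B) :
    Rel cA cB F ((s (selfObj A hA) b).1 a) ((t (selfObj B hB) a).1 b) := by
  intro M
  have h1 : rho cA M ((s (selfObj A hA) b).1 a) = rho cA M a ≫ s M b := by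
    apply hext
    intro x
    exact (happ (s_nat cB F faithF s hs (lhom hA M x) b) a).symm
  have h2 : rho cB (F.toFunctor.obj M) ((t (selfObj B hB) a).1 b)
      = rho cB (F.toFunctor.obj M) b ≫ t (F.toFunctor.obj M) a := by
    apply hext
    intro x
    exact (happ (s_nat cA G faithG t ht (lhom hB (F.toFunctor.obj M) x) a) b).symm
  have h3 : t (F.toFunctor.obj M) a = F.toFunctor.map (rho cA M a) := by
    apply faithG
    rw [ht, GF_rho cA F G η hη]
  rw [h1, h2, h3, Functor.map_comp, hs, rho_nat]

theorem main (hA : InvQuantale.MReg A) (hB : InvQuantale.MReg B)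
    (cA : ∀ a b : A, a * b = b * a) (cB : ∀ a b : B, a * b = b * a)
    (h : Morita A B) :
    ∃ φ : A → B, Function.Bijective φ ∧
      (∀ S : Set A, φ (sSup S) = ⨆ a ∈ S, φ a) ∧
      (∀ a b : A, φ (a * b) = φ a * φ b) ∧
      (∀ a : A, φ (Star.star a) = Star.star (φ a)) := by
  obtain ⟨F, G, η, ζ, hη, hζ⟩ := h
  have faithF : ∀ {M N : HObj A} (f g : M ⟶ N),
      F.toFunctor.map f = F.toFunctor.map g → f = g := fun f g => faithful_of F G η hη f g
  have faithG : ∀ {M N : HObj B} (f g : M ⟶ N),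
      G.toFunctor.map f = G.toFunctor.map g → f = g := fun f g => faithful_of G F ζ hζ f g
  have fullF : ∀ {M N : HObj A} (h : F.toFunctor.obj M ⟶ F.toFunctor.obj N),
      ∃ f : M ⟶ N, F.toFunctor.map f = h := fun h => full_of F G η hη faithG h
  have fullG : ∀ {M N : HObj B} (h : G.toFunctor.obj M ⟶ G.toFunctor.obj N),
      ∃ f : M ⟶ N, G.toFunctor.map f = h := fun h => full_of G F ζ hζ faithF h
  have es : ∀ (M : HObj A) (b : B), ∃ f : M ⟶ M,
    F.toFunctor.map f = rho cB (F.toFunctor.obj M) b := fun M b => fullF _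
  have et : ∀ (N : HObj B) (a : A), ∃ f : N ⟶ N,
    G.toFunctor.map f = rho cA (G.toFunctor.obj N) a := fun M b => fullG _
  choose s hs using es
  choose t ht using et
  have basic := Rel.basic hA hB cA cB F G η hη faithF faithG s hs t ht
  have tot : ∀ a : A, ∃ b : B, Rel cA cB F a b := by
    intro a
    have k := key hA hB cB F faithF fullF s hs (selfObj A hA) a
    let I := {p : B × A // ((s (selfObj A hA) p.1).1 p.2 : A) ≤ a}
    have e : a = ⨆ p : I, ((s (selfObj A hA) p.1.1).1 p.1.2 : A) := by
      apply le_antisymm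
      · refine le_trans k (sSup_le ?_)
        rintro _ ⟨⟨b, m, rfl⟩, hle⟩
        exact le_iSup (fun p : I => ((s (selfObj A hA) p.1.1).1 p.1.2 : A)) ⟨(b, m), hle⟩
      · exact iSup_le fun p => p.2
    refine ⟨⨆ p : I, ((t (selfObj B hB) p.1.2).1 p.1.1 : B), ?_⟩
    have r := Rel.iSup cA cB F (ι := I) _ _ fun p => basic p.1.2 p.1.1
    exact Eq.subst (motive := fun z => Rel cA cB F z _) e.symm r
  have surj : ∀ b : B, ∃ a : A, Rel cA cB F a b := by
    intro b
    have k := key hB hA cA G faithG fullG t ht (selfObj B hB) b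
    let I := {p : A × B // ((t (selfObj B hB) p.1).1 p.2 : B) ≤ b}
    have e : b = ⨆ p : I, ((t (selfObj B hB) p.1.1).1 p.1.2 : B) := by
      apply le_antisymm
      · refine le_trans k (sSup_le ?_)
        rintro _ ⟨⟨a, m, rfl⟩, hle⟩
        exact le_iSup (fun p : I => ((t (selfObj B hB) p.1.1).1 p.1.2 : B)) ⟨(a, m), hle⟩
      · exact iSup_le fun p => p.2
    refine ⟨⨆ p : I, ((s (selfObj A hA) p.1.2).1 p.1.1 : A), ?_⟩
    have r := Rel.iSup cA cB F (ι := I) _ _ fun p => basic p.1.1 p.1.2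
    exact Eq.subst (motive := fun z => Rel cA cB F _ z) e.symm r
  choose φ hφ using tot
  have uniq : ∀ {a : A} {b : B}, Rel cA cB F a b → φ a = b := fun {a b} hab =>
    Rel.right_unique hB cA cB F G ζ hζ (hφ a) hab
  refine ⟨φ, ⟨?_, ?_⟩, ?_, ?_, ?_⟩
  · intro a a' haa
    have h1 := hφ a
    rw [haa] at h1
    exact Rel.left_unique hA cA cB F faithF h1 (hφ a')
  · intro b
    obtain ⟨a, ha⟩ := surj b
    exact ⟨a, uniq ha⟩
  · intro S
    apply uniq
    rw [sSup_eq_iSup', iSup_subtype']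
    exact Rel.iSup cA cB F _ _ fun p => hφ _
  · exact fun a b => uniq (Rel.mul cA cB F (hφ a) (hφ b))
  · exact fun a => uniq (Rel.star' cA cB F (hφ a))

end Equiv

end MoritaComm
/-- Morita equivalent commutative m-regular involutive quantales
are isomorphic as involutive quantales. -/
theorem morita_commutative_iso (A B : Type u) [InvQuantale A] [InvQuantale B]
    (hA : InvQuantale.MReg A) (hB : InvQuantale.MReg B)
    (cA : ∀ a b : A, a * b = b * a) (cB : ∀ a b : B, a * b = b * a)
    (h : Morita A B) :
    ∃ φ : A → B, Function.Bijective φ ∧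
      (∀ S : Set A, φ (sSup S) = ⨆ a ∈ S, φ a) ∧
      (∀ a b : A, φ (a * b) = φ a * φ b) ∧
      (∀ a : A, φ (Star.star a) = Star.star (φ a)) := by
  exact MoritaComm.main hA hB cA cB h
end
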